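/- arXiv:2605.15884 — 4 statements merged into one kernel-verified Lean document; each statement's English description precedes it below -/
import Mathlib

section
/- Let R be a Markov generator on n ≥ 3 states with maximum escape rate r, and let λ be a nonreal eigenvalue of R. Then there exists a cycle c of R with F_c > 0 such that |Im λ| ≤ r · tanh(F_c/(2n_c)) · sin(2π⌈(n_c − 1)/4⌉/n_c). -/
open Matrix Finset

/-- Wrapped frequency `|k|ₘ := min (k mod m) ((m - k) mod m)`. -/
def wrapIdx (m : ℕ) (k : ℤ) : ℤ :=
  min (k % (m : ℤ)) (((m : ℤ) - k) % (m : ℤ))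

/-- A cycle of the generator `R`: a cyclic sequence of `len + 3 ≥ 3` distinct
states `vert t`, each consecutive pair joined by a transition with positive
rate (the edge `vert (t+1) ← vert t` requires `R (vert (t+1)) (vert t) > 0`). -/
structure MCycle (n : ℕ) (R : Matrix (Fin n) (Fin n) ℝ) where
  len : ℕ
  vert : ZMod (len + 3) → Fin n
  inj : Function.Injective vert
  pos : ∀ t, 0 < R (vert (t + 1)) (vert t)

namespace MCycle

variable {n : ℕ} {R : Matrix (Fin n) (Fin n) ℝ}

/-- The number of states `n_c` in the cycle. -/
def size (c : MCycle n R) : ℕ := c.len + 3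

/-- `tanh (F_c / 2n_c)` where `F_c = ∑ ln (R_{ji}/R_{ij})` is the cycle
affinity; equal to `1` when `F_c = ∞` (some reverse rate vanishes). -/
noncomputable def tanhAff (c : MCycle n R) : ℝ :=
  open Classical in
  if ∀ t, 0 < R (c.vert t) (c.vert (t + 1)) then
    Real.tanh ((∑ t : ZMod (c.len + 3),
        Real.log (R (c.vert (t + 1)) (c.vert t) / R (c.vert t) (c.vert (t + 1)))) /
      (2 * (c.len + 3)))
  else 1

/-- The cycle affinity is positive, `F_c > 0` (automatic when `F_c = ∞`,
i.e. when some reverse rate vanishes). -/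
def affPos (c : MCycle n R) : Prop :=
  (∀ t, 0 < R (c.vert t) (c.vert (t + 1))) →
    0 < ∑ t : ZMod (c.len + 3),
      Real.log (R (c.vert (t + 1)) (c.vert t) / R (c.vert t) (c.vert (t + 1)))

/-- The cycle `c` is admissible for `u`: `u` is nonzero on the vertices of `c`
and the edge ratios all lie in a common open half-plane of `ℂ`. -/
def Admissible (c : MCycle n R) (u : Fin n → ℂ) : Prop :=
  (∀ t, u (c.vert t) ≠ 0) ∧
  ∃ z : ℂ, ∀ t, 0 < ((starRingEnd ℂ) z * (u (c.vert (t + 1)) / u (c.vert t))).re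

/-- The branch parameter `φ  = Arg ∑ exp (i Arg (u_j/u_i))` determined by the
average phase vector of the edge ratios of `u` along `c`. -/
noncomputable def branchPhi (c : MCycle n R) (u : Fin n → ℂ) : ℝ :=
  Complex.arg (∑ t : ZMod (c.len + 3),
    Complex.exp (Complex.I * (Complex.arg (u (c.vert (t + 1)) / u (c.vert t)) : ℂ)))

/-- The winding number `ω_c(u) = |(1/2π) ∑ arg_φ (u_j/u_i)|_{n_c}`, where
`arg_φ z := Arg (exp (-iφ) z) + φ` (the sum divided by `2π` is an integer
whenever the cycle is admissible for `u`). -/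
noncomputable def winding (c : MCycle n R) (u : Fin n → ℂ) : ℤ :=
  wrapIdx (c.len + 3) (round ((∑ t : ZMod (c.len + 3),
    (Complex.arg (Complex.exp (-(Complex.I * (c.branchPhi u : ℂ))) *
        (u (c.vert (t + 1)) / u (c.vert t))) + c.branchPhi u)) / (2 * Real.pi)))

end MCycle

/-- A matrix with nonnegative entries has a nonzero nonnegative vector whose flows balance. -/
theorem exists_balanced_weight {ι : Type*} [Fintype ι] [DecidableEq ι] [Nonempty ι]
    (K : ι → ι → ℝ) (hK : ∀ i j, 0 ≤ K i j) :
    ∃ v : ι → ℝ, (∀ i, 0 ≤ v i) ∧ v ≠ 0 ∧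
      ∀ i, v i * ∑ j, K j i = ∑ j, K i j * v j := by
  set M : Matrix ι ι ℝ := Matrix.of K - Matrix.diagonal (fun i => ∑ j, K j i) with hM
  have hdet : M.det = 0 := by
    refine Matrix.exists_vecMul_eq_zero_iff.mp ⟨fun _ => 1, ?_, ?_⟩
    · intro h
      obtain ⟨i⟩ := ‹Nonempty ι›
      simpa using congrFun h i
    · rw [hM, Matrix.vecMul_sub]
      funext i
      simp [Matrix.vecMul, dotProduct, Matrix.diagonal_apply]
  obtain ⟨v, hv0, hv⟩ := Matrix.exists_mulVec_eq_zero_iff.mpr hdet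
  have hbal : ∀ i, v i * ∑ j, K j i = ∑ j, K i j * v j := by
    intro i
    have h := congrFun hv i
    rw [hM, Matrix.sub_mulVec] at h
    simp only [Pi.sub_apply, Matrix.mulVec_diagonal, Pi.zero_apply] at h
    simp only [Matrix.mulVec, dotProduct, Matrix.of_apply] at h
    linarith
  have hle : ∀ i ∈ univ, |v i| * ∑ j, K j i ≤ ∑ j, K i j * |v j| := by
    intro i _
    calc |v i| * ∑ j, K j i = |v i * ∑ j, K j i| := by
          rw [abs_mul, abs_of_nonneg (sum_nonneg fun j _ => hK j i)]
      _ = |∑ j, K i j * v j| := by rw [hbal]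
      _ ≤ ∑ j, |K i j * v j| := abs_sum_le_sum_abs _ _
      _ = ∑ j, K i j * |v j| := by
          simp_rw [abs_mul, abs_of_nonneg (hK i _)]
  have hsum : ∑ i, |v i| * ∑ j, K j i = ∑ i, ∑ j, K i j * |v j| := by
    rw [sum_comm]
    refine sum_congr rfl fun i _ => ?_
    rw [mul_sum]
    exact sum_congr rfl fun j _ => mul_comm _ _
  refine ⟨fun i => |v i|, fun i => abs_nonneg _, ?_, fun i => ?_⟩
  · intro h
    exact hv0 (funext fun i => abs_eq_zero.mp (congrFun h i))
  · exact (sum_eq_sum_iff_of_le hle).mp hsum i (mem_univ i)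

/-- A relation without loops and two-cycles, in which every step can be
continued, contains a simple cycle of length at least three. -/
theorem exists_simple_cycle {ι : Type*} [Finite ι] (E : ι → ι → Prop)
    (hasymm : ∀ i j, E i j → ¬ E j i) (hne : ∃ i j, E i j)
    (hsucc : ∀ i j, E i j → ∃ k, E j k) :
    ∃ (l : ℕ) (vert : ZMod (l + 3) → ι), Function.Injective vert ∧
      ∀ t, E (vert t) (vert (t + 1)) := by
  have hs : ∀ a : {i // ∃ j, E i j}, ∃ b : {i // ∃ j, E i j}, E a b := by
    rintro ⟨i, j, hij⟩
    exact ⟨⟨j, hsucc i j hij⟩, hij⟩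
  choose s hs using hs
  obtain ⟨i₀, hi₀⟩ := hne
  obtain ⟨p, q, hpq, heq⟩ := Finite.exists_ne_map_eq_of_infinite
    (fun k : ℕ => s^[k] (⟨i₀, hi₀⟩ : {i // ∃ j, E i j}))
  obtain ⟨x, m, hm, hx⟩ : ∃ x, ∃ m, 0 < m ∧ Function.IsPeriodicPt s m x := by
    have key : ∀ a b : ℕ, a < b →
        s^[a] (⟨i₀, hi₀⟩ : {i // ∃ j, E i j}) = s^[b] ⟨i₀, hi₀⟩ →
        ∃ x, ∃ m, 0 < m ∧ Function.IsPeriodicPt s m x := by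
      intro a b hab h
      refine ⟨s^[a] ⟨i₀, hi₀⟩, b - a, by omega, ?_⟩
      rw [Function.IsPeriodicPt, Function.IsFixedPt, ← Function.iterate_add_apply,
        Nat.sub_add_cancel hab.le, h]
    rcases lt_or_gt_of_ne hpq with h | h
    · exact key p q h heq
    · exact key q p h heq.symm
  have hpos := hx.minimalPeriod_pos hm
  have hper := Function.isPeriodicPt_minimalPeriod s x
  have h1 : Function.minimalPeriod s x ≠ 1 := by
    intro h
    have hfix : s x = x := by simpa [h] using hper.eq
    have := hs x
    rw [hfix] at this
    exact hasymm _ _ this this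
  have h2 : Function.minimalPeriod s x ≠ 2 := by
    intro h
    have hfix : s (s x) = x := by simpa [h] using hper.eq
    have := hs (s x)
    rw [hfix] at this
    exact hasymm _ _ (hs x) this
  obtain ⟨l, hl⟩ : ∃ l, Function.minimalPeriod s x = l + 3 :=
    ⟨Function.minimalPeriod s x - 3, by omega⟩
  refine ⟨l, fun t => (s^[t.val] x : ι), ?_, ?_⟩
  · intro t t' h
    refine ZMod.val_injective _ (Function.iterate_injOn_Iio_minimalPeriod (f := s) (x := x)
      ?_ ?_ (Subtype.ext h))
    · simpa [hl] using ZMod.val_lt t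
    · simpa [hl] using ZMod.val_lt t'
  · intro t
    have hmod : ∀ k, s^[k % (l + 3)] x = s^[k] x := fun k => by
      rw [← hl, Function.iterate_mod_minimalPeriod_eq]
    have hval : s^[(t + 1).val] x = s (s^[t.val] x) := by
      rw [ZMod.val_add, ZMod.val_one'' (by omega), hmod, Function.iterate_succ_apply']
    simp only [hval]
    exact hs _

/-- A nonzero nonnegative circulation of nonpositive total cost carries a simple cycle of
nonpositive cost. -/
theorem exists_cycle_cost_nonpos {ι : Type*} [Fintype ι] [DecidableEq ι] (g : ι → ι → ℝ)
    (m : ℕ) : ∀ f : ι → ι → ℝ, (∀ i j, 0 ≤ f i j) → (∀ i, ∑ j, f i j = ∑ j, f j i) →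
      (∀ i j, 0 < f i j → ¬ 0 < f j i) → (∃ i j, 0 < f i j) →
      #{e : ι × ι | 0 < f e.1 e.2} = m → ∑ i, ∑ j, f i j * g i j ≤ 0 →
      ∃ (l : ℕ) (vert : ZMod (l + 3) → ι), Function.Injective vert ∧
        (∀ t, 0 < f (vert t) (vert (t + 1))) ∧ ∑ t, g (vert t) (vert (t + 1)) ≤ 0 := by
  induction m using Nat.strong_induction_on with
  | _ m ih =>
  intro f hf hcirc hasymm hne hm hcost
  have hsucc : ∀ i j, 0 < f i j → ∃ k, 0 < f j k := by
    intro i j hij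
    have h : 0 < ∑ k, f j k := by
      rw [hcirc]
      exact sum_pos' (fun k _ => hf k j) ⟨i, mem_univ i, hij⟩
    obtain ⟨k, _, hk⟩ := exists_lt_of_sum_lt (s := univ) (f := fun _ : ι => (0 : ℝ))
      (g := fun k => f j k) (by simpa using h)
    exact ⟨k, hk⟩
  obtain ⟨l, vert, hinj, hvert⟩ :=
    exists_simple_cycle (fun i j => 0 < f i j) hasymm hne hsucc
  by_cases hg : ∑ t, g (vert t) (vert (t + 1)) ≤ 0
  · exact ⟨l, vert, hinj, hvert, hg⟩
  push Not at hg
  obtain ⟨t₀, -, ht₀⟩ := exists_min_image univ (fun t => f (vert t) (vert (t + 1)))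
    univ_nonempty
  set δ := f (vert t₀) (vert (t₀ + 1)) with hδ
  set c : ι → ι → ℝ := fun i j =>
    ∑ t, if vert t = i ∧ vert (t + 1) = j then (1 : ℝ) else 0 with hc
  have hcv : ∀ t, c (vert t) (vert (t + 1)) = 1 := by
    intro t
    rw [hc]
    simp only
    rw [sum_eq_single t]
    · simp
    · intro t' _ ht'
      rw [if_neg]
      exact fun h => ht' (hinj h.1)
    · simp
  have hc0 : ∀ i j, (¬ ∃ t, vert t = i ∧ vert (t + 1) = j) → c i j = 0 := by
    intro i j h
    refine sum_eq_zero fun t _ => if_neg fun h' => h ⟨t, h'⟩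
  have hle : ∀ i j, 0 ≤ f i j - δ * c i j := by
    intro i j
    by_cases h : ∃ t, vert t = i ∧ vert (t + 1) = j
    · obtain ⟨t, rfl, rfl⟩ := h
      rw [hcv]
      linarith [ht₀ t (mem_univ t)]
    · rw [hc0 i j h]
      simpa using hf i j
  have hcnn : ∀ i j, 0 ≤ c i j := fun i j =>
    sum_nonneg fun t _ => by split_ifs <;> norm_num
  have hle' : ∀ i j, 0 < f i j - δ * c i j → 0 < f i j := by
    intro i j h
    nlinarith [hcnn i j, hvert t₀]
  have hcsum : ∀ i, ∑ j, c i j = ∑ j, c j i := by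
    intro i
    rw [hc]
    simp only
    rw [sum_comm, sum_comm (s := (univ : Finset ι))]
    have h1 : ∀ t, ∑ j, (if vert t = i ∧ vert (t + 1) = j then (1 : ℝ) else 0) =
        if vert t = i then 1 else 0 := by
      intro t; by_cases h : vert t = i <;> simp [h]
    have h2 : ∀ t, ∑ j, (if vert t = j ∧ vert (t + 1) = i then (1 : ℝ) else 0) =
        if vert (t + 1) = i then 1 else 0 := by
      intro t; by_cases h : vert (t + 1) = i <;> simp [h]
    simp_rw [h1, h2]
    exact (Equiv.sum_comp (Equiv.addRight (1 : ZMod (l + 3)))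
      (fun t => if vert t = i then (1 : ℝ) else 0)).symm
  have hcg : ∑ i, ∑ j, c i j * g i j = ∑ t, g (vert t) (vert (t + 1)) := by
    rw [hc]
    simp only [sum_mul, ite_mul, one_mul, zero_mul]
    have : ∀ i, ∑ j, ∑ t, (if vert t = i ∧ vert (t + 1) = j then g i j else 0) =
        ∑ t, ∑ j, (if vert t = i ∧ vert (t + 1) = j then g i j else 0) := fun i => sum_comm
    simp_rw [this]
    rw [sum_comm]
    refine sum_congr rfl fun t _ => ?_
    rw [sum_eq_single (vert t), sum_eq_single (vert (t + 1))]
    · simp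
    · intro j _ hj
      exact if_neg fun h => hj h.2.symm
    · simp
    · intro i _ hi
      exact sum_eq_zero fun j _ => if_neg fun h => hi h.1.symm
    · simp
  have hcost' : ∑ i, ∑ j, (f i j - δ * c i j) * g i j < 0 := by
    have : ∑ i, ∑ j, (f i j - δ * c i j) * g i j =
        ∑ i, ∑ j, f i j * g i j - δ * ∑ i, ∑ j, c i j * g i j := by
      simp_rw [mul_sum, ← sum_sub_distrib]
      exact sum_congr rfl fun i _ => sum_congr rfl fun j _ => by ring
    rw [this, hcg]
    nlinarith [mul_pos (hvert t₀) hg]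
  have hlt : #{e : ι × ι | 0 < f e.1 e.2 - δ * c e.1 e.2} < m := by
    rw [← hm]
    refine card_lt_card ((ssubset_iff_of_subset ?_).mpr ⟨(vert t₀, vert (t₀ + 1)), ?_, ?_⟩)
    · intro e
      simp only [mem_filter, mem_univ, true_and]
      exact hle' _ _
    · simpa using hvert t₀
    · simp [hcv, ← hδ]
  obtain ⟨l', vert', hinj', hvert', hcycle⟩ := ih _ hlt (fun i j => f i j - δ * c i j) hle
    (fun i => by simp_rw [sum_sub_distrib, ← mul_sum, hcirc i, hcsum i])
    (fun i j h h' => hasymm i j (hle' i j h) (hle' j i h'))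
    (by
      by_contra! hno
      refine hcost'.ne (sum_eq_zero fun i _ => sum_eq_zero fun j _ => ?_)
      rw [le_antisymm (hno i j) (hle i j), zero_mul]) rfl hcost'.le
  exact ⟨l', vert', hinj', fun t => hle' _ _ (hvert' t), hcycle⟩

/-- The geometric mean of a family of reals indexed by a finite type. -/
noncomputable def geomMean {τ : Type*} [Fintype τ] (f : τ → ℝ) : ℝ :=
  (∏ t, f t) ^ ((Fintype.card τ : ℝ)⁻¹)

section geomMean

variable {τ : Type*} [Fintype τ]

theorem geomMean_nonneg {f : τ → ℝ} (hf : ∀ t, 0 ≤ f t) : 0 ≤ geomMean f :=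
  Real.rpow_nonneg (prod_nonneg fun t _ => hf t) _

theorem geomMean_pos {f : τ → ℝ} (hf : ∀ t, 0 < f t) : 0 < geomMean f :=
  Real.rpow_pos_of_pos (prod_pos fun t _ => hf t) _

theorem geomMean_mul {f g : τ → ℝ} (hf : ∀ t, 0 ≤ f t) (hg : ∀ t, 0 ≤ g t) :
    geomMean (fun t => f t * g t) = geomMean f * geomMean g := by
  rw [geomMean, prod_mul_distrib, Real.mul_rpow (prod_nonneg fun t _ => hf t)
    (prod_nonneg fun t _ => hg t), geomMean, geomMean]

theorem geomMean_div {f g : τ → ℝ} (hf : ∀ t, 0 ≤ f t) (hg : ∀ t, 0 ≤ g t) :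
    geomMean (fun t => f t / g t) = geomMean f / geomMean g := by
  rw [geomMean, prod_div_distrib, Real.div_rpow (prod_nonneg fun t _ => hf t)
    (prod_nonneg fun t _ => hg t), geomMean, geomMean]

theorem card_mul_geomMean_le_sum [Nonempty τ] {f : τ → ℝ} (hf : ∀ t, 0 ≤ f t) :
    Fintype.card τ * geomMean f ≤ ∑ t, f t := by
  have hN : (0 : ℝ) < Fintype.card τ := by exact_mod_cast Fintype.card_pos
  have h := Real.geom_mean_le_arith_mean_weighted univ (fun _ : τ => (Fintype.card τ : ℝ)⁻¹) f
    (fun _ _ => by positivity) (by simp) (fun t _ => hf t)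
  rw [Real.finsetProd_rpow _ _ (fun t _ => hf t), ← mul_sum, ← geomMean] at h
  calc Fintype.card τ * geomMean f
      ≤ Fintype.card τ * ((Fintype.card τ : ℝ)⁻¹ * ∑ t, f t) := by gcongr
    _ = ∑ t, f t := by field_simp

theorem geomMean_le_one [Nonempty τ] {f : τ → ℝ} (hf : ∀ t, 0 ≤ f t) (hf1 : ∀ t, f t ≤ 1) :
    geomMean f ≤ 1 :=
  Real.rpow_le_one (prod_nonneg fun t _ => hf t) (prod_le_one (fun t _ => hf t) fun t _ => hf1 t)
    (by positivity)

theorem geomMean_one_sub_add_geomMean_le [Nonempty τ] {b : τ → ℝ} (hb : ∀ t, 0 ≤ b t)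
    (hb1 : ∀ t, b t ≤ 1) : geomMean (fun t => 1 - b t) + geomMean b ≤ 1 := by
  have hN : (0 : ℝ) < Fintype.card τ := by exact_mod_cast Fintype.card_pos
  have h1 := card_mul_geomMean_le_sum hb
  have h2 := card_mul_geomMean_le_sum (f := fun t => 1 - b t) (fun t => by linarith [hb1 t])
  simp only [sum_sub_distrib, sum_const, card_univ, nsmul_eq_mul, mul_one] at h2
  have : (Fintype.card τ : ℝ) * (geomMean (fun t => 1 - b t) + geomMean b)
      ≤ Fintype.card τ * 1 := by linarith
  exact le_of_mul_le_mul_left this hN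

/-- The averaged escape-to-frequency ratio of a cycle is at least that of the uniform cycle with
the same geometric means. -/
theorem card_mul_geomMean_mul_one_add_le [Nonempty τ] {x y b : τ → ℝ} (hx : ∀ t, 0 < x t)
    (hy : ∀ t, 0 < y t) (hb : ∀ t, 0 ≤ b t) (hb1 : ∀ t, b t < 1)
    (hxy : geomMean x = geomMean y) :
    Fintype.card τ * (geomMean x * (1 + geomMean b)) ≤
      (1 - geomMean b) * ∑ t, (x t + b t * y t) / (1 - b t) := by
  have h1b : ∀ t, 0 < 1 - b t := fun t => by linarith [hb1 t]
  have hG := geomMean_one_sub_add_geomMean_le hb fun t => (hb1 t).le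
  have hG0 : 0 < geomMean (fun t => 1 - b t) := geomMean_pos h1b
  have hby : ∀ t, 0 ≤ b t * y t := fun t => mul_nonneg (hb t) (hy t).le
  have e1 := card_mul_geomMean_le_sum (f := fun t => x t / (1 - b t))
    fun t => (div_pos (hx t) (h1b t)).le
  have e2 := card_mul_geomMean_le_sum (f := fun t => b t * y t / (1 - b t))
    fun t => div_nonneg (hby t) (h1b t).le
  rw [geomMean_div (fun t => (hx t).le) fun t => (h1b t).le] at e1
  rw [geomMean_div hby fun t => (h1b t).le, geomMean_mul hb fun t => (hy t).le, ← hxy] at e2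
  have hsum : ∑ t, (x t + b t * y t) / (1 - b t) =
      ∑ t, x t / (1 - b t) + ∑ t, b t * y t / (1 - b t) := by
    rw [← sum_add_distrib]
    exact sum_congr rfl fun t _ => add_div _ _ _
  have hS : 0 ≤ ∑ t, (x t + b t * y t) / (1 - b t) := sum_nonneg fun t _ =>
    div_nonneg (add_nonneg (hx t).le (hby t)) (h1b t).le
  calc Fintype.card τ * (geomMean x * (1 + geomMean b))
      = geomMean (fun t => 1 - b t) * (Fintype.card τ * (geomMean x / geomMean (fun t => 1 - b t))
        + Fintype.card τ * (geomMean b * geomMean x / geomMean (fun t => 1 - b t))) := by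
        field_simp
    _ ≤ geomMean (fun t => 1 - b t) * ∑ t, (x t + b t * y t) / (1 - b t) := by
        rw [hsum]
        gcongr
    _ ≤ (1 - geomMean b) * ∑ t, (x t + b t * y t) / (1 - b t) := by
        gcongr
        linarith

end geomMean

/-- Among the multiples of `2π/N`, the one with index `⌊(N + 2)/4⌋` has the largest sine. -/
theorem sin_two_pi_mul_div_le (N k : ℕ) (hN : 3 ≤ N) (hk : 2 * k ≤ N) :
    Real.sin (2 * Real.pi * k / N) ≤ Real.sin (2 * Real.pi * ((N + 2) / 4 : ℕ) / N) := by
  have hN0 : (0 : ℝ) < N := by exact_mod_cast (by omega : 0 < N)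
  have key : ∀ j : ℕ, Real.sin (2 * Real.pi * j / N) =
      Real.cos (Real.pi / (2 * N) * |(N : ℝ) - 4 * j|) := by
    intro j
    rw [← abs_of_pos (show 0 < Real.pi / (2 * N) by positivity), ← abs_mul, Real.cos_abs,
      ← Real.cos_pi_div_two_sub]
    congr 1
    field_simp
    ring
  rw [key, key]
  have h1 : |(N : ℤ) - 4 * ((N + 2) / 4 : ℕ)| ≤ |(N : ℤ) - 4 * k| := by
    rw [Int.abs_eq_natAbs, Int.abs_eq_natAbs]
    omega
  have h2 : |(N : ℤ) - 4 * k| ≤ N := by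
    rw [Int.abs_eq_natAbs]
    omega
  have h1' : |(N : ℝ) - 4 * ((N + 2) / 4 : ℕ)| ≤ |(N : ℝ) - 4 * k| := by exact_mod_cast h1
  have h2' : |(N : ℝ) - 4 * k| ≤ N := by exact_mod_cast h2
  apply Real.cos_le_cos_of_nonneg_of_le_pi (by positivity)
  · calc Real.pi / (2 * N) * |(N : ℝ) - 4 * k| ≤ Real.pi / (2 * N) * N := by gcongr
      _ ≤ Real.pi := by
        field_simp
        linarith [Real.pi_pos]
  · gcongr

theorem one_sub_two_div_le_sin (N : ℕ) (hN : 3 ≤ N) :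
    1 - 2 / (N : ℝ) ≤ Real.sin (2 * Real.pi * ((N + 2) / 4 : ℕ) / N) := by
  have hN0 : (0 : ℝ) < N := by exact_mod_cast (by omega : 0 < N)
  have hN3 : (3 : ℝ) ≤ N := by exact_mod_cast hN
  have hpi : Real.pi ^ 2 ≤ 10 := by nlinarith [Real.pi_lt_d2, Real.pi_pos]
  have h1 : |(N : ℤ) - 4 * ((N + 2) / 4 : ℕ)| ≤ 2 := by
    rw [Int.abs_eq_natAbs]
    omega
  have h1' : |(N : ℝ) - 4 * ((N + 2) / 4 : ℕ)| ≤ 2 := by exact_mod_cast h1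
  set D := (N : ℝ) - 4 * ((N + 2) / 4 : ℕ) with hD
  have hsq : D ^ 2 ≤ 4 := by
    rw [← sq_abs]
    nlinarith [abs_nonneg D]
  have hsin : Real.sin (2 * Real.pi * ((N + 2) / 4 : ℕ) / N) =
      Real.cos (Real.pi / (2 * N) * D) := by
    rw [← Real.cos_pi_div_two_sub]
    congr 1
    rw [hD]
    field_simp
    ring
  rw [hsin]
  refine le_trans ?_ Real.one_sub_sq_div_two_le_cos
  have : (Real.pi / (2 * N) * D) ^ 2 / 2 ≤ 2 / N := by
    have e : (Real.pi / (2 * N) * D) ^ 2 / 2 = Real.pi ^ 2 * D ^ 2 / (8 * N ^ 2) := by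
      field_simp
      ring
    rw [e, div_le_div_iff₀ (by positivity) hN0]
    have : Real.pi ^ 2 * D ^ 2 ≤ 10 * 4 := by gcongr
    nlinarith
  linarith

/-- Signed average times geometric mean of the sines of phases adding up to a multiple of `2π`. -/
theorem sum_sign_mul_geomMean_abs_sin_le {τ : Type*} [Fintype τ] (hN : 3 ≤ Fintype.card τ)
    (θ : τ → ℝ) (hθ : ∀ t, θ t ∈ Set.Ioc (-Real.pi) Real.pi) (hsin : ∀ t, Real.sin (θ t) ≠ 0)
    (k : ℤ) (hk : ∑ t, θ t = k * (2 * Real.pi)) :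
    (∑ t, ((SignType.sign (Real.sin (θ t)) : ℤ) : ℝ)) * geomMean (fun t => |Real.sin (θ t)|) ≤
      Fintype.card τ *
        Real.sin (2 * Real.pi * ((Fintype.card τ + 2) / 4 : ℕ) / Fintype.card τ) := by
  have hN0 : (0 : ℝ) < Fintype.card τ := by exact_mod_cast (by omega : 0 < Fintype.card τ)
  have : Nonempty τ := Fintype.card_pos_iff.mp (by omega)
  have hs1 : ∀ t, ((SignType.sign (Real.sin (θ t)) : ℤ) : ℝ) ≤ 1 := by
    intro t
    rcases lt_or_gt_of_ne (hsin t) with h | h <;> simp [h]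
  have hg0 : 0 ≤ geomMean (fun t => |Real.sin (θ t)|) := geomMean_nonneg fun t => abs_nonneg _
  by_cases hall : ∀ t, 0 < Real.sin (θ t)
  · have hθ0 : ∀ t, 0 ≤ θ t := fun t => by
      by_contra! h
      exact (hall t).not_ge (Real.sin_nonpos_of_nonpos_of_neg_pi_le h.le (hθ t).1.le)
    have hk0 : 0 ≤ k := by
      have h : 0 ≤ ∑ t, θ t := sum_nonneg fun t _ => hθ0 t
      rw [hk] at h
      exact_mod_cast nonneg_of_mul_nonneg_left h (by positivity)
    obtain ⟨k, rfl⟩ := Int.eq_ofNat_of_zero_le hk0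
    rw [Int.cast_natCast] at hk
    have hkN : 2 * k ≤ Fintype.card τ := by
      have h : ∑ t, θ t ≤ ∑ t : τ, Real.pi := sum_le_sum fun t _ => (hθ t).2
      rw [hk, sum_const, card_univ, nsmul_eq_mul] at h
      have : (2 * k : ℝ) ≤ Fintype.card τ := by
        refine le_of_mul_le_mul_right ?_ Real.pi_pos
        linarith
      exact_mod_cast this
    have hJ := strictConcaveOn_sin_Icc.concaveOn.le_map_sum (t := univ)
      (w := fun _ : τ => (Fintype.card τ : ℝ)⁻¹) (p := θ) (fun _ _ => by positivity) (by simp)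
      (fun t _ => ⟨hθ0 t, (hθ t).2⟩)
    simp only [smul_eq_mul, ← mul_sum, hk] at hJ
    have hgm := card_mul_geomMean_le_sum (f := fun t => |Real.sin (θ t)|) fun t => abs_nonneg _
    have e1 : ∑ t, ((SignType.sign (Real.sin (θ t)) : ℤ) : ℝ) = Fintype.card τ := by
      simp [hall]
    rw [e1]
    calc _ ≤ ∑ t, |Real.sin (θ t)| := hgm
      _ = Fintype.card τ * ((Fintype.card τ : ℝ)⁻¹ * ∑ t, Real.sin (θ t)) := by
        simp_rw [abs_of_pos (hall _)]
        field_simp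
      _ ≤ Fintype.card τ * Real.sin (2 * Real.pi * k / Fintype.card τ) := by
        refine mul_le_mul_of_nonneg_left (hJ.trans_eq ?_) hN0.le
        congr 1
        field_simp
      _ ≤ _ := mul_le_mul_of_nonneg_left (sin_two_pi_mul_div_le _ k hN hkN) hN0.le
  · push Not at hall
    obtain ⟨t₀, ht₀⟩ := hall
    have ht₀' := lt_of_le_of_ne ht₀ (hsin t₀)
    have hS : ∑ t, ((SignType.sign (Real.sin (θ t)) : ℤ) : ℝ) ≤ Fintype.card τ - 2 := by
      classical
      have h : ∑ t, ((SignType.sign (Real.sin (θ t)) : ℤ) : ℝ) ≤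
          ∑ t, (1 - if t = t₀ then (2 : ℝ) else 0) := by
        refine sum_le_sum fun t _ => ?_
        by_cases h : t = t₀
        · subst h
          simp [ht₀']
          norm_num
        · simpa [h] using hs1 t
      simpa [sum_sub_distrib] using h
    have hN3 : (3 : ℝ) ≤ Fintype.card τ := by exact_mod_cast hN
    have hgm : geomMean (fun t => |Real.sin (θ t)|) ≤ 1 :=
      geomMean_le_one (fun t => abs_nonneg _) fun t => Real.abs_sin_le_one _
    calc _ ≤ ((Fintype.card τ : ℝ) - 2) * geomMean (fun t => |Real.sin (θ t)|) := by gcongr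
      _ ≤ ((Fintype.card τ : ℝ) - 2) * 1 :=
        mul_le_mul_of_nonneg_left hgm (by linarith)
      _ = Fintype.card τ * (1 - 2 / (Fintype.card τ : ℝ)) := by field_simp
      _ ≤ _ := mul_le_mul_of_nonneg_left (one_sub_two_div_le_sin _ hN) hN0.le

theorem prod_add_one_eq {M : Type*} [CommMonoid M] {l : ℕ} (f : ZMod (l + 3) → M) :
    ∏ t, f (t + 1) = ∏ t, f t :=
  Equiv.prod_comp (Equiv.addRight (1 : ZMod (l + 3))) f

/-- The phases of the successive ratios along a cycle add up to a multiple of `2π`. -/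
theorem exists_sum_arg_div_eq {l : ℕ} (U : ZMod (l + 3) → ℂ) (hU : ∀ t, U t ≠ 0) :
    ∃ k : ℤ, ∑ t, Complex.arg (U (t + 1) / U t) = k * (2 * Real.pi) := by
  have hz : ∀ t, U (t + 1) / U t ≠ 0 := fun t => div_ne_zero (hU _) (hU _)
  have hprod : ∏ t, U (t + 1) / U t = 1 := by
    rw [prod_div_distrib, prod_add_one_eq U, div_self (prod_ne_zero_iff.mpr fun t _ => hU t)]
  have hexp : Complex.exp (∑ t, (Complex.arg (U (t + 1) / U t) : ℂ) * Complex.I) = 1 := by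
    rw [Complex.exp_sum]
    have h : ∀ t, Complex.exp ((Complex.arg (U (t + 1) / U t) : ℂ) * Complex.I) =
        (U (t + 1) / U t) / (‖U (t + 1) / U t‖ : ℂ) := by
      intro t
      rw [eq_div_iff (by exact_mod_cast norm_ne_zero_iff.mpr (hz t)), mul_comm,
        Complex.norm_mul_exp_arg_mul_I]
    simp_rw [h]
    rw [prod_div_distrib, hprod, ← Complex.ofReal_prod, ← norm_prod, hprod]
    simp
  obtain ⟨k, hk⟩ := Complex.exp_eq_one_iff.mp hexp
  refine ⟨k, ?_⟩
  rw [← sum_mul, ← mul_assoc (k : ℂ)] at hk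
  exact_mod_cast mul_right_cancel₀ Complex.I_ne_zero hk

/-- The frequency bound extracted from a single weighted cycle, with forward rates `p`,
backward rates `m`, and amplitudes `U`. -/
theorem cycle_frequency_bound {l : ℕ} (U : ZMod (l + 3) → ℂ) (V p m : ZMod (l + 3) → ℝ)
    (ε r : ℝ) (hr : 0 ≤ r) (hε : 0 < ε) (hV : ∀ t, 0 < V t) (hp : ∀ t, 0 < p t)
    (hm : ∀ t, 0 ≤ m t) (hlt : ∀ t, V (t + 1) * m t < V t * p t)
    (hO : ∀ t, (U (t + 1) * (starRingEnd ℂ) (U t)).im ≠ 0)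
    (hcost : ε * ∑ t, (V t * p t * ‖U t‖ ^ 2 + V (t + 1) * m t * ‖U (t + 1)‖ ^ 2) /
        ((V t * p t - V (t + 1) * m t) * |(U (t + 1) * (starRingEnd ℂ) (U t)).im|) ≤
      r * ∑ t, ((SignType.sign (U (t + 1) * (starRingEnd ℂ) (U t)).im : ℤ) : ℝ)) :
    geomMean (fun t => m t / p t) < 1 ∧
      ε ≤ r * ((1 - geomMean (fun t => m t / p t)) / (1 + geomMean (fun t => m t / p t))) *
        Real.sin (2 * Real.pi * (((l + 5) / 4 : ℕ) : ℝ) / (l + 3)) := by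
  set d : ZMod (l + 3) → ℝ := fun t => |(U (t + 1) * (starRingEnd ℂ) (U t)).im| with hd
  have hd0 : ∀ t, 0 < d t := fun t => abs_pos.mpr (hO t)
  have hU : ∀ t, U t ≠ 0 := by
    intro t h
    exact hO t (by simp [h])
  have hUn : ∀ t, 0 < ‖U t‖ := fun t => norm_pos_iff.mpr (hU t)
  set x : ZMod (l + 3) → ℝ := fun t => ‖U t‖ ^ 2 / d t with hx
  set y : ZMod (l + 3) → ℝ := fun t => ‖U (t + 1)‖ ^ 2 / d t with hy
  set b : ZMod (l + 3) → ℝ := fun t => V (t + 1) * m t / (V t * p t) with hb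
  have hVp : ∀ t, 0 < V t * p t := fun t => mul_pos (hV t) (hp t)
  have hx0 : ∀ t, 0 < x t := fun t => div_pos (pow_pos (hUn t) 2) (hd0 t)
  have hy0 : ∀ t, 0 < y t := fun t => div_pos (pow_pos (hUn _) 2) (hd0 t)
  have hb0 : ∀ t, 0 ≤ b t := fun t =>
    div_nonneg (mul_nonneg (hV _).le (hm t)) (hVp t).le
  have hb1 : ∀ t, b t < 1 := fun t => (div_lt_one (hVp t)).mpr (hlt t)
  have hxy : geomMean x = geomMean y := by
    rw [geomMean, geomMean, hx, hy, prod_div_distrib, prod_div_distrib,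
      prod_add_one_eq (fun t => ‖U t‖ ^ 2)]
  have hB : geomMean b = geomMean (fun t => m t / p t) := by
    rw [geomMean, geomMean, hb, prod_div_distrib, prod_mul_distrib, prod_mul_distrib,
      prod_add_one_eq V, mul_div_mul_left _ _ (prod_pos fun t _ => hV t).ne', prod_div_distrib]
  have hB0 : 0 ≤ geomMean b := geomMean_nonneg hb0
  have hB1 : geomMean b < 1 := by
    have h1 := geomMean_one_sub_add_geomMean_le hb0 fun t => (hb1 t).le
    have h2 : 0 < geomMean fun t => 1 - b t := geomMean_pos fun t => by linarith [hb1 t]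
    linarith
  rw [← hB]
  refine ⟨hB1, ?_⟩
  have hterm : ∀ t, (V t * p t * ‖U t‖ ^ 2 + V (t + 1) * m t * ‖U (t + 1)‖ ^ 2) /
      ((V t * p t - V (t + 1) * m t) * d t) = (x t + b t * y t) / (1 - b t) := by
    intro t
    have h1 := (hVp t).ne'
    have h2 := (hd0 t).ne'
    have h3 : V t * p t - V (t + 1) * m t ≠ 0 := (sub_pos.mpr (hlt t)).ne'
    have h4 : 1 - b t = (V t * p t - V (t + 1) * m t) / (V t * p t) := by
      simp only [hb]
      rw [sub_div, div_self h1]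
    have h5 : x t + b t * y t =
        (V t * p t * ‖U t‖ ^ 2 + V (t + 1) * m t * ‖U (t + 1)‖ ^ 2) / (V t * p t * d t) := by
      simp only [hx, hy, hb]
      rw [div_mul_div_comm, div_add_div _ _ h2 (mul_ne_zero h1 h2),
        div_eq_div_iff (mul_ne_zero h2 (mul_ne_zero h1 h2)) (mul_ne_zero h1 h2)]
      ring
    rw [h4, h5, div_div_eq_mul_div, div_mul_eq_mul_div, div_div,
      div_eq_div_iff (mul_ne_zero h3 h2) (mul_ne_zero (mul_ne_zero h1 h2) h3)]
    ring
  replace hcost : ε * ∑ t, (x t + b t * y t) / (1 - b t) ≤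
      r * ∑ t, ((SignType.sign (U (t + 1) * (starRingEnd ℂ) (U t)).im : ℤ) : ℝ) := by
    rw [← sum_congr rfl fun t _ => hterm t]
    exact hcost
  set θ : ZMod (l + 3) → ℝ := fun t => Complex.arg (U (t + 1) / U t) with hθ
  have hsin : ∀ t, Real.sin (θ t) =
      (U (t + 1) * (starRingEnd ℂ) (U t)).im / (‖U t‖ ^ 2 * ‖U (t + 1) / U t‖) := by
    intro t
    simp only [hθ]
    rw [Complex.sin_arg, ← div_div]
    congr 1
    rw [div_eq_mul_inv, Complex.inv_def, ← mul_assoc, Complex.normSq_eq_norm_sq,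
      Complex.im_mul_ofReal, div_eq_mul_inv]
  have hden : ∀ t, 0 < ‖U t‖ ^ 2 * ‖U (t + 1) / U t‖ := fun t =>
    mul_pos (pow_pos (hUn t) 2) (norm_pos_iff.mpr (div_ne_zero (hU _) (hU _)))
  have hsin0 : ∀ t, Real.sin (θ t) ≠ 0 := fun t => by
    rw [hsin]
    exact div_ne_zero (hO t) (hden t).ne'
  have hsgn : ∀ t, SignType.sign (Real.sin (θ t)) =
      SignType.sign (U (t + 1) * (starRingEnd ℂ) (U t)).im := fun t => by
    rw [hsin, div_eq_mul_inv, sign_mul, sign_pos (inv_pos.mpr (hden t)), mul_one]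
  obtain ⟨k, hk⟩ := exists_sum_arg_div_eq U hU
  have hcard : Fintype.card (ZMod (l + 3)) = l + 3 := ZMod.card _
  have hS := sum_sign_mul_geomMean_abs_sin_le (by rw [hcard]; omega) θ
    (fun t => Complex.arg_mem_Ioc _) hsin0 k hk
  simp_rw [hsgn] at hS
  have hG : geomMean (fun t => |Real.sin (θ t)|) * geomMean x = 1 := by
    rw [← geomMean_mul (fun t => abs_nonneg _) fun t => (hx0 t).le]
    have h : ∀ t, |Real.sin (θ t)| * x t = ‖U t‖ / ‖U (t + 1)‖ := by
      intro t
      have h1 := (hd0 t).ne'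
      have h2 := (hUn t).ne'
      have h3 := (hUn (t + 1)).ne'
      rw [hsin, abs_div, abs_of_pos (hden t), norm_div]
      simp only [hx]
      change d t / _ * _ = _
      field_simp
    rw [geomMean]
    simp_rw [h]
    rw [prod_div_distrib, prod_add_one_eq (fun t => ‖U t‖),
      div_self (prod_pos fun t _ => hUn t).ne', Real.one_rpow]
  have hX := card_mul_geomMean_mul_one_add_le hx0 hy0 hb0 hb1 hxy
  rw [hcard] at hS hX
  simp only [Nat.cast_add, Nat.cast_ofNat] at hS hX
  have e : (l + 3 + 2) / 4 = (l + 5) / 4 := rfl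
  rw [e] at hS
  set s := Real.sin (2 * Real.pi * (((l + 5) / 4 : ℕ) : ℝ) / (l + 3)) with hs
  set S := ∑ t, ((SignType.sign (U (t + 1) * (starRingEnd ℂ) (U t)).im : ℤ) : ℝ)
  set B := geomMean b
  set X := geomMean x
  set G := geomMean fun t => |Real.sin (θ t)|
  have hG0 : 0 ≤ G := geomMean_nonneg fun t => abs_nonneg _
  have hN : (0 : ℝ) < l + 3 := by positivity
  have h1 : (l + 3 : ℝ) * (ε * (1 + B)) ≤ (l + 3) * (r * (1 - B) * s) :=
    calc (l + 3 : ℝ) * (ε * (1 + B)) = G * (ε * ((l + 3) * (X * (1 + B)))) := by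
          linear_combination (-(l + 3 : ℝ) * ε * (1 + B)) * hG
      _ ≤ G * (ε * ((1 - B) * ∑ t, (x t + b t * y t) / (1 - b t))) := by gcongr
      _ = G * (1 - B) * (ε * ∑ t, (x t + b t * y t) / (1 - b t)) := by ring
      _ ≤ G * (1 - B) * (r * S) :=
          mul_le_mul_of_nonneg_left hcost (mul_nonneg hG0 (by linarith))
      _ = r * (1 - B) * (S * G) := by ring
      _ ≤ r * (1 - B) * ((l + 3) * s) :=
          mul_le_mul_of_nonneg_left hS (mul_nonneg hr (by linarith))
      _ = (l + 3) * (r * (1 - B) * s) := by ring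
  have h2 := le_of_mul_le_mul_left h1 hN
  calc ε ≤ r * (1 - B) * s / (1 + B) := (le_div_iff₀ (by linarith)).mpr h2
    _ = r * ((1 - B) / (1 + B)) * s := by ring

namespace MCycle

variable {n : ℕ} {R : Matrix (Fin n) (Fin n) ℝ}

/-- The geometric mean of the backward-to-forward rate ratios, which is `exp (-F_c / n_c)`. -/
theorem geomMean_ratio_eq_exp (c : MCycle n R) (h : ∀ t, 0 < R (c.vert t) (c.vert (t + 1))) :
    geomMean (fun t => R (c.vert t) (c.vert (t + 1)) / R (c.vert (t + 1)) (c.vert t)) =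
      Real.exp (-(∑ t : ZMod (c.len + 3),
        Real.log (R (c.vert (t + 1)) (c.vert t) / R (c.vert t) (c.vert (t + 1)))) /
          (c.len + 3)) := by
  have hpos : ∀ t, 0 < R (c.vert t) (c.vert (t + 1)) / R (c.vert (t + 1)) (c.vert t) :=
    fun t => div_pos (h t) (c.pos t)
  rw [geomMean, Real.rpow_def_of_pos (prod_pos fun t _ => hpos t),
    Real.log_prod fun t _ => (hpos t).ne', ZMod.card, ← sum_neg_distrib, div_eq_mul_inv]
  push_cast
  simp_rw [← Real.log_inv, inv_div]

theorem tanhAff_eq (c : MCycle n R) (hnn : ∀ t, 0 ≤ R (c.vert t) (c.vert (t + 1))) :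
    c.tanhAff =
      (1 - geomMean
          (fun t => R (c.vert t) (c.vert (t + 1)) / R (c.vert (t + 1)) (c.vert t))) /
        (1 + geomMean
          (fun t => R (c.vert t) (c.vert (t + 1)) / R (c.vert (t + 1)) (c.vert t))) := by
  by_cases h : ∀ t, 0 < R (c.vert t) (c.vert (t + 1))
  · rw [tanhAff, if_pos h, c.geomMean_ratio_eq_exp h]
    set F := ∑ t : ZMod (c.len + 3),
      Real.log (R (c.vert (t + 1)) (c.vert t) / R (c.vert t) (c.vert (t + 1)))
    have e : -F / (c.len + 3 : ℝ) =
        -(F / (2 * (c.len + 3 : ℝ))) + -(F / (2 * (c.len + 3 : ℝ))) := by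
      field_simp
      ring
    rw [e, Real.exp_add, Real.tanh_eq, Real.exp_neg]
    have := Real.exp_pos (F / (2 * (c.len + 3 : ℝ)))
    field_simp
  · rw [tanhAff, if_neg h]
    push Not at h
    obtain ⟨t, ht⟩ := h
    have h0 : geomMean
        (fun t => R (c.vert t) (c.vert (t + 1)) / R (c.vert (t + 1)) (c.vert t)) = 0 := by
      rw [geomMean, prod_eq_zero (mem_univ t), Real.zero_rpow]
      · rw [ZMod.card]
        positivity
      · rw [le_antisymm ht (hnn t), zero_div]
    rw [h0]
    norm_num

theorem affPos_of_geomMean_lt_one (c : MCycle n R)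
    (h : geomMean (fun t => R (c.vert t) (c.vert (t + 1)) / R (c.vert (t + 1)) (c.vert t)) < 1) :
    c.affPos := by
  intro hpos
  rw [c.geomMean_ratio_eq_exp hpos, Real.exp_lt_one_iff, neg_div, neg_lt_zero] at h
  exact (div_pos_iff_of_pos_right (by positivity)).mp h

end MCycle

/-- A generator with a left eigenvector `u` of frequency `lam.im > 0` has a cycle, carried by a
net flow balanced with respect to `|Im (u j * conj (u i))|`, that bounds the frequency. -/
theorem exists_cycle_of_left_eigenvector {n : ℕ} (R : Matrix (Fin n) (Fin n) ℝ)
    (hoff : ∀ i j, i ≠ j → 0 ≤ R i j) (hcol : ∀ i, ∑ j, R j i = 0)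
    (r : ℝ) (hr : ∀ i, -R i i ≤ r) (lam : ℂ) (hlam : 0 < lam.im)
    (u : Fin n → ℂ) (hu0 : u ≠ 0) (hu : ∀ i, ∑ j, u j * (R j i : ℂ) = lam * u i) :
    ∃ c : MCycle n R, c.affPos ∧
      lam.im ≤ r * c.tanhAff *
        Real.sin (2 * Real.pi * (((c.len + 5) / 4 : ℕ) : ℝ) / (c.len + 3)) := by
  set ε := lam.im with hε
  obtain ⟨i₀, hi₀⟩ := Function.ne_iff.mp hu0
  have : Nonempty (Fin n) := ⟨i₀⟩
  have hr0 : 0 ≤ r := by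
    have h : R i₀ i₀ + ∑ j ∈ univ.erase i₀, R j i₀ = 0 := by
      rw [add_sum_erase univ (fun j => R j i₀) (mem_univ i₀), hcol]
    have h' : 0 ≤ ∑ j ∈ univ.erase i₀, R j i₀ :=
      sum_nonneg fun j hj => hoff _ _ (ne_of_mem_erase hj)
    linarith [hr i₀]
  set O : Fin n → Fin n → ℝ := fun i j => (u j * (starRingEnd ℂ) (u i)).im with hO
  have hOanti : ∀ i j, O j i = -O i j := by
    intro i j
    simp only [hO, Complex.mul_im, Complex.conj_re, Complex.conj_im]
    ring
  have hOself : ∀ i, O i i = 0 := fun i => by linarith [hOanti i i]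
  have hOsum : ∀ i, ∑ j, R j i * O i j = ε * ‖u i‖ ^ 2 := by
    intro i
    have h := congrArg (fun z => (z * (starRingEnd ℂ) (u i)).im) (hu i)
    simp only [sum_mul, Complex.im_sum] at h
    rw [mul_assoc, Complex.mul_conj, Complex.im_mul_ofReal, Complex.normSq_eq_norm_sq] at h
    rw [hε, ← h]
    refine sum_congr rfl fun j _ => ?_
    simp only [hO]
    rw [mul_right_comm, Complex.im_mul_ofReal, mul_comm]
  set K : Fin n → Fin n → ℝ := fun j i => R j i * |O i j| with hK
  have hK0 : ∀ j i, 0 ≤ K j i := by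
    intro j i
    by_cases h : j = i
    · subst h
      simp [hK, hOself]
    · exact mul_nonneg (hoff j i h) (abs_nonneg _)
  have hind : ∀ j i, (0 : ℝ) ≤ if u i = 0 ∧ j = i₀ then 1 else 0 := fun j i => by
    split_ifs <;> norm_num
  obtain ⟨v, hv0, hvne, hvbal⟩ := exists_balanced_weight
    (fun j i => K j i + if u i = 0 ∧ j = i₀ then 1 else 0)
    fun j i => add_nonneg (hK0 j i) (hind j i)
  have hvz : ∀ i, u i = 0 → v i = 0 := by
    intro i hi
    have h := hvbal i
    have hrhs : ∑ j, (K i j + if u j = 0 ∧ i = i₀ then 1 else 0) * v j = 0 := by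
      refine sum_eq_zero fun j _ => ?_
      have hne : i ≠ i₀ := fun h => hi₀ (by rw [← h, hi]; rfl)
      simp [hK, hO, hi, hne]
    have hlhs : 0 < ∑ j, (K j i + if u i = 0 ∧ j = i₀ then (1 : ℝ) else 0) := by
      refine sum_pos' (fun j _ => add_nonneg (hK0 j i) (hind j i)) ⟨i₀, mem_univ _, ?_⟩
      simp only [hi, and_self, if_true]
      linarith [hK0 i₀ i]
    rw [hrhs] at h
    exact (mul_eq_zero.mp h).resolve_right hlhs.ne'
  have hKbal : ∀ i, ∑ j, v i * K j i = ∑ j, v j * K i j := by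
    intro i
    have h := hvbal i
    rw [mul_sum] at h
    have hdrop : ∀ j i, v i * (K j i + if u i = 0 ∧ j = i₀ then 1 else 0) = v i * K j i := by
      intro j i
      by_cases hi : u i = 0
      · simp [hvz i hi]
      · simp [hi]
    simp_rw [mul_comm _ (v _), hdrop] at h
    exact h
  set W := ∑ i, v i * ‖u i‖ ^ 2 with hW
  have hW0 : 0 < W := by
    obtain ⟨i, hi⟩ := Function.ne_iff.mp hvne
    have hui : u i ≠ 0 := fun h => hi (hvz i h)
    exact sum_pos' (fun i _ => mul_nonneg (hv0 i) (by positivity)) ⟨i, mem_univ _,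
      mul_pos (lt_of_le_of_ne (hv0 i) (Ne.symm hi)) (pow_pos (norm_pos_iff.mpr hui) 2)⟩
  set N : Fin n → Fin n → ℝ := fun i j => v i * K j i - v j * K i j with hN
  have hNanti : ∀ i j, N j i = -N i j := fun i j => by simp only [hN]; ring
  have hNself : ∀ i, N i i = 0 := fun i => by simp [hN]
  have hNsum : ∀ i, ∑ j, N i j = 0 := fun i => by
    simp only [hN]
    rw [sum_sub_distrib, hKbal, sub_self]
  have hNeq : ∀ i j, N i j = (v i * R j i - v j * R i j) * |O i j| := fun i j => by
    simp only [hN, hK]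
    rw [hOanti i j, abs_neg]
    ring
  set f : Fin n → Fin n → ℝ := fun i j => max (N i j) 0 with hf
  have hfN : ∀ i j, f i j - f j i = N i j := fun i j => by
    simp only [hf]
    rw [hNanti i j]
    rcases le_total 0 (N i j) with h | h
    · rw [max_eq_left h, max_eq_right (by linarith)]
      ring
    · rw [max_eq_right h, max_eq_left (by linarith)]
      ring
  have hfpos : ∀ i j, 0 < f i j ↔ 0 < N i j := fun i j => by simp [hf]
  set σ : Fin n → Fin n → ℝ := fun i j => ((SignType.sign (O i j) : ℤ) : ℝ) with hσ
  have hσanti : ∀ i j, σ j i = -σ i j := fun i j => by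
    simp only [hσ]
    rw [hOanti i j, Left.sign_neg]
    simp
  have hσabs : ∀ i j, |O i j| * σ i j = O i j := fun i j => by
    simp only [hσ]
    rcases lt_trichotomy (O i j) 0 with h | h | h
    · simp [h, abs_of_neg h]
    · simp [h]
    · simp [h, abs_of_pos h]
  have hflow : ∑ i, ∑ j, v i * R j i * O i j = ε * W := by
    rw [hW, mul_sum]
    refine sum_congr rfl fun i _ => ?_
    rw [mul_left_comm, ← hOsum, mul_sum]
    exact sum_congr rfl fun j _ => mul_assoc _ _ _
  have hNσ : ∑ i, ∑ j, N i j * σ i j = 2 * (ε * W) := by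
    have h : ∑ i, ∑ j, N i j * σ i j =
        ∑ i, ∑ j, v i * R j i * O i j + ∑ i, ∑ j, v j * R i j * O j i := by
      simp_rw [← sum_add_distrib]
      refine sum_congr rfl fun i _ => sum_congr rfl fun j _ => ?_
      rw [hNeq, mul_assoc, hσabs, hOanti i j]
      ring
    rw [h, sum_comm (f := fun i j => v j * R i j * O j i), hflow]
    ring
  have hfσ : ∑ i, ∑ j, f i j * σ i j = ε * W := by
    have h : ∑ i, ∑ j, N i j * σ i j =
        ∑ i, ∑ j, f i j * σ i j + ∑ i, ∑ j, f j i * σ j i := by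
      simp_rw [← sum_add_distrib]
      refine sum_congr rfl fun i _ => sum_congr rfl fun j _ => ?_
      rw [← hfN, hσanti i j]
      ring
    rw [sum_comm (f := fun i j => f j i * σ j i), hNσ] at h
    linarith
  set A : Fin n → Fin n → ℝ := fun i j => if i = j then 0 else v i * R j i * ‖u i‖ ^ 2 with hA
  have hA0 : ∀ i j, 0 ≤ A i j := fun i j => by
    simp only [hA]
    split_ifs with h
    · exact le_rfl
    · exact mul_nonneg (mul_nonneg (hv0 i) (hoff j i (Ne.symm h))) (by positivity)
  have hAsum : ∑ i, ∑ j, A i j ≤ r * W := by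
    rw [hW, mul_sum]
    refine sum_le_sum fun i _ => ?_
    have h : ∑ j, A i j = v i * ‖u i‖ ^ 2 * (-R i i) := by
      have h1 : ∀ j, A i j = v i * ‖u i‖ ^ 2 * (R j i - if i = j then R j i else 0) := by
        intro j
        simp only [hA]
        split_ifs
        · ring
        · ring
      simp_rw [h1]
      rw [← mul_sum, sum_sub_distrib, hcol]
      simp
    rw [h, mul_comm r]
    exact mul_le_mul_of_nonneg_left (hr i) (mul_nonneg (hv0 i) (by positivity))
  set g : Fin n → Fin n → ℝ := fun i j => ε * ((A i j + A j i) / N i j) - r * σ i j with hg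
  have hcost : ∑ i, ∑ j, f i j * g i j ≤ 0 := by
    set χ : Fin n → Fin n → ℝ := fun i j => if 0 < N i j then 1 else 0 with hχ
    have hχ1 : ∀ i j, χ i j + χ j i ≤ 1 := fun i j => by
      simp only [hχ]
      rw [hNanti i j]
      split_ifs <;> linarith
    have hfg : ∀ i j, f i j * g i j = ε * (χ i j * A i j + χ i j * A j i) - r * (f i j * σ i j) := by
      intro i j
      simp only [hg, hχ]
      by_cases h : 0 < N i j
      · have : f i j = N i j := max_eq_left h.le
        rw [this, if_pos h]
        field_simp
      · have : f i j = 0 := max_eq_right (not_lt.mp h)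
        rw [this, if_neg h]
        ring
    have hχA : ∑ i, ∑ j, (χ i j * A i j + χ i j * A j i) ≤ r * W := by
      refine le_trans ?_ hAsum
      simp_rw [sum_add_distrib]
      rw [sum_comm (f := fun i j => χ i j * A j i)]
      simp_rw [← sum_add_distrib]
      refine sum_le_sum fun i _ => sum_le_sum fun j _ => ?_
      rw [← add_mul]
      exact mul_le_of_le_one_left (hA0 i j) (hχ1 i j)
    simp_rw [hfg, sum_sub_distrib, ← mul_sum]
    rw [hfσ]
    linarith [mul_le_mul_of_nonneg_left hχA hlam.le]
  obtain ⟨l, vert, hinj, hvert, hvg⟩ := exists_cycle_cost_nonpos g _ f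
    (fun i j => le_max_right _ _)
    (fun i => by
      rw [← sub_eq_zero, ← sum_sub_distrib]
      simp_rw [hfN]
      exact hNsum i)
    (fun i j h h' => by
      rw [hfpos] at h h'
      linarith [hNanti i j])
    (by
      by_contra! h
      refine (mul_pos hlam hW0).ne' (hfσ ▸ sum_eq_zero fun i _ => sum_eq_zero fun j _ => ?_)
      rw [le_antisymm (h i j) (le_max_right _ _), zero_mul]) rfl hcost
  simp_rw [hfpos] at hvert
  have hne : ∀ t, vert t ≠ vert (t + 1) := fun t h => by
    have h' := hvert t
    rw [← h, hNself] at h'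
    exact lt_irrefl _ h'
  have hO0 : ∀ t, O (vert t) (vert (t + 1)) ≠ 0 := fun t h => by
    have h' := hvert t
    rw [hNeq, h, abs_zero, mul_zero] at h'
    exact lt_irrefl _ h'
  have hlt : ∀ t, v (vert (t + 1)) * R (vert t) (vert (t + 1)) <
      v (vert t) * R (vert (t + 1)) (vert t) := fun t => by
    have h' := hvert t
    rw [hNeq] at h'
    exact sub_pos.mp (pos_of_mul_pos_left h' (abs_nonneg _))
  have hback : ∀ t, 0 ≤ R (vert t) (vert (t + 1)) := fun t => hoff _ _ (hne t)
  have hvR : ∀ t, 0 < v (vert t) * R (vert (t + 1)) (vert t) := fun t =>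
    (mul_nonneg (hv0 _) (hback t)).trans_lt (hlt t)
  have hRpos : ∀ t, 0 < R (vert (t + 1)) (vert t) := fun t =>
    pos_of_mul_pos_right (hvR t) (hv0 _)
  have hvpos : ∀ t, 0 < v (vert t) := fun t => pos_of_mul_pos_left (hvR t) (hRpos t).le
  obtain ⟨hB1, hbound⟩ := cycle_frequency_bound (fun t => u (vert t)) (fun t => v (vert t))
    (fun t => R (vert (t + 1)) (vert t)) (fun t => R (vert t) (vert (t + 1))) ε r hr0 hlam
    hvpos hRpos hback hlt hO0 (by
      simp only [hg, sum_sub_distrib, ← mul_sum, sub_nonpos] at hvg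
      refine le_of_eq_of_le ?_ hvg
      congr 1
      refine sum_congr rfl fun t _ => ?_
      rw [hNeq]
      simp only [hA]
      rw [if_neg (hne t), if_neg (hne t).symm])
  let c : MCycle n R := ⟨l, vert, hinj, hRpos⟩
  refine ⟨c, c.affPos_of_geomMean_lt_one hB1, ?_⟩
  rw [c.tanhAff_eq hback]
  exact hbound

theorem multicyclic_high_frequency
    (n : ℕ) (hn : 3 ≤ n) (R : Matrix (Fin n) (Fin n) ℝ)
    (hoff : ∀ i j, i ≠ j → 0 ≤ R i j) (hcol : ∀ i, ∑ j, R j i = 0)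
    (r : ℝ) (hr : IsGreatest (Set.range fun i => -R i i) r)
    (lam : ℂ) (hlam : lam.im ≠ 0)
    (heig : ∃ v : Fin n → ℂ, v ≠ 0 ∧ R.map Complex.ofReal *ᵥ v = lam • v) :
    ∃ c : MCycle n R, c.affPos ∧
      |lam.im| ≤ r * c.tanhAff *
        Real.sin (2 * Real.pi * (((c.len + 5) / 4 : ℕ) : ℝ) / (c.len + 3)) := by
  have hr' : ∀ i, -R i i ≤ r := fun i => hr.2 ⟨i, rfl⟩
  obtain ⟨w, hw0, hw⟩ := heig
  have hdet : (R.map Complex.ofReal - Matrix.scalar (Fin n) lam).det = 0 :=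
    Matrix.exists_mulVec_eq_zero_iff.mp ⟨w, hw0, by simp [Matrix.sub_mulVec, hw]⟩
  obtain ⟨u, hu0, hu⟩ := Matrix.exists_vecMul_eq_zero_iff.mpr hdet
  have hu' : ∀ i, ∑ j, u j * (R j i : ℂ) = lam * u i := by
    intro i
    have h := congrFun hu i
    rw [Matrix.vecMul_sub] at h
    simp only [Pi.sub_apply, Matrix.vecMul, dotProduct, Matrix.map_apply, Pi.zero_apply,
      Matrix.scalar_apply, Matrix.diagonal_apply, mul_ite, mul_zero, sum_ite_eq', mem_univ,
      if_true] at h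
    rw [sub_eq_zero.mp h, mul_comm]
  rcases lt_or_gt_of_ne hlam with h | h
  · rw [abs_of_neg h, ← Complex.conj_im]
    refine exists_cycle_of_left_eigenvector R hoff hcol r hr' _ (by simpa using h)
      (fun i => (starRingEnd ℂ) (u i)) ?_ fun i => ?_
    · intro h0
      exact hu0 (funext fun i => by simpa using congrFun h0 i)
    · simpa using congrArg (starRingEnd ℂ) (hu' i)
  · rw [abs_of_pos h]
    exact exists_cycle_of_left_eigenvector R hoff hcol r hr' lam h u hu0 hu'
end

section
/- Let R be a Markov generator on n ≥ 3 states with maximum escape rate r, and let λ be a nonreal eigenvalue of R. Then −2r < Re λ < 0 and there exists a cycle c of R with F_c > 0 such that |Im λ|/(2r + Re λ) ≤ tanh(F_c/(2n_c)) · tan(π(n_c↓ − 1)/(2n_c)), where m↓ := m if m is odd and m↓ := m − 1 if m is even. -/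
open Matrix Finset

/-- A nonnegative matrix of rates restricted to a nonempty set of states has a nonnegative
stationary weight supported in that set. -/
theorem exists_stationary_weight {V : Type*} [Fintype V] [DecidableEq V] (B : V → V → ℝ)
    (hB : ∀ i j, 0 ≤ B i j) (S : Finset V) (hS : S.Nonempty) :
    ∃ p : V → ℝ, (∀ i, 0 ≤ p i) ∧ (∀ i ∉ S, p i = 0) ∧ (∃ i ∈ S, p i ≠ 0) ∧
      ∀ i ∈ S, p i * ∑ j ∈ S, B j i = ∑ j ∈ S, p j * B i j := by
  have : Nonempty S := hS.to_subtype
  let D : S → ℝ := fun i => ∑ j : S, B j i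
  let Q : Matrix S S ℝ := Matrix.of (fun i j : S => B i j) - Matrix.diagonal D
  have hQ : (fun _ => 1) ᵥ* Q = 0 := by
    ext i
    simp [Q, Matrix.vecMul, dotProduct, D, Matrix.diagonal_apply, Finset.sum_sub_distrib]
  have hdet : Q.det = 0 :=
    Matrix.exists_vecMul_eq_zero_iff.1 ⟨fun _ => 1, fun h => by
      simpa using congrFun h (Classical.arbitrary S), hQ⟩
  obtain ⟨x, hx0, hx⟩ := Matrix.exists_mulVec_eq_zero_iff.2 hdet
  have hx' : ∀ i : S, ∑ j : S, B i j * x j = D i * x i := by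
    intro i
    have := congrFun hx i
    simp only [Q, Matrix.sub_mulVec, Pi.sub_apply, Matrix.mulVec_diagonal, Pi.zero_apply] at this
    simpa [Matrix.mulVec, dotProduct, sub_eq_zero] using this
  have hD : ∀ i, 0 ≤ D i := fun i => Finset.sum_nonneg fun j _ => hB _ _
  have hle : ∀ i ∈ (univ : Finset S), D i * |x i| ≤ ∑ j : S, B i j * |x j| := by
    intro i _
    calc D i * |x i| = |∑ j : S, B i j * x j| := by rw [hx', abs_mul, abs_of_nonneg (hD i)]
      _ ≤ ∑ j : S, |B i j * x j| := Finset.abs_sum_le_sum_abs _ _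
      _ = _ := by simp only [abs_mul, abs_of_nonneg (hB _ _)]
  have hsum : ∑ i : S, D i * |x i| = ∑ i : S, ∑ j : S, B i j * |x j| := by
    rw [Finset.sum_comm]
    simp only [D, Finset.sum_mul]
  have heq := (Finset.sum_eq_sum_iff_of_le hle).1 hsum
  refine ⟨fun i => if h : i ∈ S then |x ⟨i, h⟩| else 0, fun i => ?_, fun i hi => by simp [hi],
    ?_, fun i hi => ?_⟩
  · dsimp only
    split_ifs <;> positivity
  · obtain ⟨i, hi⟩ := Function.ne_iff.1 hx0
    exact ⟨i, i.2, by simpa using hi⟩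
  · have := heq ⟨i, hi⟩ (mem_univ _)
    rw [← Finset.sum_coe_sort S, ← Finset.sum_coe_sort S]
    simp only [hi, dite_true, Subtype.coe_eta, Finset.coe_mem]
    rw [mul_comm]
    simpa only [mul_comm] using this

/-- Passing to a suitable set of states, a left eigenvector does not vanish identically on the
support of a stationary weight. -/
theorem exists_stationary_weight_not_disjoint {V : Type*} [Fintype V] [DecidableEq V]
    (R : Matrix V V ℝ) (B : V → V → ℝ) (hB : ∀ i j, 0 ≤ B i j) (u : V → ℂ) (lam : ℂ)
    (S : Finset V) (hu : ∀ i ∈ S, ∑ j ∈ S, (R j i : ℂ) * u j = lam * u i)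
    (hne : ∃ i ∈ S, u i ≠ 0) :
    ∃ (S : Finset V) (p : V → ℝ), (∀ i ∈ S, ∑ j ∈ S, (R j i : ℂ) * u j = lam * u i) ∧
      (∀ i, 0 ≤ p i) ∧ (∀ i ∉ S, p i = 0) ∧ (∃ i, p i ≠ 0 ∧ u i ≠ 0) ∧
      ∀ i ∈ S, p i * ∑ j ∈ S, B j i = ∑ j ∈ S, p j * B i j := by
  induction S using Finset.strongInduction with
  | H S ih =>
    obtain ⟨i₀, hi₀, hui₀⟩ := hne
    obtain ⟨p, hp, hpS, ⟨k, hk, hpk⟩, hbal⟩ := exists_stationary_weight B hB S ⟨i₀, hi₀⟩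
    by_cases h : ∃ i, p i ≠ 0 ∧ u i ≠ 0
    · exact ⟨S, p, hu, hp, hpS, h, hbal⟩
    · push Not at h
      refine ih (S.filter fun i => p i = 0) ?_ ?_ ⟨i₀, ?_, hui₀⟩
      · exact Finset.filter_ssubset.2 ⟨k, hk, hpk⟩
      · intro i hi
        rw [← hu i (Finset.mem_filter.1 hi).1, Finset.sum_filter]
        refine Finset.sum_congr rfl fun j _ => ?_
        split_ifs with hj
        · rfl
        · rw [h j hj, mul_zero]
      · refine Finset.mem_filter.2 ⟨hi₀, ?_⟩
        by_contra hc
        exact hui₀ (h _ hc)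

/-- The flow of a stationary weight along the transitions of a generator, together with the
quadratic identities satisfied by a left eigenvector. -/
theorem exists_circulation {V : Type*} [Fintype V] [DecidableEq V] (R : Matrix V V ℝ)
    (hoff : ∀ i j, i ≠ j → 0 ≤ R i j) (hcol : ∀ i, ∑ j, R j i = 0) (r : ℝ)
    (hr : ∀ i, -R i i ≤ r) (lam : ℂ) (u : V → ℂ) (hu0 : u ≠ 0)
    (hu : ∀ i, ∑ j, (R j i : ℂ) * u j = lam * u i) :
    ∃ (p : V → ℝ) (a : V → V → ℝ) (N : ℝ), 0 < N ∧ (∀ i, 0 ≤ p i) ∧ (∀ i j, 0 ≤ a i j) ∧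
      (∀ i j, 0 < a i j → a i j = p i * R j i ∧ a j i = p j * R i j) ∧
      (∀ i, ∑ j, a i j = ∑ j, a j i) ∧
      ∑ i, ∑ j, a i j * (starRingEnd ℂ (u i) * u j).im = lam.im * N ∧
      ∑ i, ∑ j, a i j * Complex.normSq (u i + u j) ≤ 2 * (2 * r + lam.re) * N ∧
      ∑ i, ∑ j, a i j * Complex.normSq (u i - u j) ≤ -2 * lam.re * N := by
  let B : V → V → ℝ := fun j i => if j = i then 0 else R j i
  have hB : ∀ i j, 0 ≤ B i j := by
    intro i j
    by_cases h : i = j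
    · simp [B, h]
    · simpa [B, h] using hoff i j h
  obtain ⟨S, p, huS, hp, hpS, ⟨k, hpk, huk⟩, hbal⟩ :=
    exists_stationary_weight_not_disjoint R B hB u lam univ (fun i _ => hu i)
      (by simpa using Function.ne_iff.1 hu0)
  let a : V → V → ℝ := fun i j => if j ∈ S then p i * B j i else 0
  have ha : ∀ i j, 0 ≤ a i j := by
    intro i j
    dsimp only [a]
    split_ifs
    · exact mul_nonneg (hp _) (hB _ _)
    · exact le_rfl
  have hrow : ∀ i, ∑ j, a i j = p i * ∑ j ∈ S, B j i := by
    intro i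
    simp [a, Finset.sum_ite_mem, Finset.mul_sum]
  have hcirc : ∀ i, ∑ j, a i j = ∑ j, a j i := by
    intro i
    rw [hrow]
    by_cases hi : i ∈ S
    · rw [hbal i hi]
      simp only [a, hi, if_true]
      refine Finset.sum_subset (subset_univ _) fun j _ hj => by rw [hpS j hj, zero_mul]
    · simp [a, hi, hpS i hi]
  have hout : ∀ i, ∑ j, a i j ≤ p i * -R i i := by
    intro i
    rw [hrow]
    refine mul_le_mul_of_nonneg_left ?_ (hp i)
    calc ∑ j ∈ S, B j i ≤ ∑ j, B j i :=
          Finset.sum_le_univ_sum_of_nonneg fun j => hB j i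
      _ = ∑ j, (R j i - if j = i then R j i else 0) := by
          refine Finset.sum_congr rfl fun j _ => ?_
          by_cases h : j = i <;> simp [B, h]
      _ = -R i i := by simp [Finset.sum_sub_distrib, hcol]
  have hcorr : ∀ i, ∑ j, (a i j : ℂ) * (starRingEnd ℂ (u i) * u j) =
      (p i : ℂ) * (lam - R i i) * Complex.normSq (u i) := by
    intro i
    by_cases hi : i ∈ S
    · have h1 : ∑ j, (a i j : ℂ) * (starRingEnd ℂ (u i) * u j) =
          p i * starRingEnd ℂ (u i) * ∑ j ∈ S, ((B j i : ℝ) : ℂ) * u j := by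
        rw [Finset.mul_sum, ← Finset.sum_subset (subset_univ S)]
        · refine Finset.sum_congr rfl fun j hj => ?_
          simp only [a, hj, if_true]
          push_cast
          ring
        · intro j _ hj
          simp [a, hj]
      have h2 : ∑ j ∈ S, ((B j i : ℝ) : ℂ) * u j = (lam - R i i) * u i := by
        rw [sub_mul, ← huS i hi, ← Finset.add_sum_erase S _ hi, ← Finset.add_sum_erase S _ hi]
        have h3 : ∀ j ∈ S.erase i, ((B j i : ℝ) : ℂ) * u j = (R j i : ℂ) * u j := by
          intro j hj
          simp [B, Finset.ne_of_mem_erase hj]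
        rw [Finset.sum_congr rfl h3]
        simp [B]
      rw [h1, h2, Complex.normSq_eq_conj_mul_self]
      ring
    · simp [a, hpS i hi]
  obtain ⟨d, hd⟩ : ∃ d : V → ℝ, ∀ i, d i = p i * (lam.re - R i i) := ⟨_, fun _ => rfl⟩
  have hre : ∀ i, ∑ j, a i j * (starRingEnd ℂ (u i) * u j).re = d i * Complex.normSq (u i) := by
    intro i
    have := congrArg Complex.re (hcorr i)
    rw [Complex.re_sum] at this
    simp only [Complex.re_ofReal_mul, mul_assoc] at this
    rw [this, hd]
    simp [mul_assoc]
  have him : ∀ i, ∑ j, a i j * (starRingEnd ℂ (u i) * u j).im =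
      lam.im * (p i * Complex.normSq (u i)) := by
    intro i
    have := congrArg Complex.im (hcorr i)
    rw [Complex.im_sum] at this
    simp only [Complex.im_ofReal_mul, mul_assoc] at this
    rw [this]
    simp
    ring
  have hsq : ∀ s : ℝ, ∑ i, ∑ j, a i j * (Complex.normSq (u i) + Complex.normSq (u j) +
      s * (starRingEnd ℂ (u i) * u j).re) =
      ∑ i, (2 * ∑ j, a i j + s * d i) * Complex.normSq (u i) := by
    intro s
    have h1 : ∑ i, ∑ j, a i j * Complex.normSq (u j) =
        ∑ i, ∑ j, a i j * Complex.normSq (u i) := by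
      rw [Finset.sum_comm]
      refine Finset.sum_congr rfl fun i _ => ?_
      rw [← Finset.sum_mul, ← hcirc, Finset.sum_mul]
    have h2 : ∀ i, ∑ j, a i j * (s * (starRingEnd ℂ (u i) * u j).re) =
        s * (d i * Complex.normSq (u i)) := by
      intro i
      rw [← hre, Finset.mul_sum]
      exact Finset.sum_congr rfl fun j _ => by ring
    simp only [mul_add, Finset.sum_add_distrib, h1, h2]
    simp only [← Finset.sum_mul, ← Finset.sum_add_distrib]
    exact Finset.sum_congr rfl fun i _ => by ring
  refine ⟨p, a, ∑ i, p i * Complex.normSq (u i), ?_, hp, ha, ?_, hcirc, ?_, ?_, ?_⟩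
  · exact Finset.sum_pos' (fun i _ => mul_nonneg (hp i) (Complex.normSq_nonneg _))
      ⟨k, mem_univ _, mul_pos ((hp k).lt_of_ne' hpk) (Complex.normSq_pos.2 huk)⟩
  · intro i j hij
    have hj : j ∈ S := by
      by_contra hj
      simp [a, hj] at hij
    have hne : j ≠ i := by
      rintro rfl
      simp [a, B] at hij
    have hi : i ∈ S := by
      by_contra hi
      simp [a, hpS i hi] at hij
    simp [a, B, hi, hj, hne, hne.symm]
  · rw [Finset.mul_sum]
    exact Finset.sum_congr rfl fun i _ => him i
  · have h1 : ∀ i j, Complex.normSq (u i + u j) = Complex.normSq (u i) + Complex.normSq (u j) +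
        2 * (starRingEnd ℂ (u i) * u j).re := by
      intro i j
      simp only [Complex.normSq_apply, Complex.add_re, Complex.add_im, Complex.mul_re,
        Complex.conj_re, Complex.conj_im]
      ring
    simp only [h1]
    rw [hsq, Finset.mul_sum]
    refine Finset.sum_le_sum fun i _ => ?_
    rw [← mul_assoc]
    refine mul_le_mul_of_nonneg_right ?_ (Complex.normSq_nonneg _)
    rw [hd]
    nlinarith [hout i, mul_le_mul_of_nonneg_left (hr i) (hp i)]
  · have h1 : ∀ i j, Complex.normSq (u i - u j) = Complex.normSq (u i) + Complex.normSq (u j) +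
        -2 * (starRingEnd ℂ (u i) * u j).re := by
      intro i j
      simp only [Complex.normSq_apply, Complex.sub_re, Complex.sub_im, Complex.mul_re,
        Complex.conj_re, Complex.conj_im]
      ring
    simp only [h1]
    rw [hsq, Finset.mul_sum]
    refine Finset.sum_le_sum fun i _ => ?_
    rw [← mul_assoc]
    refine mul_le_mul_of_nonneg_right ?_ (Complex.normSq_nonneg _)
    rw [hd]
    nlinarith [hout i]

/-- A function that has a successor at every vertex of a finite nonempty set has a cycle. -/
theorem exists_injective_cycle {V : Type*} [Fintype V] (f : V → V) (P : V → Prop)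
    (hP : ∀ x, P x → P (f x)) (x₀ : V) (hx₀ : P x₀) :
    ∃ (m : ℕ) (_ : NeZero m) (c : ZMod m → V), Function.Injective c ∧
      ∀ t, P (c t) ∧ c (t + 1) = f (c t) := by
  have hPi : ∀ k, P (f^[k] x₀) := by
    intro k
    induction k with
    | zero => exact hx₀
    | succ k ih => rw [Function.iterate_succ_apply']; exact hP _ ih
  obtain ⟨k, l, hkl, he⟩ : ∃ k l, k < l ∧ f^[k] x₀ = f^[l] x₀ := by
    obtain ⟨k, l, hne, he⟩ := Finite.exists_ne_map_eq_of_infinite fun k : ℕ => f^[k] x₀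
    rcases lt_or_gt_of_ne hne with h | h
    · exact ⟨k, l, h, he⟩
    · exact ⟨l, k, h, he.symm⟩
  set x := f^[k] x₀ with hx
  have hper : x ∈ Function.periodicPts f := by
    refine ⟨l - k, by omega, ?_⟩
    rw [Function.IsPeriodicPt, Function.IsFixedPt, hx, ← Function.iterate_add_apply,
      Nat.sub_add_cancel hkl.le, ← he]
  have hpos := Function.minimalPeriod_pos_of_mem_periodicPts hper
  set m := Function.minimalPeriod f x with hm
  have hm0 : NeZero m := ⟨hpos.ne'⟩
  refine ⟨m, hm0, fun t => f^[t.val] x, fun s t hst => ?_, fun t => ⟨?_, ?_⟩⟩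
  · refine ZMod.val_injective m ?_
    exact (Function.iterate_eq_iterate_iff_of_lt_minimalPeriod (ZMod.val_lt s)
      (ZMod.val_lt t)).1 hst
  · dsimp only
    rw [hx, ← Function.iterate_add_apply]
    exact hPi _
  · dsimp only
    rw [← Function.iterate_succ_apply' f, ZMod.val_add]
    have hmod : ∀ a, f^[a % m] x = f^[a] x := fun a => Function.iterate_mod_minimalPeriod_eq
    rw [hmod, ← hmod, ZMod.val_one_eq_one_mod, Nat.add_mod_mod, hmod]

/-- A functional of a circulation is negative if it is negative on every cycle, unless it is
degenerate on every edge. -/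
theorem circulation_sum_neg {V : Type*} [Fintype V] [DecidableEq V] (g h : V → V → ℝ)
    (hgh : ∀ i j, h i j = 0 → g i j = 0) (J : V → V → ℝ) (hJ : ∀ i j, 0 ≤ J i j)
    (hbal : ∀ i, ∑ j, J i j = ∑ j, J j i)
    (hcyc : ∀ (m : ℕ) (_ : NeZero m) (c : ZMod m → V), Function.Injective c →
      (∀ t, 0 < J (c t) (c (t + 1))) →
      ∑ t, g (c t) (c (t + 1)) < 0 ∨ ∀ t, h (c t) (c (t + 1)) = 0) :
    ∑ i, ∑ j, J i j * g i j < 0 ∨ ∀ i j, 0 < J i j → h i j = 0 := by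
  induction hn : (univ.filter fun e : V × V => 0 < J e.1 e.2).card using
    Nat.strong_induction_on generalizing J with
  | _ n ih =>
  by_cases hz : ∃ i j, 0 < J i j
  swap
  · right
    intro i j hij
    exact absurd ⟨i, j, hij⟩ hz
  obtain ⟨i₀, j₀, hij₀⟩ := hz
  have hnext : ∀ i, ∃ j, (∃ k, 0 < J k i) → 0 < J i j := by
    intro i
    by_cases hk : ∃ k, 0 < J k i
    · obtain ⟨k, hk⟩ := hk
      have h1 : 0 < ∑ j, J i j := by
        rw [hbal]
        exact Finset.sum_pos' (fun _ _ => hJ _ _) ⟨k, mem_univ _, hk⟩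
      obtain ⟨j, -, hj⟩ := Finset.exists_lt_of_sum_lt (f := fun _ => (0 : ℝ)) (by simpa using h1)
      exact ⟨j, fun _ => hj⟩
    · exact ⟨i, fun h => absurd h hk⟩
  choose f hf using hnext
  obtain ⟨m, hm, c, hinj, hc⟩ := exists_injective_cycle f (fun i => ∃ k, 0 < J k i)
    (fun i hi => ⟨i, hf i hi⟩) j₀ ⟨i₀, hij₀⟩
  have hpos : ∀ t, 0 < J (c t) (c (t + 1)) := fun t => by
    rw [(hc t).2]
    exact hf _ (hc t).1
  obtain ⟨t₀, -, ht₀⟩ := Finset.exists_min_image (univ : Finset (ZMod m))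
    (fun t => J (c t) (c (t + 1))) univ_nonempty
  set ε := J (c t₀) (c (t₀ + 1)) with hε
  have hε0 : 0 < ε := hpos t₀
  let K : V → V → ℝ := fun i j => ∑ t, if c t = i ∧ c (t + 1) = j then 1 else 0
  have hKc : ∀ t, K (c t) (c (t + 1)) = 1 := by
    intro t
    have : ∀ s, (c s = c t ∧ c (s + 1) = c (t + 1)) ↔ s = t :=
      fun s => ⟨fun h => hinj h.1, by rintro rfl; exact ⟨rfl, rfl⟩⟩
    simp [K, this, Finset.filter_eq']
  have hK : ∀ i j, (K i j = 0) ∨ ∃ t, i = c t ∧ j = c (t + 1) := by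
    intro i j
    by_cases he : ∃ t, i = c t ∧ j = c (t + 1)
    · exact Or.inr he
    · left
      push Not at he
      exact Finset.sum_eq_zero fun t _ => if_neg fun ht => he t ht.1.symm ht.2.symm
  have hKsum : ∀ G : V → V → ℝ, ∑ i, ∑ j, K i j * G i j = ∑ t, G (c t) (c (t + 1)) := by
    intro G
    simp only [K, Finset.sum_mul]
    have : ∀ i, ∑ j, ∑ t, (if c t = i ∧ c (t + 1) = j then (1 : ℝ) else 0) * G i j =
        ∑ t, if c t = i then G i (c (t + 1)) else 0 := by
      intro i
      rw [Finset.sum_comm]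
      refine Finset.sum_congr rfl fun t _ => ?_
      by_cases hi : c t = i <;> simp [hi]
    simp only [this]
    rw [Finset.sum_comm]
    simp
  have hKbal : ∀ i, ∑ j, K i j = ∑ j, K j i := by
    intro i
    have h1 : ∑ j, K i j = ∑ t, if c t = i then (1 : ℝ) else 0 := by
      simp only [K]
      rw [Finset.sum_comm]
      refine Finset.sum_congr rfl fun t _ => ?_
      by_cases hi : c t = i <;> simp [hi]
    have h2 : ∑ j, K j i = ∑ t, if c (t + 1) = i then (1 : ℝ) else 0 := by
      simp only [K]
      rw [Finset.sum_comm]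
      refine Finset.sum_congr rfl fun t _ => ?_
      by_cases hi : c (t + 1) = i <;> simp [hi]
    rw [h1, h2]
    exact (Equiv.sum_comp (Equiv.addRight (1 : ZMod m))
      fun t => if c t = i then (1 : ℝ) else 0).symm
  let J' : V → V → ℝ := fun i j => J i j - ε * K i j
  have hJ' : ∀ i j, 0 ≤ J' i j := by
    intro i j
    rcases hK i j with h0 | ⟨t, rfl, rfl⟩
    · simpa [J', h0] using hJ i j
    · simpa [J', hKc] using ht₀ t (mem_univ t)
  have hJle : ∀ i j, 0 < J' i j → 0 < J i j := by
    intro i j hij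
    rcases hK i j with h0 | ⟨t, rfl, rfl⟩
    · simpa [J', h0] using hij
    · exact hpos t
  have hcard : (univ.filter fun e : V × V => 0 < J' e.1 e.2).card < n := by
    rw [← hn]
    refine Finset.card_lt_card ⟨fun e he => ?_, fun hsub => ?_⟩
    · simp only [mem_filter, mem_univ, true_and] at he ⊢
      exact hJle _ _ he
    · have := @hsub (c t₀, c (t₀ + 1)) (by simpa using hpos t₀)
      simp [J', hKc, hε] at this
  have hrec := ih _ hcard J' hJ'
    (fun i => by simp only [J', Finset.sum_sub_distrib, ← Finset.mul_sum, hbal i, hKbal i])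
    (fun m hm c hinj hc => hcyc m hm c hinj fun t => hJle _ _ (hc t)) rfl
  have hdecomp : ∑ i, ∑ j, J i j * g i j =
      ∑ i, ∑ j, J' i j * g i j + ε * ∑ t, g (c t) (c (t + 1)) := by
    rw [← hKsum, Finset.mul_sum, ← Finset.sum_add_distrib]
    refine Finset.sum_congr rfl fun i _ => ?_
    rw [Finset.mul_sum, ← Finset.sum_add_distrib]
    exact Finset.sum_congr rfl fun j _ => by simp only [J']; ring
  have hJ'0 : (∀ i j, 0 < J' i j → h i j = 0) → ∑ i, ∑ j, J' i j * g i j = 0 := by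
    intro h0
    refine Finset.sum_eq_zero fun i _ => Finset.sum_eq_zero fun j _ => ?_
    rcases (hJ' i j).eq_or_lt with hij | hij
    · rw [← hij, zero_mul]
    · rw [hgh _ _ (h0 i j hij), mul_zero]
  rcases hcyc m hm c hinj hpos with h1 | h1
  · left
    rw [hdecomp]
    have := mul_neg_of_pos_of_neg hε0 h1
    rcases hrec with h2 | h2
    · linarith
    · linarith [hJ'0 h2]
  · have h3 : ∑ t, g (c t) (c (t + 1)) = 0 := Finset.sum_eq_zero fun t _ => hgh _ _ (h1 t)
    rcases hrec with h2 | h2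
    · left
      rw [hdecomp, h3]
      linarith
    · right
      intro i j hij
      rcases hK i j with h0 | ⟨t, rfl, rfl⟩
      · exact h2 i j (by simpa [J', h0] using hij)
      · exact h1 t

/-- The action of a circular arc of half-angle `α` between two points of the plane, for a charged
particle in a uniform magnetic field. -/
noncomputable def arcAction (α : ℝ) (w w' : ℂ) : ℝ :=
  Real.cot α / 2 * Complex.normSq (w' - w) - (starRingEnd ℂ w * w').im

theorem arcAction_add_le {α β : ℝ} (hα : 0 < α) (hβ : 0 < β) (hαβ : α + β < Real.pi)
    (w v w' : ℂ) : arcAction (α + β) w w' ≤ arcAction α w v + arcAction β v w' := by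
  have hsα := Real.sin_pos_of_pos_of_lt_pi hα (by linarith)
  have hsβ := Real.sin_pos_of_pos_of_lt_pi hβ (by linarith)
  have hs := Real.sin_pos_of_pos_of_lt_pi (add_pos hα hβ) hαβ
  have hsum : Real.cot α + Real.cot β =
      Real.sin (α + β) / (Real.sin α * Real.sin β) := by
    rw [Real.cot_eq_cos_div_sin, Real.cot_eq_cos_div_sin, Real.sin_add]
    field_simp
    ring
  have hpos : 0 < Real.cot α + Real.cot β := by
    rw [hsum]
    positivity
  have hcot : Real.cot (α + β) * (Real.cot α + Real.cot β) = Real.cot α * Real.cot β - 1 := by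
    rw [hsum, Real.cot_eq_cos_div_sin, Real.cot_eq_cos_div_sin, Real.cot_eq_cos_div_sin]
    field_simp
    rw [Real.cos_add]
  refine le_of_mul_le_mul_right ?_ (mul_pos two_pos hpos)
  simp only [arcAction, Complex.normSq_apply, Complex.sub_re, Complex.sub_im, Complex.mul_im,
    Complex.conj_re, Complex.conj_im]
  generalize Real.cot α = p at *
  generalize Real.cot β = q at *
  generalize Real.cot (α + β) = s at *
  obtain ⟨x, y⟩ := w
  obtain ⟨x', y'⟩ := v
  obtain ⟨x'', y''⟩ := w'
  dsimp only
  have h1 := sq_nonneg (p * (x' - x) - (y' - y) - q * (x'' - x') - (y'' - y'))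
  have h2 := sq_nonneg (p * (y' - y) + (x' - x) - q * (y'' - y') + (x'' - x'))
  have h3 : s * (p + q) * ((x'' - x) * (x'' - x) + (y'' - y) * (y'' - y)) =
    (p * q - 1) * ((x'' - x) * (x'' - x) + (y'' - y) * (y'' - y)) := by rw [hcot]
  nlinarith [h1, h2, h3]

theorem arcAction_sum_le (α : ℕ → ℝ) (hα : ∀ k, 0 < α k) (w : ℕ → ℂ) (K : ℕ)
    (hK : ∑ k ∈ range (K + 1), α k < Real.pi) :
    arcAction (∑ k ∈ range (K + 1), α k) (w 0) (w (K + 1)) ≤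
      ∑ k ∈ range (K + 1), arcAction (α k) (w k) (w (k + 1)) := by
  induction K with
  | zero => simp
  | succ K ih =>
    rw [Finset.sum_range_succ] at hK ⊢
    rw [Finset.sum_range_succ _ (K + 1)]
    have := ih (by linarith [hα (K + 1)])
    have := arcAction_add_le (Finset.sum_pos (fun k _ => hα k) ⟨0, by simp⟩) (hα (K + 1)) hK
      (w 0) (w (K + 1)) (w (K + 1 + 1))
    linarith

/-- Isoperimetric inequality for closed polygons. -/
theorem arcAction_sum_nonneg_of_closed (α : ℕ → ℝ) (hα : ∀ k, 0 < α k) (w : ℕ → ℂ) (K : ℕ)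
    (hK : ∑ k ∈ range (K + 2), α k ≤ Real.pi) (hw : w (K + 2) = w 0) :
    0 ≤ ∑ k ∈ range (K + 2), arcAction (α k) (w k) (w (k + 1)) := by
  rw [Finset.sum_range_succ] at hK ⊢
  have hlt : ∑ k ∈ range (K + 1), α k < Real.pi := by linarith [hα (K + 1)]
  have h0 : 0 < ∑ k ∈ range (K + 1), α k := Finset.sum_pos (fun k _ => hα k) ⟨0, by simp⟩
  have h1 := arcAction_sum_le α hα w K hlt
  have hβ := hα (K + 1)
  rw [show K + 1 + 1 = K + 2 from rfl, hw]
  generalize ∑ k ∈ range (K + 1), α k = A at *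
  generalize α (K + 1) = β at *
  have hsA := Real.sin_pos_of_pos_of_lt_pi h0 hlt
  have hsβ := Real.sin_pos_of_pos_of_lt_pi hβ (by linarith)
  have hs := Real.sin_nonneg_of_nonneg_of_le_pi (add_pos h0 hβ).le hK
  have hsum : 0 ≤ Real.cot A + Real.cot β := by
    have : Real.cot A + Real.cot β = Real.sin (A + β) / (Real.sin A * Real.sin β) := by
      rw [Real.cot_eq_cos_div_sin, Real.cot_eq_cos_div_sin, Real.sin_add]
      field_simp
      ring
    rw [this]
    positivity
  refine le_trans ?_ (add_le_add_left h1 _)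
  have h2 : arcAction A (w 0) (w (K + 1)) + arcAction β (w (K + 1)) (w 0) =
      (Real.cot A + Real.cot β) / 2 * Complex.normSq (w 0 - w (K + 1)) := by
    simp only [arcAction, Complex.normSq_apply, Complex.sub_re, Complex.sub_im, Complex.mul_im,
      Complex.conj_re, Complex.conj_im]
    ring
  rw [h2]
  exact mul_nonneg (by linarith) (Complex.normSq_nonneg _)

/-- Isoperimetric inequality for half of a centrally symmetric polygon. -/
theorem arcAction_sum_nonneg_of_antiperiodic (α : ℕ → ℝ) (hα : ∀ k, 0 < α k) (w : ℕ → ℂ) (K : ℕ)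
    (hK : ∑ k ∈ range (K + 1), α k ≤ Real.pi / 2) (hw : w (K + 1) = -w 0) :
    0 ≤ ∑ k ∈ range (K + 1), arcAction (α k) (w k) (w (k + 1)) := by
  have h0 : 0 < ∑ k ∈ range (K + 1), α k := Finset.sum_pos (fun k _ => hα k) ⟨0, by simp⟩
  refine le_trans ?_ (arcAction_sum_le α hα w K (by linarith [Real.pi_pos]))
  rw [hw, arcAction]
  have h1 : (starRingEnd ℂ (w 0) * -w 0).im = 0 := by simp; ring
  have h2 : 0 ≤ Real.cot (∑ k ∈ range (K + 1), α k) := by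
    rw [Real.cot_eq_cos_div_sin]
    exact div_nonneg (Real.cos_nonneg_of_neg_pi_div_two_le_of_le (by linarith) hK)
      (Real.sin_nonneg_of_nonneg_of_le_pi h0.le (by linarith [Real.pi_pos]))
  rw [h1, sub_zero]
  exact mul_nonneg (by linarith) (Complex.normSq_nonneg _)

theorem sum_im_le_of_alternating (α : ℕ → ℝ) (hα : ∀ k, 0 < α k) (u : ℕ → ℂ) (m : ℕ) (hm : 2 ≤ m)
    (hu : u m = u 0)
    (hsum : ∑ k ∈ range m, α k ≤ if m % 2 = 1 then Real.pi / 2 else Real.pi) :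
    ∑ k ∈ range m, (starRingEnd ℂ (u k) * u (k + 1)).im ≤
      ∑ k ∈ range m, Real.cot (α k) / 2 * Complex.normSq (u k + u (k + 1)) := by
  let w : ℕ → ℂ := fun k => (-1) ^ k * starRingEnd ℂ (u k)
  have hact : ∀ k, arcAction (α k) (w k) (w (k + 1)) =
      Real.cot (α k) / 2 * Complex.normSq (u k + u (k + 1)) -
        (starRingEnd ℂ (u k) * u (k + 1)).im := by
    intro k
    simp only [arcAction, w, pow_succ]
    rcases neg_one_pow_eq_or ℂ k with h | h <;> rw [h] <;>
      simp [Complex.normSq_apply] <;> ring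
  obtain ⟨K, rfl⟩ : ∃ K, m = K + 2 := ⟨m - 2, by omega⟩
  have key : 0 ≤ ∑ k ∈ range (K + 2), arcAction (α k) (w k) (w (k + 1)) := by
    split_ifs at hsum with hodd
    · refine arcAction_sum_nonneg_of_antiperiodic α hα w (K + 1) hsum ?_
      have : (-1 : ℂ) ^ (K + 2) = -1 := (Nat.odd_iff.2 hodd).neg_one_pow
      simp [w, hu, this]
    · refine arcAction_sum_nonneg_of_closed α hα w K hsum ?_
      have : (-1 : ℂ) ^ (K + 2) = 1 := (Nat.even_iff.2 (by omega)).neg_one_pow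
      simp [w, hu, this]
  simp only [hact, Finset.sum_sub_distrib] at key
  linarith

theorem concaveOn_arctan_mul_tanh {k : ℝ} (hk : 0 ≤ k) :
    ConcaveOn ℝ (Set.Ici 0) fun s => Real.arctan (k * Real.tanh s) := by
  have hd : ∀ s, HasDerivAt (fun s => Real.arctan (k * Real.tanh s))
      (k / (Real.cosh s ^ 2 + k ^ 2 * Real.sinh s ^ 2)) s := by
    intro s
    have hc := Real.cosh_pos s
    have h1 : HasDerivAt Real.tanh (1 / Real.cosh s ^ 2) s := by
      have := (Real.hasDerivAt_sinh s).div (Real.hasDerivAt_cosh s) hc.ne'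
      have he : Real.tanh = Real.sinh / Real.cosh := by
        ext x
        exact Real.tanh_eq_sinh_div_cosh x
      rw [he]
      rwa [← sq, ← sq, Real.cosh_sq_sub_sinh_sq] at this
    convert (h1.const_mul k).arctan using 1
    rw [Real.tanh_eq_sinh_div_cosh]
    field_simp
  refine AntitoneOn.concaveOn_of_deriv (convex_Ici 0)
    (fun s _ => (hd s).continuousAt.continuousWithinAt)
    (fun s _ => (hd s).differentiableAt.differentiableWithinAt) ?_
  rw [interior_Ici, funext fun s => (hd s).deriv]
  intro s hs t _ hst
  have h0 : 0 ≤ Real.sinh s := Real.sinh_nonneg_iff.2 (le_of_lt hs)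
  have hcs := Real.cosh_pos s
  have h1 : Real.sinh s ≤ Real.sinh t := Real.sinh_le_sinh.2 hst
  have h2 : Real.sinh s ^ 2 ≤ Real.sinh t ^ 2 := pow_le_pow_left₀ h0 h1 2
  dsimp only
  have h3 : Real.cosh s ^ 2 ≤ Real.cosh t ^ 2 := by rw [Real.cosh_sq, Real.cosh_sq]; linarith
  gcongr

theorem tanh_half_log_div {x y : ℝ} (hx : 0 < x) (hy : 0 < y) :
    Real.tanh (Real.log (x / y) / 2) = (x - y) / (x + y) := by
  have h1 : Real.exp (Real.log (x / y) / 2) ^ 2 = x / y := by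
    rw [← Real.exp_nat_mul, Nat.cast_ofNat, mul_div_cancel₀ _ two_ne_zero,
      Real.exp_log (div_pos hx hy)]
  rw [Real.tanh_eq, Real.exp_neg]
  have h2 := Real.exp_pos (Real.log (x / y) / 2)
  generalize Real.exp (Real.log (x / y) / 2) = z at *
  rw [eq_div_iff hy.ne'] at h1
  rw [← h1]
  field_simp

theorem sum_arctan_mul_tanh_le {ι : Type*} [Fintype ι] [Nonempty ι] {k : ℝ} (hk : 0 ≤ k)
    (s : ι → ℝ) (hs : ∀ t, 0 ≤ s t) :
    ∑ t, Real.arctan (k * Real.tanh (s t)) ≤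
      Fintype.card ι * Real.arctan (k * Real.tanh ((∑ t, s t) / Fintype.card ι)) := by
  have hpos : (0 : ℝ) < Fintype.card ι := by exact_mod_cast Fintype.card_pos
  have := (concaveOn_arctan_mul_tanh hk).le_map_sum (t := univ)
    (w := fun _ : ι => (Fintype.card ι : ℝ)⁻¹) (p := s) (fun _ _ => by positivity)
    (by simp) (fun t _ => hs t)
  simp only [smul_eq_mul, ← Finset.mul_sum] at this
  rw [inv_mul_le_iff₀ hpos] at this
  rwa [div_eq_inv_mul]

theorem MCycle.affPos_and_sum_arctan_le {n : ℕ} {R : Matrix (Fin n) (Fin n) ℝ} (c : MCycle n R)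
    (hoff : ∀ i j, i ≠ j → 0 ≤ R i j) (p : Fin n → ℝ) (hp : ∀ t, 0 < p (c.vert t))
    (x y : ZMod (c.len + 3) → ℝ)
    (hx : ∀ t, x t = p (c.vert t) * R (c.vert (t + 1)) (c.vert t))
    (hy : ∀ t, y t = p (c.vert (t + 1)) * R (c.vert t) (c.vert (t + 1)))
    (hyx : ∀ t, y t < x t) :
    c.affPos ∧ 0 < c.tanhAff ∧ ∀ k, 0 ≤ k →
      ∑ t, Real.arctan (k / c.tanhAff * ((x t - y t) / (x t + y t))) ≤
        (c.len + 3 : ℝ) * Real.arctan k := by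
  have hx0 : ∀ t, 0 < x t := fun t => by
    rw [hx]
    exact mul_pos (hp _) (c.pos t)
  have hy0 : ∀ t, 0 ≤ y t := fun t => by
    rw [hy]
    refine mul_nonneg (hp _).le (hoff _ _ fun h => ?_)
    have h1 := c.inj h
    have : Fact (1 < c.len + 3) := ⟨by omega⟩
    simp at h1
  have hcard : (Fintype.card (ZMod (c.len + 3)) : ℝ) = c.len + 3 := by
    rw [ZMod.card]
    push_cast
    ring
  by_cases hfin : ∀ t, 0 < R (c.vert t) (c.vert (t + 1))
  · have hy1 : ∀ t, 0 < y t := fun t => by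
      rw [hy]
      exact mul_pos (hp _) (hfin t)
    have hF : ∑ t, Real.log (R (c.vert (t + 1)) (c.vert t) / R (c.vert t) (c.vert (t + 1))) =
        ∑ t, Real.log (x t / y t) := by
      have h1 : ∀ t, Real.log (x t / y t) =
          Real.log (R (c.vert (t + 1)) (c.vert t) / R (c.vert t) (c.vert (t + 1))) +
            (Real.log (p (c.vert t)) - Real.log (p (c.vert (t + 1)))) := by
        intro t
        rw [hx, hy, Real.log_div (mul_pos (hp _) (c.pos t)).ne' (mul_pos (hp _) (hfin t)).ne',
          Real.log_mul (hp _).ne' (c.pos t).ne', Real.log_mul (hp _).ne' (hfin t).ne',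
          Real.log_div (c.pos t).ne' (hfin t).ne']
        ring
      have h2 : ∑ t, Real.log (p (c.vert (t + 1))) = ∑ t, Real.log (p (c.vert t)) :=
        Equiv.sum_comp (Equiv.addRight (1 : ZMod (c.len + 3))) fun t => Real.log (p (c.vert t))
      simp only [h1, Finset.sum_add_distrib, Finset.sum_sub_distrib, h2, sub_self, add_zero]
    have hlog : ∀ t, 0 < Real.log (x t / y t) := fun t =>
      Real.log_pos ((one_lt_div (hy1 t)).2 (hyx t))
    have hFpos : 0 < ∑ t, Real.log (x t / y t) :=
      Finset.sum_pos (fun t _ => hlog t) univ_nonempty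
    have htau : c.tanhAff = Real.tanh ((∑ t, Real.log (x t / y t) / 2) /
        Fintype.card (ZMod (c.len + 3))) := by
      rw [MCycle.tanhAff, if_pos hfin, hF, hcard, ← Finset.sum_div, div_div]
    have htau0 : 0 < c.tanhAff := by
      rw [htau, hcard, Real.tanh_eq_sinh_div_cosh]
      refine div_pos (Real.sinh_pos_iff.2 ?_) (Real.cosh_pos _)
      rw [← Finset.sum_div]
      positivity
    refine ⟨fun _ => by rwa [hF], htau0, fun k hk => ?_⟩
    have h := sum_arctan_mul_tanh_le (k := k / c.tanhAff) (by positivity)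
      (fun t => Real.log (x t / y t) / 2) (fun t => by have := hlog t; positivity)
    rw [← htau, div_mul_cancel₀ _ htau0.ne', hcard] at h
    simpa only [tanh_half_log_div (hx0 _) (hy1 _)] using h
  · have htau : c.tanhAff = 1 := by rw [MCycle.tanhAff, if_neg hfin]
    refine ⟨fun h => absurd h hfin, by rw [htau]; exact one_pos, fun k hk => ?_⟩
    rw [← hcard, ← nsmul_eq_mul, ← Finset.card_univ]
    refine Finset.sum_le_card_nsmul _ _ _ fun t _ => Real.arctan_mono ?_
    rw [htau, div_one]
    refine mul_le_of_le_one_right hk ?_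
    rw [div_le_one (by linarith [hx0 t, hy0 t])]
    linarith [hy0 t]

theorem sum_im_le_of_sum_arctan_le (l : ℕ) (u : ZMod (l + 3) → ℂ) (q : ZMod (l + 3) → ℝ)
    (hq : ∀ t, 0 < q t) (τ : ℝ) (hτ : 0 < τ)
    (hsum : ∀ k, 0 ≤ k → ∑ t, Real.arctan (k / τ * q t) ≤ (l + 3 : ℝ) * Real.arctan k) :
    ∑ t, (starRingEnd ℂ (u t) * u (t + 1)).im ≤
      ∑ t, τ * Real.tan (Real.pi * (((if (l + 3) % 2 = 1 then l + 2 else l + 1 : ℕ)) : ℝ) /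
        (2 * (l + 3))) / 2 * ((q t)⁻¹ * Complex.normSq (u t + u (t + 1))) := by
  have hπ := Real.pi_pos
  obtain ⟨β, hβ0, hβ2, hβm, hT⟩ : ∃ β : ℝ, 0 < β ∧ β < Real.pi / 2 ∧
      (l + 3 : ℝ) * β = (if (l + 3) % 2 = 1 then Real.pi / 2 else Real.pi) ∧
      Real.tan (Real.pi * (((if (l + 3) % 2 = 1 then l + 2 else l + 1 : ℕ)) : ℝ) /
        (2 * (l + 3))) = (Real.tan β)⁻¹ := by
    have hl : (0 : ℝ) < l + 3 := by positivity
    have hl0 : (0 : ℝ) ≤ l := by positivity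
    refine ⟨(if (l + 3) % 2 = 1 then Real.pi / 2 else Real.pi) / (l + 3), ?_, ?_, ?_, ?_⟩
    · split_ifs <;> positivity
    · rw [div_lt_iff₀ hl]
      split_ifs <;> nlinarith
    · field_simp
    · rw [← Real.tan_pi_div_two_sub]
      congr 1
      split_ifs <;> push_cast <;> field_simp <;> ring
  have htan : 0 < Real.tan β := Real.tan_pos_of_pos_of_lt_pi_div_two hβ0 hβ2
  have hrange : ∀ G : ZMod (l + 3) → ℝ, ∑ t, G t = ∑ k ∈ range (l + 3), G (k : ZMod (l + 3)) := by
    intro G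
    rw [← Fin.sum_univ_eq_sum_range (fun k => G (k : ZMod (l + 3)))]
    exact Finset.sum_congr rfl fun t _ => congrArg G (ZMod.natCast_zmod_val t).symm
  have hpos : ∀ t, 0 < Real.tan β / τ * q t := fun t => mul_pos (div_pos htan hτ) (hq t)
  have h := hsum _ htan.le
  rw [Real.arctan_tan (by linarith) hβ2, hβm, hrange] at h
  have key := sum_im_le_of_alternating
    (fun k => Real.arctan (Real.tan β / τ * q (k : ZMod (l + 3))))
    (fun k => Real.arctan_pos.2 (hpos _)) (fun k => u (k : ZMod (l + 3))) (l + 3)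
    (by omega) (by simp) h
  rw [hrange, hrange]
  simp only [Nat.cast_add_one] at key
  refine key.trans (le_of_eq (Finset.sum_congr rfl fun k _ => ?_))
  rw [← Real.tan_inv_eq_cot, Real.tan_arctan, hT]
  have := hq k
  field_simp

/-- The net flow of a circulation is a circulation. -/
theorem sum_posPart_balanced {V : Type*} [Fintype V] (a : V → V → ℝ)
    (ha : ∀ i, ∑ j, a i j = ∑ j, a j i) (i : V) :
    ∑ j, max (a i j - a j i) 0 = ∑ j, max (a j i - a i j) 0 := by
  rw [← sub_eq_zero, ← Finset.sum_sub_distrib]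
  have h1 : ∀ j, max (a i j - a j i) 0 - max (a j i - a i j) 0 = a i j - a j i := by
    intro j
    rcases le_total (a i j) (a j i) with h | h
    · rw [max_eq_right (by linarith), max_eq_left (by linarith)]
      ring
    · rw [max_eq_left (by linarith), max_eq_right (by linarith)]
      ring
  simp only [h1, Finset.sum_sub_distrib, ha i, sub_self]

theorem sum_posPart_mul_of_antisymm {V : Type*} [Fintype V] (a f : V → V → ℝ)
    (hf : ∀ i j, f j i = -f i j) :
    ∑ i, ∑ j, max (a i j - a j i) 0 * f i j = ∑ i, ∑ j, a i j * f i j := by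
  have h1 : ∀ b : V → V → ℝ, 2 * ∑ i, ∑ j, b i j * f i j =
      ∑ i, ∑ j, (b i j - b j i) * f i j := by
    intro b
    have : ∑ i, ∑ j, b i j * f i j = -∑ i, ∑ j, b j i * f i j := by
      rw [Finset.sum_comm, ← Finset.sum_neg_distrib]
      refine Finset.sum_congr rfl fun i _ => ?_
      rw [← Finset.sum_neg_distrib]
      exact Finset.sum_congr rfl fun j _ => by rw [hf]; ring
    simp only [sub_mul, Finset.sum_sub_distrib]
    linarith
  refine mul_left_cancel₀ two_ne_zero ?_
  rw [h1, h1]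
  refine Finset.sum_congr rfl fun i _ => Finset.sum_congr rfl fun j _ => ?_
  congr 1
  rcases le_total (a i j) (a j i) with h | h
  · rw [max_eq_right (by linarith), max_eq_left (by linarith)]
    ring
  · rw [max_eq_left (by linarith), max_eq_right (by linarith)]
    ring

theorem sum_posPart_mul_le_of_symm {V : Type*} [Fintype V] (a f : V → V → ℝ)
    (ha : ∀ i j, 0 ≤ a i j) (hf0 : ∀ i j, 0 ≤ f i j) (hf : ∀ i j, f j i = f i j) :
    ∑ i, ∑ j, max (a i j - a j i) 0 * (((a i j - a j i) / (a i j + a j i))⁻¹ * f i j) ≤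
      ∑ i, ∑ j, a i j * f i j := by
  have hsym : ∀ b : V → V → ℝ, 2 * ∑ i, ∑ j, b i j = ∑ i, ∑ j, (b i j + b j i) := by
    intro b
    simp only [Finset.sum_add_distrib]
    rw [Finset.sum_comm (f := fun i j => b j i)]
    ring
  refine le_of_mul_le_mul_left ?_ (two_pos (α := ℝ))
  rw [hsym, hsym]
  refine Finset.sum_le_sum fun i _ => Finset.sum_le_sum fun j _ => ?_
  have key : ∀ x y f : ℝ, 0 ≤ x → 0 ≤ y → 0 ≤ f → y ≤ x →
      max (x - y) 0 * (((x - y) / (x + y))⁻¹ * f) + max (y - x) 0 * (((y - x) / (y + x))⁻¹ * f) ≤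
        x * f + y * f := by
    intro x y f hx hy hf hyx
    rw [max_eq_left (by linarith), max_eq_right (by linarith), zero_mul, add_zero, inv_div]
    rcases hyx.eq_or_lt with h | h
    · rw [h, sub_self, zero_mul]
      positivity
    · have : x - y ≠ 0 := by linarith
      field_simp
      linarith
  rw [hf i j]
  rcases le_total (a j i) (a i j) with h | h
  · exact key _ _ _ (ha _ _) (ha _ _) (hf0 _ _) h
  · rw [add_comm, add_comm (a i j * _)]
    exact key _ _ _ (ha _ _) (ha _ _) (hf0 _ _) h

theorem fast_decay_of_left_eigenvector {n : ℕ} (R : Matrix (Fin n) (Fin n) ℝ)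
    (hoff : ∀ i j, i ≠ j → 0 ≤ R i j) (hcol : ∀ i, ∑ j, R j i = 0) (r : ℝ)
    (hr : ∀ i, -R i i ≤ r) (lam : ℂ) (hlam : 0 < lam.im) (u : Fin n → ℂ) (hu0 : u ≠ 0)
    (hu : ∀ i, ∑ j, (R j i : ℂ) * u j = lam * u i) :
    (-(2 * r) < lam.re ∧ lam.re < 0) ∧
    ∃ c : MCycle n R, c.affPos ∧
      lam.im / (2 * r + lam.re) ≤ c.tanhAff *
        Real.tan (Real.pi *
          (((if (c.len + 3) % 2 = 1 then c.len + 2 else c.len + 1 : ℕ)) : ℝ) /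
          (2 * (c.len + 3))) := by
  obtain ⟨p, a, N, hN, hp, ha, hapR, hbal, him, hadd, hsub⟩ :=
    exists_circulation R hoff hcol r hr lam u hu0 hu
  have himpos : 0 < lam.im * N := mul_pos hlam hN
  have him_add : ∀ x y : ℂ, Complex.normSq (x + y) = 0 → (starRingEnd ℂ x * y).im = 0 := by
    intro x y h
    rw [eq_neg_of_add_eq_zero_right (Complex.normSq_eq_zero.1 h)]
    simp
    ring
  have him_sub : ∀ x y : ℂ, Complex.normSq (x - y) = 0 → (starRingEnd ℂ x * y).im = 0 := by
    intro x y h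
    rw [← sub_eq_zero.1 (Complex.normSq_eq_zero.1 h)]
    simp
    ring
  have hdeg : ∀ f : Fin n → Fin n → ℝ, (∀ i j, 0 ≤ f i j) →
      (∀ i j, f i j = 0 → (starRingEnd ℂ (u i) * u j).im = 0) →
      0 < ∑ i, ∑ j, a i j * f i j := by
    intro f hf hfi
    have hnn : ∀ i j, 0 ≤ a i j * f i j := fun i j => mul_nonneg (ha i j) (hf i j)
    refine (Finset.sum_nonneg fun i _ => Finset.sum_nonneg fun j _ => hnn i j).lt_of_ne' fun h => ?_
    rw [← him] at himpos
    refine himpos.ne' (Finset.sum_eq_zero fun i hi => Finset.sum_eq_zero fun j hj => ?_)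
    have h1 := (Finset.sum_eq_zero_iff_of_nonneg fun j _ => hnn i j).1
      ((Finset.sum_eq_zero_iff_of_nonneg fun i _ =>
        Finset.sum_nonneg fun j _ => hnn i j).1 h i hi) j hj
    rcases mul_eq_zero.1 h1 with h2 | h2
    · rw [h2, zero_mul]
    · rw [hfi i j h2, mul_zero]
  have hgap : 0 < 2 * r + lam.re := by
    have := (hdeg (fun i j => Complex.normSq (u i + u j)) (fun _ _ => Complex.normSq_nonneg _)
      fun i j => him_add _ _).trans_le hadd
    have := pos_of_mul_pos_left this hN.le
    linarith
  have hre : lam.re < 0 := by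
    have := (hdeg (fun i j => Complex.normSq (u i - u j)) (fun _ _ => Complex.normSq_nonneg _)
      fun i j => him_sub _ _).trans_le hsub
    have := pos_of_mul_pos_left this hN.le
    linarith
  refine ⟨⟨by linarith, hre⟩, ?_⟩
  by_contra! hcon
  set κ := lam.im / (2 * r + lam.re) with hκ
  have hκ0 : 0 < κ := div_pos hlam hgap
  let q : Fin n → Fin n → ℝ := fun i j => (a i j - a j i) / (a i j + a j i)
  let h : Fin n → Fin n → ℝ := fun i j => Complex.normSq (u i + u j)
  let g : Fin n → Fin n → ℝ := fun i j =>
    (starRingEnd ℂ (u i) * u j).im - κ / 2 * ((q i j)⁻¹ * h i j)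
  let J : Fin n → Fin n → ℝ := fun i j => max (a i j - a j i) 0
  have hJlt : ∀ i j, 0 < J i j → a j i < a i j := by
    intro i j hij
    by_contra hc
    have : J i j = 0 := max_eq_right (by linarith)
    linarith
  have hJim : ∑ i, ∑ j, J i j * (starRingEnd ℂ (u i) * u j).im = lam.im * N := by
    rw [← him]
    refine sum_posPart_mul_of_antisymm a (fun i j => (starRingEnd ℂ (u i) * u j).im)
      fun i j => ?_
    simp
    ring
  have hJg : 0 ≤ ∑ i, ∑ j, J i j * g i j := by
    have h1 : ∑ i, ∑ j, J i j * g i j = ∑ i, ∑ j, J i j * (starRingEnd ℂ (u i) * u j).im -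
        κ / 2 * ∑ i, ∑ j, J i j * ((q i j)⁻¹ * h i j) := by
      rw [Finset.mul_sum, ← Finset.sum_sub_distrib]
      refine Finset.sum_congr rfl fun i _ => ?_
      rw [Finset.mul_sum, ← Finset.sum_sub_distrib]
      exact Finset.sum_congr rfl fun j _ => by simp only [g]; ring
    have h2 := (sum_posPart_mul_le_of_symm a h ha (fun _ _ => Complex.normSq_nonneg _)
      fun i j => by simp only [h, add_comm]).trans hadd
    have h3 := mul_le_mul_of_nonneg_left h2 (half_pos hκ0).le
    have h4 : κ / 2 * (2 * (2 * r + lam.re) * N) = lam.im * N := by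
      rw [hκ]
      field_simp
    rw [h1, hJim]
    linarith
  have hcyc : ∀ (m : ℕ) (_ : NeZero m) (c : ZMod m → Fin n), Function.Injective c →
      (∀ t, 0 < J (c t) (c (t + 1))) →
      ∑ t, g (c t) (c (t + 1)) < 0 ∨ ∀ t, h (c t) (c (t + 1)) = 0 := by
    intro m hm c hinj hc
    obtain ⟨l, rfl⟩ : ∃ l, m = l + 3 := by
      have h0 := hm.out
      have h1 : m ≠ 1 := by
        rintro rfl
        have := hJlt _ _ (hc 0)
        rw [Subsingleton.elim (0 + 1 : ZMod 1) 0] at this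
        exact lt_irrefl _ this
      have h2 : m ≠ 2 := by
        rintro rfl
        have h3 := hJlt _ _ (hc 0)
        have h4 := hJlt _ _ (hc (0 + 1))
        rw [show (0 + 1 + 1 : ZMod 2) = 0 from by decide] at h4
        exact lt_asymm h3 h4
      exact ⟨m - 3, by omega⟩
    have hlt : ∀ t, a (c (t + 1)) (c t) < a (c t) (c (t + 1)) := fun t => hJlt _ _ (hc t)
    have hapos : ∀ t, 0 < a (c t) (c (t + 1)) := fun t => (ha _ _).trans_lt (hlt t)
    have hpR : ∀ t, 0 < p (c t) ∧ 0 < R (c (t + 1)) (c t) := by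
      intro t
      have h1 := hapos t
      rw [(hapR _ _ h1).1] at h1
      have h2 := pos_of_mul_pos_right h1 (hp _)
      exact ⟨pos_of_mul_pos_left h1 h2.le, h2⟩
    let C : MCycle n R := ⟨l, c, hinj, fun t => (hpR t).2⟩
    obtain ⟨haff, htau, hsum⟩ := C.affPos_and_sum_arctan_le hoff p (fun t => (hpR t).1)
      (fun t => a (c t) (c (t + 1))) (fun t => a (c (t + 1)) (c t))
      (fun t => (hapR _ _ (hapos t)).1) (fun t => (hapR _ _ (hapos t)).2) hlt
    have hq : ∀ t, 0 < q (c t) (c (t + 1)) := fun t =>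
      div_pos (sub_pos.2 (hlt t)) (add_pos_of_pos_of_nonneg (hapos t) (ha _ _))
    have hbound := sum_im_le_of_sum_arctan_le l (fun t => u (c t))
      (fun t => q (c t) (c (t + 1))) hq C.tanhAff htau hsum
    have hC := hcon C haff
    change C.tanhAff * Real.tan (Real.pi *
      (((if (l + 3) % 2 = 1 then l + 2 else l + 1 : ℕ)) : ℝ) / (2 * (l + 3))) < κ at hC
    generalize C.tanhAff * Real.tan (Real.pi *
      (((if (l + 3) % 2 = 1 then l + 2 else l + 1 : ℕ)) : ℝ) / (2 * (l + 3))) = B at hbound hC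
    have hnn : ∀ t, 0 ≤ (q (c t) (c (t + 1)))⁻¹ * h (c t) (c (t + 1)) := fun t =>
      mul_nonneg (inv_pos.2 (hq t)).le (Complex.normSq_nonneg _)
    rw [← Finset.mul_sum] at hbound
    have hgsum : ∑ t, g (c t) (c (t + 1)) =
        ∑ t, (starRingEnd ℂ (u (c t)) * u (c (t + 1))).im -
          κ / 2 * ∑ t, (q (c t) (c (t + 1)))⁻¹ * h (c t) (c (t + 1)) := by
      rw [Finset.mul_sum, ← Finset.sum_sub_distrib]
    rcases (Finset.sum_nonneg fun t _ => hnn t).eq_or_lt with h0 | h0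
    · right
      intro t
      have h1 := (Finset.sum_eq_zero_iff_of_nonneg fun t _ => hnn t).1 h0.symm t (mem_univ t)
      exact (mul_eq_zero.1 h1).resolve_left (inv_pos.2 (hq t)).ne'
    · left
      rw [hgsum]
      have := mul_lt_mul_of_pos_right hC h0
      simp only [h] at this hbound ⊢
      linarith
  have hgh : ∀ i j, h i j = 0 → g i j = 0 := by
    intro i j hij
    simp only [g, hij, him_add _ _ hij, mul_zero, sub_zero]
  rcases circulation_sum_neg g h hgh J (fun _ _ => le_max_right _ _)
    (sum_posPart_balanced a hbal) hcyc with h1 | h1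
  · exact absurd hJg (not_le.2 h1)
  · rw [← hJim] at himpos
    refine himpos.ne' (Finset.sum_eq_zero fun i _ => Finset.sum_eq_zero fun j _ => ?_)
    have hJ0 : 0 ≤ J i j := le_max_right _ _
    rcases hJ0.eq_or_lt with h2 | h2
    · rw [← h2, zero_mul]
    · rw [him_add _ _ (h1 i j h2), mul_zero]

theorem multicyclic_fast_decay
    (n : ℕ) (hn : 3 ≤ n) (R : Matrix (Fin n) (Fin n) ℝ)
    (hoff : ∀ i j, i ≠ j → 0 ≤ R i j) (hcol : ∀ i, ∑ j, R j i = 0)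
    (r : ℝ) (hr : IsGreatest (Set.range fun i => -R i i) r)
    (lam : ℂ) (hlam : lam.im ≠ 0)
    (heig : ∃ v : Fin n → ℂ, v ≠ 0 ∧ R.map Complex.ofReal *ᵥ v = lam • v) :
    (-(2 * r) < lam.re ∧ lam.re < 0) ∧
    ∃ c : MCycle n R, c.affPos ∧
      |lam.im| / (2 * r + lam.re) ≤ c.tanhAff *
        Real.tan (Real.pi *
          (((if (c.len + 3) % 2 = 1 then c.len + 2 else c.len + 1 : ℕ)) : ℝ) /
          (2 * (c.len + 3))) := by
  obtain ⟨v, hv0, hv⟩ := heig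
  have hdet : (R.map Complex.ofReal - lam • (1 : Matrix (Fin n) (Fin n) ℂ)).det = 0 := by
    refine Matrix.exists_mulVec_eq_zero_iff.1 ⟨v, hv0, ?_⟩
    rw [Matrix.sub_mulVec, hv, Matrix.smul_mulVec, Matrix.one_mulVec, sub_self]
  obtain ⟨u, hu0, hu⟩ := Matrix.exists_vecMul_eq_zero_iff.2 hdet
  have hleft : ∀ i, ∑ j, (R j i : ℂ) * u j = lam * u i := by
    intro i
    have h1 := congrFun hu i
    rw [Matrix.vecMul_sub, Matrix.vecMul_smul, Matrix.vecMul_one] at h1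
    simp only [Pi.sub_apply, Pi.smul_apply, Pi.zero_apply, sub_eq_zero, smul_eq_mul,
      Matrix.vecMul, dotProduct, Matrix.map_apply] at h1
    rw [← h1]
    exact Finset.sum_congr rfl fun j _ => mul_comm _ _
  have hr' : ∀ i, -R i i ≤ r := fun i => hr.2 ⟨i, rfl⟩
  rcases lt_or_gt_of_ne hlam with hneg | hpos
  · have h := fast_decay_of_left_eigenvector R hoff hcol r hr' (starRingEnd ℂ lam)
      (by simpa using hneg) (fun i => starRingEnd ℂ (u i))
      (fun h => hu0 (funext fun i => by simpa using congrFun h i))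
      (fun i => by
        have h1 := congrArg (starRingEnd ℂ) (hleft i)
        simpa only [map_sum, map_mul, Complex.conj_ofReal] using h1)
    rw [abs_of_neg hneg]
    simpa only [Complex.conj_re, Complex.conj_im] using h
  · rw [abs_of_pos hpos]
    exact fast_decay_of_left_eigenvector R hoff hcol r hr' lam hpos u hu0 hleft
end

section
/- Let R be a Markov generator on n states with maximum escape rate r, and let 𝔉* be the supremum of tanh(F_c/(2n_c)) over all cycles c of R (with tanh(F_c/(2n_c)) = 1 when F_c = ∞, and 𝔉* = 0 if R has no cycles). Then every eigenvalue λ of R belongs to the convex hull in ℂ (as a real vector space) of the finite set { r(cos(2πq) − 1) + 𝒊·r·𝔉*·sin(2πq) : q a rational number in [0,1] whose reduced denominator is at most n }. -/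
open Matrix Finset

theorem lt_one_of_mul_eq {X X' Y Y' c d : ℝ} (h₁ : X * Y - X' * Y' = c ^ 2 - d ^ 2)
    (h₂ : X * Y' + X' * Y = -(2 * c * d)) (hc : c ^ 2 < 1) (hX : 1 < X) :
    Y < 1 ∧ X * Y < 1 := by
  have key : (X ^ 2 + X' ^ 2) * (X * Y) = c ^ 2 * (X ^ 2 + X' ^ 2) - (c * X' + d * X) ^ 2 := by
    linear_combination X ^ 2 * h₁ + X * X' * h₂
  have hXY : X * Y < 1 := by
    by_contra! h
    have hN : 0 < X ^ 2 + X' ^ 2 := by positivity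
    have h₃ := mul_le_mul_of_nonneg_left h hN.le
    have h₄ := mul_pos hN (sub_pos.2 hc)
    linarith [sq_nonneg (c * X' + d * X)]
  exact ⟨by nlinarith, hXY⟩

theorem quadratic_form_nonneg {A B C p q : ℝ} (hA : 0 < A) (hdet : B ^ 2 ≤ A * C) :
    0 ≤ A * p ^ 2 + 2 * B * p * q + C * q ^ 2 := by
  have h : 0 ≤ A * (A * p ^ 2 + 2 * B * p * q + C * q ^ 2) := by
    nlinarith [sq_nonneg (A * p + B * q), mul_nonneg (sub_nonneg.2 hdet) (sq_nonneg q)]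
  exact nonneg_of_mul_nonneg_right h hA

theorem hessian_nonneg {X X' Y Y' c d : ℝ} (p q : ℝ) (h₁ : X * Y - X' * Y' = c ^ 2 - d ^ 2)
    (h₂ : X * Y' + X' * Y = -(2 * c * d)) (hc : c ^ 2 < 1) (hX : 1 < X) :
    0 ≤ (-((p ^ 2 - q ^ 2) * Y - 2 * p * q * Y') / (1 - Y)
        - (p * Y - q * Y') ^ 2 / (1 - Y) ^ 2)
      - (((p ^ 2 - q ^ 2) * X - 2 * p * q * X') / (X - 1)
        - (p * X - q * X') ^ 2 / (X - 1) ^ 2) := by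
  obtain ⟨hY, hXY⟩ := lt_one_of_mul_eq h₁ h₂ hc hX
  have ha : 0 < 1 - Y := by linarith
  have hb : 0 < X - 1 := by linarith
  have hA : 0 < (X - Y) * (1 - X * Y) := mul_pos (by linarith) (by linarith)
  have hP : 0 ≤ 4 * (1 - (X * Y - X' * Y')) - (X * Y' + X' * Y) ^ 2 := by
    rw [h₁, h₂]
    nlinarith [mul_nonneg (sub_nonneg.2 hc.le) (sq_nonneg d)]
  have hZ := mul_nonneg (mul_pos ha hb).le
    (add_nonneg (mul_nonneg hP (sq_nonneg ((1 - Y + (X - 1)) / 2)))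
      (sq_nonneg ((1 - Y) * X' + (X - 1) * Y' - (X * Y' + X' * Y) * (1 - Y + (X - 1)) / 2)))
  have hdet : (Y' * (X - 1) ^ 2 - X' * (1 - Y) ^ 2) ^ 2 ≤ (X - Y) * (1 - X * Y) *
      (Y * (1 - Y) * (X - 1) ^ 2 - Y' ^ 2 * (X - 1) ^ 2
        + X * (1 - Y) ^ 2 * (X - 1) + X' ^ 2 * (1 - Y) ^ 2) := by
    rw [← sub_nonneg]
    refine hZ.trans_eq ?_
    ring
  have hQ := quadratic_form_nonneg (p := p) (q := q) hA hdet
  have hpos : 0 < (1 - Y) ^ 2 * (X - 1) ^ 2 := by positivity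
  refine (div_nonneg hQ hpos.le).trans_eq ?_
  field_simp
  ring

theorem hasDerivAt_re_mul_exp (κ A B : ℂ) (t : ℝ) :
    HasDerivAt (fun t : ℝ => (κ * Complex.exp (A + t * B)).re)
      (κ * B * Complex.exp (A + t * B)).re t := by
  have h : HasDerivAt (fun z : ℂ => κ * Complex.exp (A + z * B))
      (κ * B * Complex.exp (A + t * B)) (t : ℂ) := by
    have h₁ : HasDerivAt (fun z : ℂ => A + z * B) B (t : ℂ) := by
      simpa using ((hasDerivAt_id (t : ℂ)).mul_const B).const_add A
    exact ((h₁.cexp).const_mul κ).congr_deriv (by ring)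
  exact h.real_of_complex

/-- The logarithms of the points of the half-plane `1 < re`. -/
def logHalfPlane : Set ℂ := {ω | |ω.im| ≤ Real.pi / 2 ∧ 1 < (Complex.exp ω).re}

theorem convex_logHalfPlane : Convex ℝ logHalfPlane := by
  rw [convex_iff_forall_pos]
  rintro x ⟨hx, hx'⟩ y ⟨hy, hy'⟩ a b ha hb hab
  rw [abs_le] at hx hy
  have him : (a • x + b • y).im = a * x.im + b * y.im := by simp
  have hre : (a • x + b • y).re = a * x.re + b * y.re := by simp
  rw [Complex.exp_re] at hx' hy'
  have hconv : ∀ z : ℂ, 1 < Real.exp z.re * Real.cos z.im ↔ Real.exp (-z.re) < Real.cos z.im := by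
    intro z
    rw [Real.exp_neg, inv_lt_iff_one_lt_mul₀' (Real.exp_pos _)]
  refine ⟨?_, ?_⟩
  · rw [him, abs_le]
    constructor <;> nlinarith
  · rw [Complex.exp_re, hconv, him, hre]
    rw [hconv] at hx' hy'
    have h₁ := strictConcaveOn_cos_Icc.concaveOn.2 (x := x.im) (y := y.im) hx hy ha.le hb.le hab
    have h₂ := convexOn_exp.2 (Set.mem_univ (-x.re)) (Set.mem_univ (-y.re)) ha.le hb.le hab
    simp only [smul_eq_mul] at h₁ h₂
    rw [show a * -x.re + b * -y.re = -(a * x.re + b * y.re) by ring] at h₂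
    nlinarith

/-- The logarithm of `(1 - re ((c - id)² / x)) / (re x - 1)` as a function of `ω = log x`. -/
noncomputable def logRatio (c d : ℝ) (ω : ℂ) : ℝ :=
  Real.log (1 - ((⟨c, -d⟩ : ℂ) ^ 2 * Complex.exp (-ω)).re) - Real.log ((Complex.exp ω).re - 1)

theorem exp_relations (c d : ℝ) (ω : ℂ) :
    let X := Complex.exp ω
    let Y := (⟨c, -d⟩ : ℂ) ^ 2 * Complex.exp (-ω)
    X.re * Y.re - X.im * Y.im = c ^ 2 - d ^ 2 ∧ X.re * Y.im + X.im * Y.re = -(2 * c * d) := by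
  intro X Y
  have h : X * Y = (⟨c, -d⟩ : ℂ) ^ 2 := by
    simp only [X, Y]
    rw [mul_left_comm, ← Complex.exp_add]
    simp
  have hre := congrArg Complex.re h
  have him := congrArg Complex.im h
  simp only [sq, Complex.mul_re, Complex.mul_im] at hre him
  constructor <;> linarith

theorem convexOn_logRatio {c d : ℝ} (hc : c ^ 2 < 1) :
    ConvexOn ℝ logHalfPlane (logRatio c d) := by
  refine ⟨convex_logHalfPlane, ?_⟩
  intro x hx y hy a b ha hb hab
  set B := y - x with hB
  have hmem : ∀ t ∈ Set.Icc (0 : ℝ) 1, x + t * B ∈ logHalfPlane := by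
    intro t ht
    have := convex_logHalfPlane.add_smul_sub_mem hx hy ht
    simpa using this
  set ζ : ℂ := (⟨c, -d⟩ : ℂ) ^ 2 with hζ
  have hneg : ∀ t : ℝ, -(x + t * B) = -x + t * (-B) := fun t => by ring
  have hX : ∀ t ∈ Set.Icc (0 : ℝ) 1, 0 < (Complex.exp (x + t * B)).re - 1 :=
    fun t ht => sub_pos.2 (hmem t ht).2
  have hY : ∀ t ∈ Set.Icc (0 : ℝ) 1, 0 < 1 - (ζ * Complex.exp (-x + t * (-B))).re := by
    intro t ht
    obtain ⟨h₁, h₂⟩ := exp_relations c d (x + t * B)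
    rw [hneg] at h₁ h₂
    exact sub_pos.2 (lt_one_of_mul_eq h₁ h₂ hc (hmem t ht).2).1
  have dX : ∀ t : ℝ, HasDerivAt (fun t : ℝ => (Complex.exp (x + t * B)).re - 1)
      (B * Complex.exp (x + t * B)).re t := fun t => by
    simpa using (hasDerivAt_re_mul_exp 1 x B t).sub_const 1
  have dX' := hasDerivAt_re_mul_exp B x B
  have dY : ∀ t : ℝ, HasDerivAt (fun t : ℝ => 1 - (ζ * Complex.exp (-x + t * (-B))).re)
      (-(ζ * (-B) * Complex.exp (-x + t * (-B))).re) t := fun t => by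
    simpa using (hasDerivAt_re_mul_exp ζ (-x) (-B) t).const_sub 1
  have dY' := hasDerivAt_re_mul_exp (ζ * (-B)) (-x) (-B)
  have hφ : ∀ t ∈ Set.Icc (0 : ℝ) 1, HasDerivAt (fun t : ℝ => logRatio c d (x + t * B))
      (-(ζ * (-B) * Complex.exp (-x + t * (-B))).re / (1 - (ζ * Complex.exp (-x + t * (-B))).re)
        - (B * Complex.exp (x + t * B)).re / ((Complex.exp (x + t * B)).re - 1)) t := by
    intro t ht
    have := ((dY t).log (hY t ht).ne').sub ((dX t).log (hX t ht).ne')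
    simp only [logRatio, hneg]
    exact this
  have hcv : ConvexOn ℝ (Set.Icc (0 : ℝ) 1) (fun t : ℝ => logRatio c d (x + t * B)) := by
    refine convexOn_of_hasDerivWithinAt2_nonneg (convex_Icc _ _)
      (fun t ht => (hφ t ht).continuousAt.continuousWithinAt)
      (fun t ht => (hφ t (interior_subset ht)).hasDerivWithinAt)
      (fun t ht => (((dY' t).neg.div (dY t) (hY t (interior_subset ht)).ne').sub
        ((dX' t).div (dX t) (hX t (interior_subset ht)).ne')).hasDerivWithinAt) ?_
    intro t ht
    obtain ⟨h₁, h₂⟩ := exp_relations c d (x + t * B)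
    have hX0 := hX t (interior_subset ht)
    have hY0 := hY t (interior_subset ht)
    rw [hneg, ← hζ] at h₁ h₂
    have := hessian_nonneg B.re B.im h₁ h₂ hc (sub_pos.1 hX0)
    generalize Complex.exp (x + t * B) = ξ at *
    have e₁ : ζ * (-B) * Complex.exp (-x + t * (-B)) = -(B * (ζ * Complex.exp (-x + t * (-B)))) := by
      ring
    have e₂ : ζ * (-B) * (-B) * Complex.exp (-x + t * (-B)) =
        B * B * (ζ * Complex.exp (-x + t * (-B))) := by
      ring
    simp only [Pi.neg_apply, e₁, e₂]
    generalize ζ * Complex.exp (-x + t * (-B)) = η at *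
    refine this.trans_eq ?_
    simp only [Complex.mul_re, Complex.mul_im, Complex.neg_re]
    field_simp
    ring
  have := hcv.2 (x := 0) (y := 1) (by simp) (by simp) ha hb hab
  simp only [smul_eq_mul, mul_zero, mul_one, zero_add, Complex.ofReal_zero, zero_mul, add_zero,
    Complex.ofReal_one, one_mul] at this
  rw [show x + B = y by simp [hB]] at this
  simp only [smul_eq_mul]
  convert this using 2
  simp only [Complex.real_smul, hB]
  have : (a : ℂ) = 1 - b := by rw [← Complex.ofReal_one, ← hab]; push_cast; ring
  rw [this]; ring

section paths
variable {V : Type*} (w : V → V → ℝ)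

/-- The product of the weights along the edges of a path. -/
def pathWeight : List V → ℝ
  | [] => 1
  | [_] => 1
  | x :: y :: l => w x y * pathWeight (y :: l)

theorem pathWeight_append (s t : List V) (x : V) :
    pathWeight w (s ++ x :: t) = pathWeight w (s ++ [x]) * pathWeight w (x :: t) := by
  induction s with
  | nil => simp [pathWeight]
  | cons y s ih =>
    cases s with
    | nil => simp [pathWeight]
    | cons z s =>
      simp only [List.cons_append, pathWeight] at ih ⊢
      rw [ih, mul_assoc]

theorem pathWeight_concat (l : List V) (x z : V) :
    pathWeight w (x :: l ++ [z]) =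
      ∏ t ∈ range (l.length + 1), w ((x :: l).getD t z) ((x :: l).getD (t + 1) z) := by
  induction l generalizing x with
  | nil => simp [pathWeight]
  | cons y l ih =>
    rw [List.length_cons, prod_range_succ']
    simp only [List.cons_append, pathWeight] at ih ⊢
    rw [ih, mul_comm]
    simp

theorem pathWeight_cycle (l : List V) (x : V) :
    pathWeight w (x :: l ++ [x]) =
      ∏ t : Fin (l.length + 1), w ((x :: l).get t) ((x :: l).get (t + 1)) := by
  rw [pathWeight_concat, ← Fin.prod_univ_eq_prod_range
    (fun t => w ((x :: l).getD t x) ((x :: l).getD (t + 1) x))]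
  refine prod_congr rfl fun t _ => ?_
  congr 1
  · rw [List.getD_eq_getElem _ _ t.isLt]
    rfl
  · rcases eq_or_ne t (Fin.last _) with rfl | ht
    · simp
    · have h : (t + 1 : Fin (l.length + 1)).val = t.val + 1 := by
        rw [Fin.val_add_one, if_neg ht]
      have h' : t.val + 1 < l.length + 1 := h ▸ (t + 1).isLt
      rw [List.getD_eq_getElem _ _ (by simpa using h')]
      simp [h]

/-- If no simple cycle has weight exceeding `1`, there is a potential. -/
theorem exists_potential [Fintype V] (hw : ∀ i j, 0 ≤ w i j)
    (hcyc : ∀ (k : ℕ) (v : Fin (k + 1) → V), Function.Injective v →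
      ∏ t, w (v t) (v (t + 1)) ≤ 1) :
    ∃ q : V → ℝ, (∀ i, 0 < q i) ∧ ∀ i j, w i j * q j ≤ q i := by
  have hmax : ∀ i, ∃ l : List V, (i :: l).Nodup ∧
      ∀ l' : List V, (i :: l').Nodup → pathWeight w (i :: l') ≤ pathWeight w (i :: l) := by
    intro i
    have hfin : {l : List V | (i :: l).Nodup}.Finite :=
      (List.finite_length_le V (Fintype.card V)).subset fun l hl =>
        (List.nodup_cons.1 hl).2.length_le_card
    obtain ⟨l, hl, hl'⟩ := Set.exists_max_image _ (fun l => pathWeight w (i :: l)) hfin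
      ⟨[], by simp⟩
    exact ⟨l, hl, hl'⟩
  choose L hL hLmax using hmax
  refine ⟨fun i => pathWeight w (i :: L i), fun i => ?_, fun i j => ?_⟩
  · exact zero_lt_one.trans_le (hLmax i [] (by simp))
  · change pathWeight w (i :: j :: L j) ≤ _
    by_cases hi : i ∈ j :: L j
    · obtain ⟨s, t, hst⟩ := List.append_of_mem hi
      have hnd := hL j
      rw [hst] at hnd ⊢
      have hs : (i :: s).Nodup := by
        have := List.nodup_middle.1 hnd
        exact this.sublist (by simp)
      have ht : (i :: t).Nodup := hnd.sublist (by simp)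
      have h₁ : pathWeight w (i :: s ++ [i]) ≤ 1 := by
        rw [pathWeight_cycle]
        exact hcyc _ _ (List.nodup_iff_injective_get.1 hs)
      rw [← List.cons_append, pathWeight_append]
      have h₂ := hLmax i t ht
      have h₀ : 0 ≤ pathWeight w (i :: t) := by
        clear * - hw
        induction t generalizing i with
        | nil => simp [pathWeight]
        | cons y t ih => exact mul_nonneg (hw _ _) (ih y)
      exact (mul_le_of_le_one_left h₀ h₁).trans h₂
    · exact hLmax i _ (List.nodup_cons.2 ⟨hi, hL j⟩)

end paths

/-- If at every vertex with an incoming edge the outgoing weights `a` exceed the reverse weights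
`b` of the incoming edges, some simple cycle has larger forward than reverse weight. -/
theorem exists_cycle_prod_lt {V : Type*} [Fintype V] {a b : V → V → ℝ}
    (ha : ∀ i j, 0 ≤ a i j) (hb : ∀ i j, 0 ≤ b i j)
    (h : ∀ i, (∃ j, 0 < a j i) → ∑ j, (if 0 < a j i then b i j else 0) < ∑ j, a i j)
    (hne : ∃ i j, 0 < a j i) :
    ∃ (k : ℕ) (v : Fin (k + 1) → V), Function.Injective v ∧
      (∀ t, 0 < a (v t) (v (t + 1))) ∧
      ∏ t, b (v (t + 1)) (v t) < ∏ t, a (v t) (v (t + 1)) := by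
  obtain ⟨ε, hε, hεlt⟩ : ∃ ε > (0 : ℝ), ∀ i, (∃ j, 0 < a j i) →
      ∑ j, (if 0 < a j i then b i j + ε else 0) < ∑ j, a i j := by
    have hev : ∀ᶠ ε in nhdsWithin (0 : ℝ) (Set.Ioi 0), ∀ i, (∃ j, 0 < a j i) →
        ∑ j, (if 0 < a j i then b i j + ε else 0) < ∑ j, a i j := by
      rw [Filter.eventually_all]
      intro i
      by_cases hi : ∃ j, 0 < a j i
      · have hcont : Continuous fun ε : ℝ => ∑ j, (if 0 < a j i then b i j + ε else 0) := by
          refine continuous_finsetSum _ fun j _ => ?_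
          split_ifs <;> fun_prop
        have := (hcont.tendsto 0).eventually_lt_const (u := ∑ j, a i j) (by simpa using h i hi)
        exact (this.filter_mono nhdsWithin_le_nhds).mono fun ε hε _ => hε
      · exact Filter.Eventually.of_forall fun _ h' => absurd h' hi
    obtain ⟨ε, h₁, h₂⟩ := (hev.and self_mem_nhdsWithin).exists
    exact ⟨ε, h₂, h₁⟩
  by_contra! hno
  have hbε : ∀ i j, 0 < b i j + ε := fun i j => add_pos_of_nonneg_of_pos (hb i j) hε
  obtain ⟨q, hq, hqw⟩ := exists_potential (fun i j => a i j / (b j i + ε))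
    (fun i j => div_nonneg (ha i j) (hbε j i).le) (by
      intro k v hv
      by_cases hpos : ∀ t, 0 < a (v t) (v (t + 1))
      · rw [prod_div_distrib, div_le_one (prod_pos fun t _ => hbε _ _)]
        exact (hno k v hv hpos).trans
          (prod_le_prod (fun t _ => hb _ _) fun t _ => by linarith)
      · push Not at hpos
        obtain ⟨t, ht⟩ := hpos
        rw [prod_eq_zero (mem_univ t) (by rw [le_antisymm ht (ha _ _), zero_div])]
        exact zero_le_one)
  have hedge : ∀ i j, a i j / q i ≤ (if 0 < a i j then b j i + ε else 0) / q j := by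
    intro i j
    split_ifs with hij
    · rw [div_le_div_iff₀ (hq i) (hq j)]
      have := hqw i j
      rw [div_mul_eq_mul_div, div_le_iff₀ (hbε j i)] at this
      linarith
    · simp [le_antisymm (not_lt.1 hij) (ha i j)]
  have hle : ∑ i, ∑ j, a i j / q i ≤ ∑ i, ∑ j, (if 0 < a j i then b i j + ε else 0) / q i := by
    rw [sum_comm (f := fun i j => (if 0 < a j i then b i j + ε else 0) / q i)]
    exact sum_le_sum fun i _ => sum_le_sum fun j _ => hedge i j
  refine hle.not_gt (sum_lt_sum (fun i _ => ?_) ?_)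
  · rw [← sum_div, ← sum_div]
    refine div_le_div_of_nonneg_right ?_ (hq i).le
    by_cases hi : ∃ j, 0 < a j i
    · exact (hεlt i hi).le
    · push Not at hi
      simp only [(hi _).not_gt, if_false, sum_const_zero]
      exact sum_nonneg fun j _ => ha i j
  · obtain ⟨i, hi⟩ := hne
    refine ⟨i, mem_univ i, ?_⟩
    rw [← sum_div, ← sum_div]
    exact div_lt_div_of_pos_right (hεlt i hi) (hq i)

theorem half_plane_inv_lt {c d : ℝ} {x : ℂ} (hc : c ^ 2 < 1) (hx : 1 < c * x.re + d * x.im) :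
    c * x⁻¹.re + d * x⁻¹.im < 1 := by
  have hx0 : x ≠ 0 := by
    rintro rfl
    norm_num at hx
  have h : ((⟨c, -d⟩ : ℂ) * x) * ((⟨c, -d⟩ : ℂ) * x⁻¹) = (⟨c, -d⟩ : ℂ) ^ 2 := by
    field_simp
  have hre := congrArg Complex.re h
  have him := congrArg Complex.im h
  simp only [sq, Complex.mul_re, Complex.mul_im] at hre him
  refine (lt_one_of_mul_eq (c := c) (d := d) (X := c * x.re + d * x.im)
    (X' := c * x.im - d * x.re) (Y' := c * x⁻¹.im - d * x⁻¹.re) ?_ ?_ hc hx).1 <;>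
  linarith

/-- Jensen's inequality for `logRatio` along a family of complex numbers with product `1`: the
geometric mean is a root of unity. -/
theorem exists_root_of_unity_le {ι : Type*} [Fintype ι] [Nonempty ι] {c d : ℝ} (hc : c ^ 2 < 1)
    (x : ι → ℂ) (hprod : ∏ t, x t = 1) (hx : ∀ t, 1 < c * (x t).re + d * (x t).im) :
    ∃ k < Fintype.card ι,
      1 < c * Real.cos (2 * Real.pi * (k / Fintype.card ι))
        + d * Real.sin (2 * Real.pi * (k / Fintype.card ι)) ∧
      Fintype.card ι * (Real.log (1 - (c * Real.cos (2 * Real.pi * (k / Fintype.card ι))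
          - d * Real.sin (2 * Real.pi * (k / Fintype.card ι))))
        - Real.log (c * Real.cos (2 * Real.pi * (k / Fintype.card ι))
          + d * Real.sin (2 * Real.pi * (k / Fintype.card ι)) - 1)) ≤
      ∑ t, (Real.log (1 - (c * (x t)⁻¹.re + d * (x t)⁻¹.im))
        - Real.log (c * (x t).re + d * (x t).im - 1)) := by
  set m := Fintype.card ι with hm
  have hm0 : m ≠ 0 := Fintype.card_ne_zero
  have hmR : (0 : ℝ) < m := by exact_mod_cast Nat.pos_of_ne_zero hm0
  set z : ℂ := ⟨c, -d⟩ with hz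
  have hzre : ∀ y : ℂ, (z * y).re = c * y.re + d * y.im := fun y => by simp [hz]
  have hzx : ∀ t, z * x t ≠ 0 := by
    intro t h
    have := hx t
    rw [← hzre, h] at this
    norm_num at this
  have hz0 : z ≠ 0 := left_ne_zero_of_mul (hzx (Classical.arbitrary ι))
  have hexp : ∀ t, Complex.exp (Complex.log (z * x t)) = z * x t := fun t => Complex.exp_log (hzx t)
  have hmem : ∀ t ∈ (univ : Finset ι), Complex.log (z * x t) ∈ logHalfPlane := by
    intro t _
    refine ⟨?_, ?_⟩
    · rw [Complex.log_im, Complex.abs_arg_le_pi_div_two_iff, hzre]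
      linarith [hx t]
    · rw [hexp, hzre]
      exact hx t
  have hw : ∑ _t : ι, (m : ℝ)⁻¹ = 1 := by
    rw [sum_const, card_univ, nsmul_eq_mul, mul_inv_cancel₀ hmR.ne']
  have hw0 : ∀ t ∈ (univ : Finset ι), (0 : ℝ) ≤ (fun _ => (m : ℝ)⁻¹) t := fun _ _ => by positivity
  have hJ := (convexOn_logRatio (d := d) hc).map_sum_le hw0 hw hmem
  have hmean := convex_logHalfPlane.sum_mem hw0 hw hmem
  set ω := ∑ t, (m : ℝ)⁻¹ • Complex.log (z * x t) with hω
  have hωm : (m : ℂ) * ω = ∑ t, Complex.log (z * x t) := by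
    rw [hω, mul_sum]
    refine sum_congr rfl fun t _ => ?_
    rw [Complex.real_smul, Complex.ofReal_inv, Complex.ofReal_natCast, mul_inv_cancel_left₀]
    exact_mod_cast hm0
  have hpow : (Complex.exp ω / z) ^ m = 1 := by
    rw [div_pow, ← Complex.exp_nat_mul, hωm, Complex.exp_sum]
    simp only [hexp]
    rw [prod_mul_distrib, hprod, prod_const, card_univ, ← hm, mul_one, div_self (pow_ne_zero _ hz0)]
  have : NeZero m := ⟨hm0⟩
  obtain ⟨k, hk, hζ⟩ := (Complex.isPrimitiveRoot_exp m hm0).eq_pow_of_pow_eq_one hpow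
  set θ : ℝ := 2 * Real.pi * (k / m) with hθ
  have hζ' : Complex.exp ω = z * Complex.exp (θ * Complex.I) := by
    rw [← Complex.exp_nat_mul] at hζ
    rw [eq_div_iff hz0] at hζ
    rw [← hζ, mul_comm]
    congr 2
    rw [hθ]
    push_cast
    ring
  have hX : (Complex.exp ω).re = c * Real.cos θ + d * Real.sin θ := by
    rw [hζ', hzre, Complex.exp_ofReal_mul_I_re, Complex.exp_ofReal_mul_I_im]
  have hY : (z ^ 2 * Complex.exp (-ω)).re = c * Real.cos θ - d * Real.sin θ := by
    have : z ^ 2 * Complex.exp (-ω) = z * Complex.exp ((-θ : ℝ) * Complex.I) := by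
      rw [Complex.exp_neg, hζ', Complex.ofReal_neg, neg_mul, Complex.exp_neg]
      field_simp
    rw [this, hzre, Complex.exp_ofReal_mul_I_re, Complex.exp_ofReal_mul_I_im, Real.cos_neg,
      Real.sin_neg]
    ring
  refine ⟨k, hk, hX ▸ hmean.2, ?_⟩
  have hval : ∀ t, logRatio c d (Complex.log (z * x t)) =
      Real.log (1 - (c * (x t)⁻¹.re + d * (x t)⁻¹.im))
        - Real.log (c * (x t).re + d * (x t).im - 1) := by
    intro t
    have hxt : x t ≠ 0 := right_ne_zero_of_mul (hzx t)
    have : z ^ 2 * (z * x t)⁻¹ = z * (x t)⁻¹ := by field_simp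
    rw [logRatio, Complex.exp_neg, hexp, ← hz, this, hzre, hzre]
  have hval' : logRatio c d ω = Real.log (1 - (c * Real.cos θ - d * Real.sin θ))
      - Real.log (c * Real.cos θ + d * Real.sin θ - 1) := by
    rw [logRatio, ← hz, hX, hY]
  simp only [hval, smul_eq_mul, ← mul_sum] at hJ
  rwa [hval', ← div_eq_inv_mul, le_div_iff₀' hmR] at hJ

namespace MCycle

variable {n : ℕ} {R : Matrix (Fin n) (Fin n) ℝ}

theorem tanhAff_le_one (C : MCycle n R) : C.tanhAff ≤ 1 := by
  unfold tanhAff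
  split_ifs
  · exact (Real.tanh_lt_one _).le
  · exact le_rfl

theorem len_add_three_le (C : MCycle n R) : C.len + 3 ≤ n := by
  simpa [ZMod.card] using Fintype.card_le_of_injective C.vert C.inj

/-- If the edge ratios of `u` along a cycle lie in a half-plane avoiding the points
`cos θ + i F sin θ` with `F` at least the normalized affinity of the cycle, then the weighted
forward rates do not dominate the weighted backward rates. -/
theorem prod_forward_le_prod_backward (C : MCycle n R) {u : Fin n → ℂ} {c d F : ℝ}
    (hc : c ^ 2 < 1) (hF : F ≤ 1) (haff : C.tanhAff ≤ F)
    (hfarey : ∀ k : ℕ, k < C.len + 3 → c * Real.cos (2 * Real.pi * (k / (C.len + 3 : ℕ)))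
      + d * F * Real.sin (2 * Real.pi * (k / (C.len + 3 : ℕ))) < 1)
    (hu : ∀ t, u (C.vert t) ≠ 0)
    (hgt : ∀ t, 1 < c * (u (C.vert (t + 1)) / u (C.vert t)).re
      + d * (u (C.vert (t + 1)) / u (C.vert t)).im) :
    ∏ t, R (C.vert (t + 1)) (C.vert t) * (c * (u (C.vert (t + 1)) / u (C.vert t)).re
        + d * (u (C.vert (t + 1)) / u (C.vert t)).im - 1) ≤
      ∏ t, R (C.vert t) (C.vert (t + 1)) * (1 - (c * (u (C.vert t) / u (C.vert (t + 1))).re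
        + d * (u (C.vert t) / u (C.vert (t + 1))).im)) := by
  by_contra! hlt
  have hprod : ∏ t, u (C.vert (t + 1)) / u (C.vert t) = 1 := by
    have hshift : ∏ t, u (C.vert (t + 1)) = ∏ t, u (C.vert t) :=
      Equiv.prod_comp (Equiv.addRight 1) fun t => u (C.vert t)
    rw [prod_div_distrib, hshift]
    exact div_self (prod_ne_zero_iff.2 fun t _ => hu t)
  obtain ⟨k, hk, h₁, hJ⟩ := exists_root_of_unity_le hc _ hprod hgt
  rw [ZMod.card] at hk h₁ hJ
  have hcard : (0 : ℝ) < (C.len + 3 : ℕ) := by positivity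
  have hFk := hfarey k hk
  set θ := 2 * Real.pi * ((k : ℝ) / (C.len + 3 : ℕ))
  have hp : c * Real.cos θ < 1 := by
    nlinarith [Real.cos_sq_add_sin_sq θ, sq_nonneg (c - Real.cos θ), sq_nonneg (Real.sin θ)]
  have hq : 0 < d * Real.sin θ := by linarith
  have hF1 : F < 1 := by
    refine lt_of_le_of_ne hF ?_
    rintro rfl
    linarith
  unfold tanhAff at haff
  split_ifs at haff with hrev
  · have hinv : ∀ t, u (C.vert t) / u (C.vert (t + 1)) = (u (C.vert (t + 1)) / u (C.vert t))⁻¹ :=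
      fun t => (inv_div _ _).symm
    simp only [hinv] at hlt
    have hback : ∀ t, 0 < 1 - (c * (u (C.vert (t + 1)) / u (C.vert t))⁻¹.re
        + d * (u (C.vert (t + 1)) / u (C.vert t))⁻¹.im) :=
      fun t => sub_pos.2 (half_plane_inv_lt hc (hgt t))
    have hforw := fun t => sub_pos.2 (hgt t)
    have hlog := Real.log_lt_log (prod_pos fun t _ => mul_pos (hrev t) (hback t)) hlt
    rw [Real.log_prod fun t _ => (mul_pos (hrev t) (hback t)).ne',
      Real.log_prod fun t _ => (mul_pos (C.pos t) (hforw t)).ne'] at hlog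
    simp only [Real.log_mul (hrev _).ne' (hback _).ne',
      Real.log_mul (C.pos _).ne' (hforw _).ne', sum_add_distrib] at hlog
    rw [sum_sub_distrib] at hJ
    simp only [Real.log_div (C.pos _).ne' (hrev _).ne', sum_sub_distrib] at haff
    set T := (∑ t, Real.log (R (C.vert (t + 1)) (C.vert t))
      - ∑ t, Real.log (R (C.vert t) (C.vert (t + 1)))) / (2 * ((C.len : ℝ) + 3)) with hT
    have hX : 0 < c * Real.cos θ + d * Real.sin θ - 1 := by linarith
    have hY : 0 < 1 - (c * Real.cos θ - d * Real.sin θ) := by linarith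
    have hlt2 : Real.log (1 - (c * Real.cos θ - d * Real.sin θ))
        - Real.log (c * Real.cos θ + d * Real.sin θ - 1) < 2 * T := by
      have h2 : 2 * T = (∑ t, Real.log (R (C.vert (t + 1)) (C.vert t))
          - ∑ t, Real.log (R (C.vert t) (C.vert (t + 1)))) / (C.len + 3 : ℕ) := by
        rw [hT]
        push_cast
        field_simp
      rw [h2, lt_div_iff₀' hcard]
      linarith
    rw [← Real.log_div hY.ne' hX.ne', Real.log_lt_iff_lt_exp (div_pos hY hX), div_lt_iff₀ hX]
      at hlt2
    have htanh : Real.exp (2 * T) - 1 ≤ F * (Real.exp (2 * T) + 1) := by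
      have hpos := Real.exp_pos T
      rw [Real.tanh_eq, div_le_iff₀ (by positivity)] at haff
      have h := mul_le_mul_of_nonneg_left haff hpos.le
      have he : Real.exp T * Real.exp (-T) = 1 := by rw [← Real.exp_add]; simp
      rw [two_mul, Real.exp_add]
      linear_combination h + (1 + F) * he
    have hE := Real.exp_pos (2 * T)
    have h₂ := mul_le_mul_of_nonneg_left htanh hq.le
    have h₃ := mul_lt_mul_of_pos_right hFk (by linarith : 0 < Real.exp (2 * T) + 1)
    nlinarith
  · linarith

end MCycle

theorem exists_left_eigenvector {n : ℕ} {R : Matrix (Fin n) (Fin n) ℝ} {lam : ℂ}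
    (heig : ∃ v : Fin n → ℂ, v ≠ 0 ∧ R.map Complex.ofReal *ᵥ v = lam • v) :
    ∃ u : Fin n → ℂ, u ≠ 0 ∧ ∀ i, ∑ j, (R j i : ℂ) * u j = lam * u i := by
  obtain ⟨v, hv, hv'⟩ := heig
  have hdet : (R.map Complex.ofReal - lam • (1 : Matrix (Fin n) (Fin n) ℂ)).det = 0 :=
    Matrix.exists_mulVec_eq_zero_iff.1
      ⟨v, hv, by rw [sub_mulVec, hv', smul_mulVec, one_mulVec, sub_self]⟩
  obtain ⟨u, hu, hu'⟩ := Matrix.exists_vecMul_eq_zero_iff.2 hdet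
  rw [vecMul_sub, vecMul_smul, vecMul_one, sub_eq_zero] at hu'
  refine ⟨u, hu, fun i => ?_⟩
  have := congrFun hu' i
  simp only [vecMul, dotProduct, map_apply, Pi.smul_apply, smul_eq_mul] at this
  rw [← this]
  exact sum_congr rfl fun j _ => mul_comm _ _

/-- A half-plane containing all affinity-scaled Farey points contains every eigenvalue. -/
theorem eigenvalue_le_of_farey {n : ℕ} {R : Matrix (Fin n) (Fin n) ℝ}
    (hoff : ∀ i j, i ≠ j → 0 ≤ R i j) (hcol : ∀ i, ∑ j, R j i = 0)
    {r c d F : ℝ} (hr : ∀ i, -R i i ≤ r) (hc : c ^ 2 < 1) (hF : F ≤ 1)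
    (haff : ∀ C : MCycle n R, C.tanhAff ≤ F)
    (hfarey : ∀ q : ℚ, 0 ≤ q → q ≤ 1 → q.den ≤ n →
      c * Real.cos (2 * Real.pi * q) + d * F * Real.sin (2 * Real.pi * q) < 1)
    {lam : ℂ} {u : Fin n → ℂ} (hu : u ≠ 0) (heig : ∀ i, ∑ j, (R j i : ℂ) * u j = lam * u i) :
    c * lam.re + d * lam.im ≤ r * (1 - c) := by
  by_contra! hlam
  have hc1 : c < 1 := by nlinarith
  set ℓ : ℂ → ℝ := fun x => c * x.re + d * x.im with hℓ
  set K : Fin n → Fin n → ℝ := fun i j => if i = j then 0 else R j i with hK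
  have hK0 : ∀ i j, 0 ≤ K i j := by
    intro i j
    simp only [hK]
    split_ifs with h
    · exact le_rfl
    · exact hoff j i (Ne.symm h)
  have hRK : ∀ i j, R j i = K i j + if i = j then R i i else 0 := by
    intro i j
    simp only [hK]
    split_ifs with h
    · rw [h, zero_add]
    · rw [add_zero]
  have hKsum : ∀ i, ∑ j, K i j = -R i i := by
    intro i
    have := hcol i
    rw [sum_congr rfl fun j _ => hRK i j, sum_add_distrib, sum_ite_eq, if_pos (mem_univ i)] at this
    linarith
  set a : Fin n → Fin n → ℝ := fun i j => K i j * max (ℓ (u j / u i) - 1) 0 with ha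
  set b : Fin n → Fin n → ℝ := fun i j => K i j * max (1 - ℓ (u j / u i)) 0 with hb
  have ha0 : ∀ i j, 0 ≤ a i j := fun i j => mul_nonneg (hK0 i j) (le_max_right _ _)
  have hb0 : ∀ i j, 0 ≤ b i j := fun i j => mul_nonneg (hK0 i j) (le_max_right _ _)
  have hedge : ∀ i j, 0 < a i j → i ≠ j ∧ 0 < R j i ∧ 1 < ℓ (u j / u i) ∧ u i ≠ 0 ∧ u j ≠ 0 := by
    intro i j hij
    have hKpos : 0 < K i j := pos_of_mul_pos_left hij (le_max_right _ _)
    have hmax : 0 < max (ℓ (u j / u i) - 1) 0 := pos_of_mul_pos_right hij (hK0 i j)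
    have hℓ1 : 1 < ℓ (u j / u i) := by
      rcases lt_max_iff.1 hmax with h | h
      · linarith
      · exact absurd h (lt_irrefl _)
    have hne : i ≠ j := by
      rintro rfl
      simp [hK] at hKpos
    have hdiv : u j / u i ≠ 0 := by
      intro h
      rw [h] at hℓ1
      simp only [hℓ, Complex.zero_re, Complex.zero_im, mul_zero, add_zero] at hℓ1
      linarith
    rw [div_ne_zero_iff] at hdiv
    refine ⟨hne, ?_, hℓ1, hdiv.2, hdiv.1⟩
    simpa [hK, hne] using hKpos
  have hstrict : ∀ i, u i ≠ 0 → ∑ j, b i j < ∑ j, a i j := by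
    intro i hi
    have h₁ : ∑ j, (R j i : ℂ) * (u j / u i) = lam := by
      refine mul_right_cancel₀ hi ?_
      rw [← heig i, sum_mul]
      exact sum_congr rfl fun j _ => by rw [mul_assoc, div_mul_cancel₀ _ hi]
    have h₂ : ∑ j, R j i * ℓ (u j / u i) = c * lam.re + d * lam.im := by
      rw [← h₁, Complex.re_sum, Complex.im_sum, mul_sum, mul_sum, ← sum_add_distrib]
      refine sum_congr rfl fun j _ => ?_
      rw [Complex.re_ofReal_mul, Complex.im_ofReal_mul]
      simp only [hℓ]
      ring
    have hsplit : ∑ j, R j i * ℓ (u j / u i) = ∑ j, K i j * ℓ (u j / u i) + R i i * ℓ 1 := by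
      rw [sum_congr rfl fun j _ => congrArg (· * ℓ (u j / u i)) (hRK i j)]
      simp only [add_mul, ite_mul, zero_mul, sum_add_distrib, sum_ite_eq, mem_univ, if_true,
        div_self hi]
    have h₃ : ℓ 1 = c := by simp [hℓ]
    have h₄ : ∑ j, b i j - ∑ j, a i j = ∑ j, K i j - ∑ j, K i j * ℓ (u j / u i) := by
      rw [← sum_sub_distrib, ← sum_sub_distrib]
      refine sum_congr rfl fun j _ => ?_
      simp only [ha, hb]
      rcases le_total (ℓ (u j / u i)) 1 with h | h
      · rw [max_eq_left (by linarith), max_eq_right (by linarith)]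
        ring
      · rw [max_eq_right (by linarith), max_eq_left (by linarith)]
        ring
    have h₅ := mul_le_mul_of_nonneg_right (hr i) (sub_pos.2 hc1).le
    rw [hKsum] at h₄
    rw [hsplit, h₃] at h₂
    linarith
  obtain ⟨k, v, hv, hpos, hlt⟩ := exists_cycle_prod_lt ha0 hb0
    (fun i ⟨j, hj⟩ => (sum_le_sum fun k _ => by
      split_ifs
      · exact le_rfl
      · exact hb0 i k).trans_lt (hstrict i (hedge j i hj).2.2.2.2))
    (by
      obtain ⟨j, hj⟩ := Function.ne_iff.1 hu
      have h : 0 < ∑ i, a j i := (sum_nonneg fun i _ => hb0 j i).trans_lt (hstrict j hj)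
      obtain ⟨i, -, hi⟩ := exists_lt_of_sum_lt (s := univ) (f := fun _ => 0) (g := a j) (by simpa)
      exact ⟨i, j, hi⟩)
  have hinv : ∀ t, ℓ (u (v t) / u (v (t + 1))) < 1 := by
    intro t
    rw [← inv_div]
    exact half_plane_inv_lt hc (hedge _ _ (hpos t)).2.2.1
  rcases k with _ | _ | m
  · exact (hedge _ _ (hpos 0)).1 rfl
  · exact lt_asymm (hedge _ _ (hpos 1)).2.2.1 (hinv 0)
  · let C : MCycle n R := ⟨m, v, hv, fun t => (hedge _ _ (hpos t)).2.1⟩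
    have hle := C.prod_forward_le_prod_backward (u := u) (c := c) (d := d) hc hF (haff C)
      (fun k hk => by
        have hden : ((k : ℚ) / (m + 3 : ℕ)).den ∣ m + 3 := by
          have := Rat.den_dvd k ((m + 3 : ℕ) : ℤ)
          rw [Rat.divInt_eq_div, Int.cast_natCast, Int.cast_natCast] at this
          exact Int.natCast_dvd_natCast.1 this
        have hq := hfarey ((k : ℚ) / (m + 3 : ℕ)) (by positivity)
          ((div_le_one (by positivity)).2 (by exact_mod_cast hk.le))
          ((Nat.le_of_dvd (by positivity) hden).trans C.len_add_three_le)
        simpa using hq)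
      (fun t => (hedge _ _ (hpos t)).2.2.2.1) (fun t => (hedge _ _ (hpos t)).2.2.1)
    refine hlt.not_ge (le_trans (le_of_eq ?_) (hle.trans (le_of_eq ?_)))
    · refine prod_congr rfl fun t _ => ?_
      obtain ⟨h₁, -, h₂, -⟩ := hedge _ _ (hpos t)
      simp only [ha, hK, if_neg h₁]
      rw [max_eq_left (by linarith)]
      rfl
    · refine prod_congr rfl fun t _ => ?_
      simp only [hb, hK, if_neg (hedge _ _ (hpos t)).1.symm]
      rw [max_eq_left (by linarith [hinv t])]
      rfl

theorem finite_farey (n : ℕ) : {q : ℚ | 0 ≤ q ∧ q ≤ 1 ∧ q.den ≤ n}.Finite := by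
  refine ((Set.finite_Iic n).prod (Set.finite_Iic n)).image
    (fun p : ℕ × ℕ => (p.1 : ℚ) / p.2) |>.subset ?_
  rintro q ⟨h₀, h₁, hq⟩
  have hnum : ((q.num.toNat : ℕ) : ℤ) = q.num := Int.toNat_of_nonneg (Rat.num_nonneg.2 h₀)
  refine ⟨(q.num.toNat, q.den), ⟨?_, hq⟩, ?_⟩
  · have : q.num ≤ q.den := by
      rw [← Rat.num_div_den q, div_le_one (by exact_mod_cast q.den_pos)] at h₁
      exact_mod_cast h₁
    change q.num.toNat ≤ n
    omega
  · change ((q.num.toNat : ℕ) : ℚ) / q.den = q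
    rw [← Int.cast_natCast, hnum, Rat.num_div_den]

theorem multicyclic_farey_localization
    (n : ℕ) (R : Matrix (Fin n) (Fin n) ℝ)
    (hoff : ∀ i j, i ≠ j → 0 ≤ R i j) (hcol : ∀ i, ∑ j, R j i = 0)
    (r : ℝ) (hr : IsGreatest (Set.range fun i => -R i i) r)
    (Fs : ℝ) (hFs : Fs = ⨆ c : MCycle n R, c.tanhAff)
    (lam : ℂ)
    (heig : ∃ v : Fin n → ℂ, v ≠ 0 ∧ R.map Complex.ofReal *ᵥ v = lam • v) :
    lam ∈ convexHull ℝ {z : ℂ | ∃ q : ℚ, 0 ≤ q ∧ q ≤ 1 ∧ q.den ≤ n ∧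
      z = ((r * (Real.cos (2 * Real.pi * (q : ℝ)) - 1) : ℝ) : ℂ) +
        Complex.I * ((r * Fs * Real.sin (2 * Real.pi * (q : ℝ)) : ℝ) : ℂ)} := by
  obtain ⟨u, hu, hueig⟩ := exists_left_eigenvector heig
  obtain ⟨⟨i₀, hi₀⟩, hub⟩ := hr
  replace hub : ∀ i, -R i i ≤ r := fun i => hub ⟨i, rfl⟩
  have hsplit : ∀ i, R i i + ∑ j ∈ univ.erase i, R j i = 0 := fun i => by
    rw [add_sum_erase _ (fun j => R j i) (mem_univ i), hcol]
  have hoffsum : ∀ i, ∀ j ∈ univ.erase i, 0 ≤ R j i := fun i j hj => hoff j i (ne_of_mem_erase hj)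
  have hr0 : 0 ≤ r := by linarith [hub i₀, hsplit i₀, sum_nonneg (hoffsum i₀)]
  rcases hr0.eq_or_lt with rfl | hr0
  · have hR : ∀ i j, R j i = 0 := by
      intro i
      have hsum : ∑ j ∈ univ.erase i, R j i = 0 :=
        le_antisymm (by linarith [hub i, hsplit i]) (sum_nonneg (hoffsum i))
      intro j
      rcases eq_or_ne j i with rfl | hji
      · linarith [hsplit j]
      · exact (sum_eq_zero_iff_of_nonneg (hoffsum i)).1 hsum j (mem_erase.2 ⟨hji, mem_univ j⟩)
    obtain ⟨i, hi⟩ := Function.ne_iff.1 hu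
    have hlam : lam = 0 := by
      have := hueig i
      simp only [hR, Complex.ofReal_zero, zero_mul, sum_const_zero] at this
      exact (mul_eq_zero.1 this.symm).resolve_right hi
    exact subset_convexHull ℝ _ ⟨0, le_rfl, zero_le_one, i₀.pos, by simp [hlam]⟩
  have hn : 2 ≤ n := by
    by_contra! hn
    have : Subsingleton (Fin n) := Fin.subsingleton_iff_le_one.2 (by omega)
    have h := hcol i₀
    rw [Fintype.sum_subsingleton _ i₀] at h
    linarith
  by_contra hnot
  obtain ⟨f, s, hfs, hflam⟩ := geometric_hahn_banach_closed_point (convex_convexHull ℝ _)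
    (Set.Finite.isClosed_convexHull ℝ (((finite_farey n).image fun q : ℚ =>
      ((r * (Real.cos (2 * Real.pi * (q : ℝ)) - 1) : ℝ) : ℂ) +
        Complex.I * ((r * Fs * Real.sin (2 * Real.pi * (q : ℝ)) : ℝ) : ℂ)).subset (by
      rintro z ⟨q, h₀, h₁, hq, rfl⟩
      exact ⟨q, ⟨h₀, h₁, hq⟩, rfl⟩))) hnot
  have hf : ∀ x y : ℝ, f (x + Complex.I * y) = f 1 * x + f Complex.I * y := by
    intro x y
    have : (x : ℂ) + Complex.I * y = x • (1 : ℂ) + y • Complex.I := by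
      simp [mul_comm]
    rw [this, map_add, map_smul, map_smul, smul_eq_mul, smul_eq_mul]
    ring
  set α := f 1
  set β := f Complex.I
  obtain ⟨M, rfl⟩ : ∃ M, s = r * (M - α) := ⟨α + s / r, by field_simp; ring⟩
  have hM : ∀ q : ℚ, 0 ≤ q → q ≤ 1 → q.den ≤ n →
      α * Real.cos (2 * Real.pi * q) + β * Fs * Real.sin (2 * Real.pi * q) < M := by
    intro q h₀ h₁ hq
    have := hfs _ (subset_convexHull ℝ _ ⟨q, h₀, h₁, hq, rfl⟩)
    rw [hf] at this
    refine lt_of_mul_lt_mul_left ?_ hr0.le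
    linarith
  have hα₁ : α < M := by simpa using hM 0 le_rfl zero_le_one i₀.pos
  have hα₂ : -α < M := by
    have hden : ((1 / 2 : ℚ)).den ≤ n := by
      norm_num
      exact hn
    have := hM (1 / 2) (by norm_num) (by norm_num) hden
    rw [show 2 * Real.pi * ((1 / 2 : ℚ) : ℝ) = Real.pi by push_cast; ring, Real.cos_pi,
      Real.sin_pi] at this
    linarith
  have hM0 : 0 < M := by linarith
  have haff : ∀ C : MCycle n R, C.tanhAff ≤ Fs := fun C => by
    rw [hFs]
    exact le_ciSup ⟨1, Set.forall_mem_range.2 MCycle.tanhAff_le_one⟩ C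
  have hF1 : Fs ≤ 1 := by
    rw [hFs]
    exact Real.iSup_le MCycle.tanhAff_le_one zero_le_one
  have hle := eigenvalue_le_of_farey hoff hcol (c := α / M) (d := β / M) hub
    (by rw [div_pow, div_lt_one (by positivity)]; nlinarith) hF1 haff
    (fun q h₀ h₁ hq => by
      have := (div_lt_one hM0).2 (hM q h₀ h₁ hq)
      refine lt_of_eq_of_lt ?_ this
      ring) hu hueig
  have hlam := hf lam.re lam.im
  rw [mul_comm Complex.I, Complex.re_add_im] at hlam
  rw [hlam] at hflam
  have h := mul_le_mul_of_nonneg_left hle hM0.le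
  have e₁ : M * (α / M * lam.re + β / M * lam.im) = α * lam.re + β * lam.im := by field_simp
  have e₂ : M * (r * (1 - α / M)) = r * (M - α) := by field_simp
  linarith
end

section
/- Let R be a Markov generator on n states with maximum escape rate r, let C⁺ be the nonempty set of cycles c of R with F_c > 0, and fix an assignment 𝐰 giving every c ∈ C⁺ a winding number 𝐰_c ∈ {1,…,⌈n_c/2⌉−1}. Let Ω(𝐰) be the convex hull in ℂ of {−2r, 0} ∪ ⋃_{c∈C⁺} {λ^unif_{F_c,n_c,𝐰_c}, conj(λ^unif_{F_c,n_c,𝐰_c})}. Then Ω(𝐰) = { x + 𝒊y : −2r ≤ x ≤ 0, |y| ≤ ψ_𝐰(x) }, where ψ_𝐰(−2r) = ψ_𝐰(0) = 0 and, for x ∈ (−2r, 0), ψ_𝐰(x) = min over τ ∈ [0,1] of the max over c ∈ C⁺ of tanh(F_c/(2n_c)) / ( (τ/(−x))·tan(π𝐰_c/n_c) + ((1−τ)/(2r+x))·cot(π𝐰_c/n_c) ). -/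
open Matrix Finset

/-- The uniform-cycle eigenvalue `λ^unif`: for escape rate `r`, normalized
affinity factor `T = tanh (F/2m)`, cycle size `m` and winding number `w`,
`λ^unif = r (cos (2πw/m) - 1) + i r T sin (2πw/m)`. -/
noncomputable def uPoint (r T : ℝ) (m w : ℕ) : ℂ :=
  ((r * (Real.cos (2 * Real.pi * w / m) - 1) : ℝ) : ℂ) +
    Complex.I * ((r * T * Real.sin (2 * Real.pi * w / m) : ℝ) : ℂ)

/-- The convex hull `Ω(𝐰)` generated by `{-2r, 0}` together with the
uniform-cycle eigenvalues (and their conjugates) of all positive-affinity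
cycles, with winding numbers assigned by `W`. -/
noncomputable def hullSet {n : ℕ} (R : Matrix (Fin n) (Fin n) ℝ) (r : ℝ)
    (W : MCycle n R → ℕ) : Set ℂ :=
  convexHull ℝ ({((-(2 * r) : ℝ) : ℂ), 0} ∪
    ⋃ (c : MCycle n R) (_ : c.affPos),
      {uPoint r c.tanhAff (c.len + 3) (W c),
       (starRingEnd ℂ) (uPoint r c.tanhAff (c.len + 3) (W c))})

/-- The upper envelope `ψ_𝐰` of the hull `Ω(𝐰)`: zero at the endpoints
`-2r` and `0`, and otherwise the min over `τ ∈ [0,1]` of the max over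
positive-affinity cycles of
`tanh(F_c/2n_c) / (τ/(-x) · tan(π𝐰_c/n_c) + (1-τ)/(2r+x) · cot(π𝐰_c/n_c))`. -/
noncomputable def psiEnv {n : ℕ} (R : Matrix (Fin n) (Fin n) ℝ) (r : ℝ)
    (W : MCycle n R → ℕ) : ℝ → ℝ := fun x =>
  open Classical in
  if x = -(2 * r) ∨ x = 0 then 0
  else
    ⨅ τ : Set.Icc (0 : ℝ) 1, ⨆ c : {c : MCycle n R // c.affPos},
      c.1.tanhAff /
        (((τ : ℝ) / (-x)) * Real.tan (Real.pi * (W c.1 : ℝ) / (c.1.len + 3)) +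
         ((1 - (τ : ℝ)) / (2 * r + x)) * Real.cot (Real.pi * (W c.1 : ℝ) / (c.1.len + 3)))

section ConvexHullEnvelope

variable {ι : Type*} {L : ℝ} {p : ι → ℂ}

/-- The conjugation-symmetric set spanned by the real points `-L`, `0` and the points `p i`. -/
def symmSpan (L : ℝ) (p : ι → ℂ) : Set ℂ :=
  {((-L : ℝ) : ℂ), 0} ∪ ⋃ i, {p i, (starRingEnd ℂ) (p i)}

theorem symmSpan_finite [Finite ι] : (symmSpan L p).Finite :=
  (Set.toFinite _).union (Set.finite_iUnion fun _ => Set.toFinite _)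

/-- An affine majorant of the points `p i`, nonnegative at `-L` and `0`, bounds the convex hull. -/
theorem abs_im_le_of_mem_convexHull (hL : 0 ≤ L) {A B : ℝ} (hA : 0 ≤ A) (hB : 0 ≤ B)
    (hp0 : ∀ i, 0 ≤ (p i).im) (hp : ∀ i, (p i).im ≤ A * -(p i).re + B * (L + (p i).re))
    {z : ℂ} (hz : z ∈ convexHull ℝ (symmSpan L p)) :
    |z.im| ≤ A * -z.re + B * (L + z.re) := by
  suffices h : convexHull ℝ (symmSpan L p) ⊆
      {w : ℂ | |w.im| ≤ A * -w.re + B * (L + w.re)} from h hz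
  refine convexHull_min ?_ ?_
  · rintro w (hw | hw)
    · rcases hw with rfl | rfl
      · simp; positivity
      · simp; positivity
    · obtain ⟨i, rfl | rfl⟩ := Set.mem_iUnion.1 hw
      · simpa [abs_of_nonneg (hp0 i)] using hp i
      · simpa [abs_of_nonneg (hp0 i)] using hp i
  · intro a ha b hb s t hs ht hst
    simp only [Set.mem_ofPred_eq, abs_le, Complex.add_im, Complex.add_re, Complex.smul_im,
      Complex.smul_re, smul_eq_mul] at ha hb ⊢
    obtain rfl : t = 1 - s := by linarith
    constructor
    · linear_combination s * ha.1 + (1 - s) * hb.1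
    · linear_combination s * ha.2 + (1 - s) * hb.2

theorem re_mem_Icc_of_mem_convexHull (hL : 0 ≤ L) (hp : ∀ i, (p i).re ∈ Set.Icc (-L) 0)
    {z : ℂ} (hz : z ∈ convexHull ℝ (symmSpan L p)) : z.re ∈ Set.Icc (-L) 0 := by
  suffices h : convexHull ℝ (symmSpan L p) ⊆ Complex.reLm ⁻¹' Set.Icc (-L) 0 from h hz
  refine convexHull_min ?_ ((convex_Icc _ _).linear_preimage _)
  rintro w (hw | hw)
  · rcases hw with rfl | rfl <;> simp [hL]
  · obtain ⟨i, rfl | rfl⟩ := Set.mem_iUnion.1 hw <;> simpa using hp i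

/-- A point outside the convex hull, over the interval `[-L, 0]`, is separated from it by an
affine majorant of the points `p i`. -/
theorem exists_majorant_of_notMem_convexHull [Finite ι] (hL : 0 < L) {z : ℂ}
    (hz : z.re ∈ Set.Icc (-L) 0) (hzn : z ∉ convexHull ℝ (symmSpan L p)) :
    ∃ A B : ℝ, 0 ≤ A ∧ 0 ≤ B ∧ (∀ i, (p i).im ≤ A * -(p i).re + B * (L + (p i).re)) ∧
      A * -z.re + B * (L + z.re) < |z.im| := by
  obtain ⟨f, u, hf, hu⟩ := geometric_hahn_banach_closed_point
    (convex_convexHull ℝ (symmSpan L p)) (symmSpan_finite.isClosed_convexHull ℝ) hzn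
  set a := f 1
  set b := f Complex.I
  have hfw : ∀ w : ℂ, f w = a * w.re + b * w.im := fun w => by
    have : w = w.re • (1 : ℂ) + w.im • Complex.I := by
      apply Complex.ext <;> simp
    conv_lhs => rw [this]
    rw [map_add, map_smul, map_smul, smul_eq_mul, smul_eq_mul]
    ring
  have hf' : ∀ w ∈ symmSpan L p, a * w.re + b * w.im < u := fun w hw =>
    hfw w ▸ hf w (subset_convexHull ℝ _ hw)
  rw [hfw] at hu
  have h0 : 0 < u := by simpa using hf' 0 (by simp [symmSpan])
  have h1 : 0 < u + a * L := by
    have := hf' ((-L : ℝ) : ℂ) (Or.inl (Or.inl rfl))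
    simp only [Complex.ofReal_re, Complex.ofReal_im] at this
    linarith
  have hpi : ∀ i, a * (p i).re + |b| * (p i).im < u := fun i => by
    have h2 := hf' (p i) (Or.inr (Set.mem_iUnion.2 ⟨i, Or.inl rfl⟩))
    have h3 := hf' _ (Or.inr (Set.mem_iUnion.2 ⟨i, Or.inr rfl⟩))
    simp only [Complex.conj_re, Complex.conj_im] at h3
    rcases abs_cases b with ⟨hb, -⟩ | ⟨hb, -⟩ <;> rw [hb] <;> linarith
  have hzb : u < a * z.re + |b| * |z.im| := by
    have := le_abs_self (b * z.im)
    rw [abs_mul] at this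
    linarith
  have hline : ∀ t : ℝ, (u + a * L) / (L * |b|) * -t + u / (L * |b|) * (L + t) =
      (u - a * t) / |b| := fun t => by
    rw [div_mul_eq_mul_div, div_mul_eq_mul_div, ← add_div,
      ← mul_div_mul_left (u - a * t) |b| hL.ne']
    congr 1
    ring
  have hb : 0 < |b| := by
    refine (abs_nonneg b).lt_of_ne fun hb => ?_
    rw [← hb] at hzb
    nlinarith [hz.1, hz.2, mul_nonneg h0.le (by linarith [hz.1] : 0 ≤ L + z.re),
      mul_nonneg h1.le (by linarith [hz.2] : 0 ≤ -z.re)]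
  refine ⟨(u + a * L) / (L * |b|), u / (L * |b|), by positivity, by positivity, fun i => ?_, ?_⟩
  · rw [hline, le_div_iff₀ hb]
    linarith [hpi i]
  · rw [hline, div_lt_iff₀ hb]
    linarith

/-- The upper envelope of a convex hull containing the chord `[-L, 0]`, as a minimum over the
affine majorants through the height sought. -/
theorem mem_convexHull_symmSpan_iff [Finite ι] [Nonempty ι] (hL : 0 < L)
    (hre : ∀ i, (p i).re ∈ Set.Ioo (-L) 0) (him : ∀ i, 0 < (p i).im)
    {z : ℂ} (hz : z.re ∈ Set.Ioo (-L) 0) :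
    z ∈ convexHull ℝ (symmSpan L p) ↔
      |z.im| ≤ ⨅ τ : Set.Icc (0 : ℝ) 1, ⨆ i, (p i).im /
        ((τ : ℝ) / -z.re * -(p i).re + (1 - (τ : ℝ)) / (L + z.re) * (L + (p i).re)) := by
  have hx : 0 < -z.re := by linarith [hz.2]
  have hx' : 0 < L + z.re := by linarith [hz.1]
  have hpx : ∀ i, 0 < -(p i).re := fun i => by linarith [(hre i).2]
  have hpx' : ∀ i, 0 < L + (p i).re := fun i => by linarith [(hre i).1]
  have hden : ∀ τ ∈ Set.Icc (0 : ℝ) 1, ∀ i,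
      0 < τ / -z.re * -(p i).re + (1 - τ) / (L + z.re) * (L + (p i).re) := by
    intro τ hτ i
    rcases hτ.1.eq_or_lt with rfl | h
    · have := mul_pos (one_div_pos.2 hx') (hpx' i)
      simpa using this
    · have h1 := mul_pos (div_pos h hx) (hpx i)
      have h2 := mul_nonneg (div_nonneg (sub_nonneg.2 hτ.2) hx'.le) (hpx' i).le
      linarith
  have hbdd : BddBelow (Set.range fun τ : Set.Icc (0 : ℝ) 1 => ⨆ i, (p i).im /
      ((τ : ℝ) / -z.re * -(p i).re + (1 - (τ : ℝ)) / (L + z.re) * (L + (p i).re))) := by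
    refine ⟨0, ?_⟩
    rintro _ ⟨τ, rfl⟩
    exact Real.iSup_nonneg fun i => (div_pos (him i) (hden τ τ.2 i)).le
  constructor
  · intro h
    have : Nonempty (Set.Icc (0 : ℝ) 1) := ⟨⟨0, by simp⟩⟩
    refine le_ciInf fun τ => ?_
    set y := ⨆ i, (p i).im /
      ((τ : ℝ) / -z.re * -(p i).re + (1 - (τ : ℝ)) / (L + z.re) * (L + (p i).re)) with hy
    have hy0 : 0 ≤ y := Real.iSup_nonneg fun i => (div_pos (him i) (hden τ τ.2 i)).le
    have hτ : (0 : ℝ) ≤ 1 - τ := sub_nonneg.2 τ.2.2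
    have hτ' : (0 : ℝ) ≤ τ := τ.2.1
    have key := abs_im_le_of_mem_convexHull (A := y * (τ / -z.re))
      (B := y * ((1 - τ) / (L + z.re))) hL.le (by positivity) (by positivity)
      (fun i => (him i).le) (fun i => ?_) h
    · rw [mul_assoc, mul_assoc, div_mul_cancel₀ _ hx.ne', div_mul_cancel₀ _ hx'.ne'] at key
      linarith
    · have := (div_le_iff₀ (hden τ τ.2 i)).1 (le_ciSup (f := fun i => (p i).im /
        ((τ : ℝ) / -z.re * -(p i).re + (1 - (τ : ℝ)) / (L + z.re) * (L + (p i).re)))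
        (Set.finite_range _).bddAbove i)
      rw [← hy] at this
      linarith
  · intro h
    by_contra hzn
    obtain ⟨A, B, hA, hB, hmaj, hlt⟩ :=
      exists_majorant_of_notMem_convexHull hL (Set.Ioo_subset_Icc_self hz) hzn
    set y := A * -z.re + B * (L + z.re) with hy
    have hA' := mul_nonneg hA hx.le
    have hB' := mul_nonneg hB hx'.le
    have hy0 : 0 < y := by
      refine (add_nonneg hA' hB').lt_of_ne fun h0 => ?_
      have hA0 : A = 0 := (mul_eq_zero.1 (by linarith : A * -z.re = 0)).resolve_right hx.ne'
      have hB0 : B = 0 := (mul_eq_zero.1 (by linarith : B * (L + z.re) = 0)).resolve_right hx'.ne'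
      obtain ⟨i⟩ := ‹Nonempty ι›
      have := hmaj i
      rw [hA0, hB0] at this
      linarith [him i]
    have hτ : A * -z.re / y ∈ Set.Icc (0 : ℝ) 1 :=
      ⟨by positivity, (div_le_one hy0).2 (by linarith)⟩
    refine (hlt.trans_le (h.trans (ciInf_le hbdd ⟨_, hτ⟩))).not_ge (ciSup_le fun i => ?_)
    rw [div_le_iff₀ (hden _ hτ i)]
    have h1 : A * -z.re / y / -z.re = A / y := by
      rw [div_right_comm, mul_div_cancel_right₀ _ hx.ne']
    have h2 : (1 - A * -z.re / y) / (L + z.re) = B / y := by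
      rw [one_sub_div hy0.ne', hy, add_sub_cancel_left]
      field_simp
    rw [h1, h2, mul_add, ← mul_assoc, ← mul_assoc, mul_div_cancel₀ _ hy0.ne',
      mul_div_cancel₀ _ hy0.ne']
    exact hmaj i

/-- Over the endpoints of the chord `[-L, 0]`, the convex hull contains only real points. -/
theorem im_eq_zero_of_mem_convexHull [Finite ι] (hL : 0 < L)
    (hre : ∀ i, (p i).re ∈ Set.Ioo (-L) 0) (him : ∀ i, 0 ≤ (p i).im)
    {z : ℂ} (hz : z ∈ convexHull ℝ (symmSpan L p)) (hend : z.re = -L ∨ z.re = 0) :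
    z.im = 0 := by
  have hbd : ∀ d : ι → ℝ, (∀ i, 0 < d i) → ∃ K : ℝ, 0 ≤ K ∧ ∀ i, (p i).im ≤ K * d i := by
    intro d hd
    obtain ⟨K, hK⟩ := (Set.finite_range fun i => (p i).im / d i).bddAbove
    exact ⟨max K 0, le_max_right _ _, fun i =>
      (div_le_iff₀ (hd i)).1 ((hK (Set.mem_range_self i)).trans (le_max_left _ _))⟩
  rw [← abs_nonpos_iff]
  rcases hend with h | h
  · obtain ⟨K, hK, hKp⟩ := hbd (fun i => L + (p i).re) fun i => by linarith [(hre i).1]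
    simpa [h] using abs_im_le_of_mem_convexHull hL.le le_rfl hK him
      (fun i => by simpa using hKp i) hz
  · obtain ⟨K, hK, hKp⟩ := hbd (fun i => -(p i).re) fun i => by linarith [(hre i).2]
    simpa [h] using abs_im_le_of_mem_convexHull hL.le hK le_rfl him
      (fun i => by simpa using hKp i) hz

end ConvexHullEnvelope

theorem Real.tanh_pos_of_pos {x : ℝ} (hx : 0 < x) : 0 < Real.tanh x := by
  rw [Real.tanh_eq_sinh_div_cosh]
  exact div_pos (Real.sinh_pos_iff.2 hx) (Real.cosh_pos x)

theorem uPoint_re (r T : ℝ) (m w : ℕ) :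
    (uPoint r T m w).re = -(2 * r * Real.sin (Real.pi * w / m) ^ 2) := by
  have : 2 * Real.pi * w / m = 2 * (Real.pi * w / m) := by ring
  simp only [uPoint, this, Complex.add_re, Complex.mul_re, Complex.I_re, Complex.I_im,
    Complex.ofReal_re, Complex.ofReal_im, Real.cos_two_mul, Real.sin_sq]
  ring

theorem uPoint_im (r T : ℝ) (m w : ℕ) :
    (uPoint r T m w).im =
      2 * r * T * Real.sin (Real.pi * w / m) * Real.cos (Real.pi * w / m) := by
  have : 2 * Real.pi * w / m = 2 * (Real.pi * w / m) := by ring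
  simp only [uPoint, this, Complex.add_im, Complex.mul_im, Complex.I_re, Complex.I_im,
    Complex.ofReal_re, Complex.ofReal_im, Real.sin_two_mul]
  ring

theorem div_tan_add_cot {r T a b s c : ℝ} (hr : r ≠ 0) (hs : s ≠ 0) (hc : c ≠ 0) :
    T / (a * (s / c) + b * (c / s)) =
      2 * r * T * s * c / (a * (2 * r * s ^ 2) + b * (2 * r * c ^ 2)) := by
  have h : a * (2 * r * s ^ 2) + b * (2 * r * c ^ 2) =
      (2 * r * s * c) * (a * (s / c) + b * (c / s)) := by
    field_simp
  rw [h, show 2 * r * T * s * c = (2 * r * s * c) * T by ring,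
    mul_div_mul_left _ _ (by positivity)]

namespace MCycle

variable {n : ℕ} {R : Matrix (Fin n) (Fin n) ℝ}

theorem len_lt (c : MCycle n R) : c.len < n := by
  have h := Fintype.card_le_of_injective c.vert c.inj
  rw [ZMod.card, Fintype.card_fin] at h
  omega

instance : Finite (MCycle n R) := by
  refine Finite.of_injective (β := Σ l : Fin n, ZMod ((l : ℕ) + 3) → Fin n)
    (fun c => ⟨⟨c.len, c.len_lt⟩, c.vert⟩) ?_
  rintro ⟨l, v, _, _⟩ ⟨l', v', _, _⟩ h
  simp only [Sigma.mk.injEq, Fin.mk.injEq] at h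
  obtain ⟨rfl, h⟩ := h
  simpa using h

theorem tanhAff_pos {c : MCycle n R} (hc : c.affPos) : 0 < c.tanhAff := by
  unfold tanhAff
  split_ifs with h
  · exact Real.tanh_pos_of_pos (div_pos (hc h) (by positivity))
  · exact one_pos

/-- A generator with a cycle has positive maximum escape rate. -/
theorem escapeRate_pos (c : MCycle n R) (hoff : ∀ i j, i ≠ j → 0 ≤ R i j)
    (hcol : ∀ i, ∑ j, R j i = 0) {r : ℝ} (hr : IsGreatest (Set.range fun i => -R i i) r) :
    0 < r := by
  have hne : c.vert (0 + 1) ≠ c.vert 0 := fun h => by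
    have : Fact (1 < c.len + 3) := ⟨by omega⟩
    simpa using c.inj h
  refine lt_of_lt_of_le ?_ (hr.2 (Set.mem_range_self (c.vert 0)))
  have hsum := Finset.add_sum_erase univ (fun j => R j (c.vert 0)) (mem_univ (c.vert 0))
  have hle := Finset.single_le_sum (f := fun j => R j (c.vert 0)) (s := univ.erase (c.vert 0))
    (fun j hj => hoff _ _ (ne_of_mem_erase hj)) (mem_erase.2 ⟨hne, mem_univ _⟩)
  have := c.pos 0
  have := hcol (c.vert 0)
  change 0 < -R (c.vert 0) (c.vert 0)
  linarith

theorem winding_angle_mem {w len : ℕ} (hw : 1 ≤ w ∧ w ≤ (len + 4) / 2 - 1) :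
    Real.pi * w / ((len + 3 : ℕ) : ℝ) ∈ Set.Ioo 0 (Real.pi / 2) := by
  have hm : (0 : ℝ) < ((len + 3 : ℕ) : ℝ) := by positivity
  have h1 : (0 : ℝ) < w := by exact_mod_cast hw.1
  have h2 : (2 * w : ℝ) < ((len + 3 : ℕ) : ℝ) := by
    have : 2 * w < len + 3 := by omega
    exact_mod_cast this
  refine ⟨by positivity, ?_⟩
  rw [div_lt_div_iff₀ hm two_pos]
  nlinarith [Real.pi_pos]

end MCycle

theorem hull_envelope
    (n : ℕ) (R : Matrix (Fin n) (Fin n) ℝ)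
    (hoff : ∀ i j, i ≠ j → 0 ≤ R i j) (hcol : ∀ i, ∑ j, R j i = 0)
    (r : ℝ) (hr : IsGreatest (Set.range fun i => -R i i) r)
    (hne : ∃ c : MCycle n R, c.affPos)
    (W : MCycle n R → ℕ)
    (hW : ∀ c : MCycle n R, c.affPos → 1 ≤ W c ∧ W c ≤ (c.len + 4) / 2 - 1) :
    hullSet R r W =
      {z : ℂ | -(2 * r) ≤ z.re ∧ z.re ≤ 0 ∧ |z.im| ≤ psiEnv R r W z.re} := by
  have hr0 : 0 < r := hne.choose.escapeRate_pos hoff hcol hr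
  have : Nonempty {c : MCycle n R // c.affPos} := ⟨⟨_, hne.choose_spec⟩⟩
  have hL : 0 < 2 * r := by positivity
  let p : {c : MCycle n R // c.affPos} → ℂ := fun c =>
    uPoint r c.1.tanhAff (c.1.len + 3) (W c.1)
  have hhull : hullSet R r W = convexHull ℝ (symmSpan (2 * r) p) := by
    rw [hullSet, symmSpan, Set.iUnion_subtype]
  have hsin : ∀ c : {c : MCycle n R // c.affPos},
      0 < Real.sin (Real.pi * W c.1 / ((c.1.len + 3 : ℕ) : ℝ)) := fun c =>
    have h := MCycle.winding_angle_mem (hW c.1 c.2)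
    Real.sin_pos_of_pos_of_lt_pi h.1 (by linarith [h.2, Real.pi_pos])
  have hcos : ∀ c : {c : MCycle n R // c.affPos},
      0 < Real.cos (Real.pi * W c.1 / ((c.1.len + 3 : ℕ) : ℝ)) := fun c =>
    have h := MCycle.winding_angle_mem (hW c.1 c.2)
    Real.cos_pos_of_mem_Ioo ⟨by linarith [h.1, Real.pi_pos], h.2⟩
  have hre' : ∀ c, 2 * r + (p c).re =
      2 * r * Real.cos (Real.pi * W c.1 / ((c.1.len + 3 : ℕ) : ℝ)) ^ 2 := fun c => by
    rw [uPoint_re, Real.sin_sq]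
    ring
  have hre : ∀ c, (p c).re ∈ Set.Ioo (-(2 * r)) 0 := fun c => by
    have h1 := mul_pos hL (pow_pos (hsin c) 2)
    have h2 := mul_pos hL (pow_pos (hcos c) 2)
    rw [← hre'] at h2
    exact ⟨by linarith, by rw [uPoint_re]; linarith⟩
  have him : ∀ c, 0 < (p c).im := fun c => by
    rw [uPoint_im]
    have := hsin c
    have := hcos c
    have := MCycle.tanhAff_pos c.2
    positivity
  have hpsi : ∀ x ∈ Set.Ioo (-(2 * r)) 0, psiEnv R r W x =
      ⨅ τ : Set.Icc (0 : ℝ) 1, ⨆ c, (p c).im /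
        ((τ : ℝ) / -x * -(p c).re + (1 - (τ : ℝ)) / (2 * r + x) * (2 * r + (p c).re)) := by
    intro x hx
    rw [psiEnv, if_neg (by rintro (h | h); exacts [hx.1.ne' h, hx.2.ne h])]
    refine iInf_congr fun τ => iSup_congr fun c => ?_
    rw [hre', uPoint_re, uPoint_im, neg_neg,
      ← div_tan_add_cot hr0.ne' (hsin c).ne' (hcos c).ne', ← Real.tan_eq_sin_div_cos,
      ← Real.cot_eq_cos_div_sin]
    push_cast
    rfl
  rw [hhull]
  ext z
  by_cases hend : z.re = -(2 * r) ∨ z.re = 0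
  · rw [Set.mem_ofPred_eq, psiEnv, if_pos hend, abs_nonpos_iff]
    constructor
    · intro hz
      have h := re_mem_Icc_of_mem_convexHull hL.le
        (fun c => Set.Ioo_subset_Icc_self (hre c)) hz
      exact ⟨h.1, h.2, im_eq_zero_of_mem_convexHull hL hre (fun c => (him c).le) hz hend⟩
    · rintro ⟨-, -, hz⟩
      refine subset_convexHull ℝ _ (Or.inl ?_)
      rcases hend with h | h
      · exact Or.inl (Complex.ext (by simpa using h) (by simpa using hz))
      · exact Or.inr (Complex.ext (by simpa using h) (by simpa using hz))
  · push Not at hend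
    have hIoo : z.re ∈ Set.Icc (-(2 * r)) 0 → z.re ∈ Set.Ioo (-(2 * r)) 0 := fun h =>
      ⟨h.1.lt_of_ne' hend.1, h.2.lt_of_ne hend.2⟩
    constructor
    · intro hz
      have h := re_mem_Icc_of_mem_convexHull hL.le
        (fun c => Set.Ioo_subset_Icc_self (hre c)) hz
      refine ⟨h.1, h.2, ?_⟩
      rw [hpsi _ (hIoo h)]
      exact (mem_convexHull_symmSpan_iff hL hre him (hIoo h)).1 hz
    · rintro ⟨h1, h2, hz⟩
      rw [hpsi _ (hIoo ⟨h1, h2⟩)] at hz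
      exact (mem_convexHull_symmSpan_iff hL hre him (hIoo ⟨h1, h2⟩)).2 hz
end
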